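/- arXiv:2406.01404 — 2 statements merged into one kernel-verified Lean document; each statement's English description precedes it below -/
import Mathlib

section
/- Let 𝒳 be a complex Hilbert manifold, A ⊆ 𝒳 a Hilbert analytic subset of codimension ≥ 2, and C an analytic subset of pure codimension one of 𝒳 \ A. Then the closure C̄ of C is an analytic subset of 𝒳. -/
noncomputable section
open Set Metric

/-- The model separable Hilbert space ℓ². -/
abbrev EllTwo : Type := lp (fun _ : ℕ => ℂ) 2

/-- A meromorphic function on an open subset `U` of a complex normed space:
locally a quotient `h/g` of holomorphic functions with `g ≢ 0`. -/
def MeromorphicOnSet {E : Type*} [NormedAddCommGroup E] [NormedSpace ℂ E]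
    (f : E → ℂ) (U : Set E) : Prop :=
  ∀ a ∈ U, ∃ V : Set E, IsOpen V ∧ a ∈ V ∧ V ⊆ U ∧ ∃ h g : E → ℂ,
    DifferentiableOn ℂ h V ∧ DifferentiableOn ℂ g V ∧ (∃ z ∈ V, g z ≠ 0) ∧
    ∀ z ∈ V, g z ≠ 0 → f z = h z / g z

/-- A Hilbert analytic subset of an open set `U`: locally the zero set of a
holomorphic map with values in a separable complex Hilbert space. -/
def IsHilbertAnalyticIn {E : Type*} [NormedAddCommGroup E] [NormedSpace ℂ E]
    (A U : Set E) : Prop :=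
  A ⊆ U ∧ ∀ a ∈ U, ∃ V : Set E, IsOpen V ∧ a ∈ V ∧ V ⊆ U ∧
    ∃ h : E → EllTwo, DifferentiableOn ℂ h V ∧ A ∩ V = {z ∈ V | h z = 0}

/-- The germ of `A` at `a` has codimension at least `p`: there is a
`p`-dimensional linear subspace `T` such that, locally near `a`, the affine
subspace `a + T` meets `A` only at `a`. -/
def GermCodimAtLeast {E : Type*} [NormedAddCommGroup E] [NormedSpace ℂ E]
    (A : Set E) (a : E) (p : ℕ) : Prop :=
  ∃ T : Submodule ℂ E, Module.finrank ℂ T = p ∧ ∃ V : Set E, IsOpen V ∧ a ∈ V ∧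
    ∀ z ∈ A ∩ V, z - a ∈ (T : Set E) → z = a

/-- `A` contains a principal germ at `a`: the germ of the zero set of a single
holomorphic function vanishing at `a` (and not identically zero) is contained
in `A`. -/
def ContainsPrincipalGermAt {E : Type*} [NormedAddCommGroup E] [NormedSpace ℂ E]
    (A : Set E) (a : E) : Prop :=
  ∃ V : Set E, IsOpen V ∧ a ∈ V ∧ ∃ f : E → ℂ,
    DifferentiableOn ℂ f V ∧ f a = 0 ∧ (∃ z ∈ V, f z ≠ 0) ∧
    ∃ W : Set E, IsOpen W ∧ a ∈ W ∧ W ⊆ V ∧ {z ∈ W | f z = 0} ⊆ A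

namespace RemmertStein

open Filter Topology

/-- Holomorphy in a neighbourhood of a point. -/
def HolAt {G H : Type*} [NormedAddCommGroup G] [NormedSpace ℂ G] [NormedAddCommGroup H]
    [NormedSpace ℂ H] (f : G → H) (x : G) : Prop :=
  ∀ᶠ y in 𝓝 x, DifferentiableAt ℂ f y

section Holomorphic

variable {G H : Type*} [NormedAddCommGroup G] [NormedSpace ℂ G] [NormedAddCommGroup H]
  [NormedSpace ℂ H]

theorem HolAt.differentiableAt {f : G → H} {x : G} (h : HolAt f x) : DifferentiableAt ℂ f x :=
  h.self_of_nhds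

theorem HolAt.continuousAt {f : G → H} {x : G} (h : HolAt f x) : ContinuousAt f x :=
  h.differentiableAt.continuousAt

theorem HolAt.eventually {f : G → H} {x : G} (h : HolAt f x) : ∀ᶠ y in 𝓝 x, HolAt f y :=
  eventually_eventually_nhds.2 h

theorem HolAt.congr {f g : G → H} {x : G} (h : HolAt f x) (hfg : f =ᶠ[𝓝 x] g) : HolAt g x := by
  filter_upwards [h, eventually_eventually_nhds.2 hfg] with y hy hy'
  exact hy.congr_of_eventuallyEq (EventuallyEq.symm hy')

theorem holAt_of_differentiableOn {f : G → H} {V : Set G} (hf : DifferentiableOn ℂ f V)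
    (hV : IsOpen V) {x : G} (hx : x ∈ V) : HolAt f x := by
  filter_upwards [hV.mem_nhds hx] with y hy
  exact hf.differentiableAt (hV.mem_nhds hy)

theorem HolAt.mul {f g : G → ℂ} {x : G} (hf : HolAt f x) (hg : HolAt g x) :
    HolAt (fun y => f y * g y) x := by
  filter_upwards [hf, hg] with y h1 h2 using h1.mul h2

theorem HolAt.comp_of_differentiable {K : Type*} [NormedAddCommGroup K] [NormedSpace ℂ K]
    {f : G → H} {u : K → G} {x : K} (hf : HolAt f (u x)) (hu : Differentiable ℂ u) :
    HolAt (fun y => f (u y)) x := by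
  filter_upwards [hu.continuous.continuousAt.eventually hf] with y hy
  exact hy.comp y (hu y)

theorem HolAt.comp {K : Type*} [NormedAddCommGroup K] [NormedSpace ℂ K]
    {f : G → H} {u : K → G} {x : K} (hf : HolAt f (u x)) (hu : HolAt u x) :
    HolAt (fun y => f (u y)) x := by
  filter_upwards [hu, hu.continuousAt.eventually hf] with y h1 hy
  exact hy.comp y h1

theorem holAt_iff_analyticAt [CompleteSpace H] {f : ℂ → H} {z : ℂ} :
    HolAt f z ↔ AnalyticAt ℂ f z :=
  Complex.analyticAt_iff_eventually_differentiableAt.symm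

theorem HolAt.continuousAt_fderiv {f : G → ℂ} {x : G} (h : HolAt f x) :
    ContinuousAt (fderiv ℂ f) x := by
  let _ : NormedSpace ℝ G := NormedSpace.restrictScalars ℝ ℂ G
  have h1 : ∀ᶠ y in 𝓝 x, DifferentiableAt ℂ f y ∧ dist (f y) (f x) < 1 :=
    h.and (h.continuousAt.eventually (ball_mem_nhds _ one_pos))
  obtain ⟨R, hR, hB⟩ := Metric.eventually_nhds_iff_ball.1 h1
  have hsub : ∀ y ∈ ball x (R / 2), ∀ r ≤ R / 2, ball y r ⊆ ball x R := fun y hy r hr =>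
    ball_subset_ball' (by linarith [mem_ball.1 hy])
  have hbd : ∀ y ∈ ball x (R / 2), ‖fderiv ℂ f y‖ ≤ 2 / (R / 2) := by
    intro y hy
    refine Complex.norm_fderiv_le_div_of_mapsTo_ball
      (fun z hz => (hB z (hsub y hy _ le_rfl hz)).1.differentiableWithinAt) ?_ (by positivity)
    intro z hz
    have h1 := (hB z (hsub y hy _ le_rfl hz)).2
    have h2 := (hB y (ball_subset_ball (by linarith) hy)).2
    rw [mem_closedBall]
    linarith [dist_triangle_right (f z) (f y) (f x)]
  have hlip : ∀ u ∈ ball x (R / 2), ∀ v ∈ ball x (R / 2),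
      ‖f v - f u‖ ≤ 2 / (R / 2) * ‖v - u‖ := fun u hu v hv =>
    (convex_ball x (R / 2)).norm_image_sub_le_of_norm_fderiv_le
      (fun z hz => (hB z (ball_subset_ball (by linarith) hz)).1) hbd hu hv
  have key : ∀ᶠ y in 𝓝 x, dist (fderiv ℂ f y) (fderiv ℂ f x) ≤
      (2 * (2 / (R / 2) * ‖y - x‖)) / (R / 4) := by
    filter_upwards [ball_mem_nhds x (by positivity : 0 < R / 4)] with y hy
    have hyx : ∀ u ∈ ball x (R / 4), u + (y - x) ∈ ball x (R / 2) := by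
      intro u hu
      rw [mem_ball, dist_eq_norm] at *
      calc ‖u + (y - x) - x‖ = ‖(u - x) + (y - x)‖ := by congr 1; abel
        _ ≤ ‖u - x‖ + ‖y - x‖ := norm_add_le _ _
        _ < _ := by linarith
    have hsm : ∀ u ∈ ball x (R / 4), u ∈ ball x (R / 2) := fun u hu =>
      ball_subset_ball (by linarith) hu
    have hdl : ∀ u ∈ ball x (R / 4), DifferentiableAt ℂ (fun u => f (u + (y - x))) u := by
      intro u hu
      have := (hB _ (ball_subset_ball (by linarith) (hyx u hu))).1
      exact DifferentiableAt.comp u (f := fun u => u + (y - x)) this (by fun_prop)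
    have hdr : ∀ u ∈ ball x (R / 4), DifferentiableAt ℂ f u := fun u hu =>
      (hB _ (ball_subset_ball (by linarith) hu)).1
    have hx : x ∈ ball x (R / 4) := mem_ball_self (by positivity)
    have := Complex.norm_fderiv_le_div_of_mapsTo_ball
      (f := fun u => f (u + (y - x)) - f u) (c := x) (R₁ := R / 4)
      (R₂ := 2 * (2 / (R / 2) * ‖y - x‖))
      (fun u hu => ((hdl u hu).sub (hdr u hu)).differentiableWithinAt) ?_ (by positivity)
    · have e : fderiv ℂ (fun u => f (u + (y - x)) - f u) x = fderiv ℂ f y - fderiv ℂ f x := by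
        rw [fderiv_fun_sub (hdl x hx) (hdr x hx), fderiv_comp_add_right]
        simp
      rw [dist_eq_norm, ← e]
      exact this
    · intro u hu
      rw [mem_closedBall, dist_eq_norm]
      have a1 := hlip u (hsm u hu) _ (hyx u hu)
      have a2 := hlip x (hsm x hx) _ (hyx x hx)
      simp only [add_sub_cancel_left] at a1 a2
      refine (norm_sub_le _ _).trans ?_
      linarith
  refine tendsto_iff_dist_tendsto_zero.2
    (squeeze_zero' (Eventually.of_forall fun _ => dist_nonneg) key ?_)
  have : ContinuousAt (fun y => (2 * (2 / (R / 2) * ‖y - x‖)) / (R / 4)) x := by fun_prop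
  simpa [ContinuousAt] using this

/-- A circle integral depends holomorphically on parameters. -/
theorem holAt_circleIntegral {φ : G × ℂ → ℂ} {b : G} {c : ℂ} {r : ℝ} (hr : 0 ≤ r)
    (h : ∀ z ∈ sphere c r, HolAt φ (b, z)) :
    HolAt (fun b => ∮ z in C(c, r), φ (b, z)) b := by
  have hK : IsCompact (sphere c r) := isCompact_sphere c r
  have hev : ∀ᶠ b' in 𝓝 b, ∀ z ∈ sphere c r, HolAt φ (b', z) :=
    hK.eventually_forall_of_forall_eventually (P := fun b z => HolAt φ (b, z))
      fun z hz => (h z hz).eventually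
  suffices H : ∀ b, (∀ z ∈ sphere c r, HolAt φ (b, z)) →
      DifferentiableAt ℂ (fun b => ∮ z in C(c, r), φ (b, z)) b from hev.mono H
  clear hev h b
  intro b h
  have hev : ∀ᶠ b' in 𝓝 b, ∀ z ∈ sphere c r, HolAt φ (b', z) :=
    hK.eventually_forall_of_forall_eventually (P := fun b z => HolAt φ (b, z))
      fun z hz => (h z hz).eventually
  have hcont : ContinuousOn (fun z => ‖fderiv ℂ φ (b, z)‖) (sphere c r) := fun z hz =>
    (ContinuousAt.norm (ContinuousAt.comp (f := fun z : ℂ => (b, z))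
      (h z hz).continuousAt_fderiv (by fun_prop))).continuousWithinAt
  obtain ⟨M, hM⟩ := hK.bddAbove_image hcont
  have hM' : ∀ᶠ b' in 𝓝 b, ∀ z ∈ sphere c r, ‖fderiv ℂ φ (b', z)‖ ≤ M + 1 := by
    refine hK.eventually_forall_of_forall_eventually
      (P := fun b z => ‖fderiv ℂ φ (b, z)‖ ≤ M + 1) fun z hz => ?_
    have := (h z hz).continuousAt_fderiv.norm.eventually
      (Iio_mem_nhds (show ‖fderiv ℂ φ (b, z)‖ < M + 1 by
        linarith [hM (mem_image_of_mem _ hz)]))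
    filter_upwards [this] with y hy using le_of_lt hy
  have hcirc : ∀ θ, circleMap c r θ ∈ sphere c r := circleMap_mem_sphere c hr
  have hd : Continuous (deriv (circleMap c r)) := by
    have : deriv (circleMap c r) = fun θ => circleMap 0 r θ * Complex.I := by
      ext θ; exact deriv_circleMap c r θ
    rw [this]
    exact (continuous_circleMap 0 r).mul continuous_const
  have hFc : ∀ b', (∀ z ∈ sphere c r, HolAt φ (b', z)) →
      Continuous (fun θ => deriv (circleMap c r) θ • φ (b', circleMap c r θ)) := by
    intro b' hb'
    refine hd.smul (continuous_iff_continuousAt.2 fun θ => ?_)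
    exact ContinuousAt.comp (f := fun θ => (b', circleMap c r θ))
      (hb' _ (hcirc θ)).continuousAt
      (Continuous.continuousAt (by fun_prop))
  have main := intervalIntegral.hasFDerivAt_integral_of_dominated_of_fderiv_le
    (𝕜 := ℂ) (μ := MeasureTheory.volume) (a := 0) (b := 2 * Real.pi) (x₀ := b)
    (F := fun b θ => deriv (circleMap c r) θ • φ (b, circleMap c r θ))
    (F' := fun b θ => deriv (circleMap c r) θ •
      (fderiv ℂ φ (b, circleMap c r θ)).comp (ContinuousLinearMap.inl ℂ G ℂ))
    (s := {b' | (∀ z ∈ sphere c r, HolAt φ (b', z)) ∧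
      ∀ z ∈ sphere c r, ‖fderiv ℂ φ (b', z)‖ ≤ M + 1})
    (bound := fun _ => |r| * ((M + 1) * ‖ContinuousLinearMap.inl ℂ G ℂ‖))
    (hev.and hM')
    (hev.mono fun b' hb' => (hFc b' hb').aestronglyMeasurable)
    ((hFc b h).intervalIntegrable _ _) ?_ ?_ (by simp) ?_
  · exact main.differentiableAt
  · refine Continuous.aestronglyMeasurable (hd.smul (continuous_iff_continuousAt.2 fun θ => ?_))
    have : ContinuousAt (fun θ => fderiv ℂ φ (b, circleMap c r θ)) θ :=
      ContinuousAt.comp (f := fun θ => (b, circleMap c r θ))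
        (h _ (hcirc θ)).continuousAt_fderiv (Continuous.continuousAt (by fun_prop))
    exact this.clm_comp continuousAt_const
  · refine Eventually.of_forall fun θ _ b' hb' => ?_
    rw [norm_smul]
    refine mul_le_mul (by simp) ?_ (norm_nonneg _) (abs_nonneg _)
    exact (ContinuousLinearMap.opNorm_comp_le _ _).trans
      (mul_le_mul_of_nonneg_right (hb'.2 _ (hcirc θ)) (norm_nonneg _))
  · refine Eventually.of_forall fun θ _ b' hb' => ?_
    have : HasFDerivAt (fun b => φ (b, circleMap c r θ)) _ b' :=
      (hb'.1 _ (hcirc θ)).differentiableAt.hasFDerivAt.comp b'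
        (hasFDerivAt_prodMk_left b' (circleMap c r θ))
    exact this.const_smul (deriv (circleMap c r) θ)

theorem HolAt.fderiv_apply {f : G → ℂ} {x : G} (h : HolAt f x) (v : G) :
    HolAt (fun y => fderiv ℂ f y v) x := by
  have h0 : ∀ᶠ p : G × ℂ in 𝓝 (x, 0), HolAt f (p.1 + p.2 • v) := by
    have hc : ContinuousAt (fun p : G × ℂ => p.1 + p.2 • v) (x, 0) := by fun_prop
    refine hc.eventually ?_
    simpa using h.eventually
  rw [nhds_prod_eq] at h0
  obtain ⟨P, hP, Q, hQ, hPQ⟩ := eventually_prod_iff.1 h0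
  obtain ⟨ρ, hρ, hB⟩ := Metric.nhds_basis_closedBall.eventually_iff.1 hQ
  have hint : HolAt (fun y => (2 * Real.pi * Complex.I : ℂ)⁻¹ *
      ∮ w in C(0, ρ), ((w - 0) ^ 2)⁻¹ * f (y + w • v)) x := by
    refine HolAt.mul (Eventually.of_forall fun _ => differentiableAt_const _)
      (holAt_circleIntegral (φ := fun p : G × ℂ => ((p.2 - 0) ^ 2)⁻¹ * f (p.1 + p.2 • v))
        hρ.le fun z hz => ?_)
    have hz0 : z ≠ 0 := by
      rintro rfl
      simp at hz
      exact hρ.ne hz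
    refine HolAt.mul ?_ ?_
    · have : ∀ᶠ p : G × ℂ in 𝓝 (x, z), p.2 ≠ 0 :=
        ContinuousAt.eventually_ne (g := fun p : G × ℂ => p.2) (by fun_prop) hz0
      filter_upwards [this] with p hp
      exact DifferentiableAt.inv (by fun_prop) (pow_ne_zero _ (by simpa using hp))
    · exact HolAt.comp_of_differentiable (u := fun p : G × ℂ => p.1 + p.2 • v)
        (hPQ hP.self_of_nhds (hB (sphere_subset_closedBall hz))) (by fun_prop)
  refine hint.congr ?_
  filter_upwards [hP] with y hy
  have hU : IsOpen {w : ℂ | HolAt f (y + w • v)} := by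
    rw [isOpen_iff_mem_nhds]
    intro w hw
    have hc : ContinuousAt (fun w : ℂ => y + w • v) w := by fun_prop
    exact hc.eventually hw.eventually
  have hd : ∀ w ∈ {w : ℂ | HolAt f (y + w • v)}, HasDerivAt (fun w : ℂ => f (y + w • v))
      (fderiv ℂ f (y + w • v) v) w := by
    intro w hw
    have h2 : HasDerivAt (fun w : ℂ => y + w • v) v w := by
      simpa using ((hasDerivAt_id w).smul_const v).const_add y
    exact hw.differentiableAt.hasFDerivAt.comp_hasDerivAt w h2
  have hcb : closedBall (0 : ℂ) ρ ⊆ {w : ℂ | HolAt f (y + w • v)} := fun w hw => hPQ hy (hB hw)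
  have := Complex.two_pi_I_inv_smul_circleIntegral_sub_sq_inv_smul_of_differentiable hU hcb
    (fun w hw => (hd w hw).differentiableAt.differentiableWithinAt) (mem_ball_self hρ)
  rw [(hd 0 (hcb (mem_closedBall_self hρ.le))).deriv] at this
  simpa using this

end Holomorphic

section Thin

variable {F H : Type*} [NormedAddCommGroup F] [NormedSpace ℂ F] [NormedAddCommGroup H]
  [NormedSpace ℂ H]

theorem convex_line_preimage_ball (p v x : F) (R : ℝ) :
    Convex ℝ {t : ℂ | p + t • v ∈ ball x R} := by
  intro s hs t ht a c ha hc hac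
  simp only [mem_ofPred_eq, mem_ball, dist_eq_norm] at *
  have e : p + (a • s + c • t) • v - x =
      (a : ℂ) • (p + s • v - x) + (c : ℂ) • (p + t • v - x) := by
    have : (a : ℂ) + c = 1 := by exact_mod_cast hac
    have h1 : p - x = ((a : ℂ) + c) • (p - x) := by rw [this, one_smul]
    calc p + (a • s + c • t) • v - x = (p - x) + ((a : ℂ) * s + (c : ℂ) * t) • v := by
          rw [Complex.real_smul, Complex.real_smul]; abel
      _ = ((a : ℂ) + c) • (p - x) + ((a : ℂ) * s + (c : ℂ) * t) • v := by rw [← h1]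
      _ = _ := by module
  rw [e]
  refine (norm_add_le _ _).trans_lt ?_
  rw [norm_smul, norm_smul, Complex.norm_real, Complex.norm_real, Real.norm_of_nonneg ha,
    Real.norm_of_nonneg hc]
  rcases ha.eq_or_lt with rfl | ha'
  · have : c = 1 := by linarith
    subst this; simpa using ht
  · have h1 := mul_le_mul_of_nonneg_left ht.le hc
    have h2 := mul_lt_mul_of_pos_left hs ha'
    have h3 : a * R + c * R = R := by rw [← add_mul, hac, one_mul]
    linarith

theorem isOpen_line_preimage_ball (p v x : F) (R : ℝ) :
    IsOpen {t : ℂ | p + t • v ∈ ball x R} :=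
  isOpen_ball.preimage (f := fun t : ℂ => p + t • v) (by fun_prop)

theorem differentiableAt_line {f : F → H} {p v : F} {t : ℂ}
    (h : DifferentiableAt ℂ f (p + t • v)) : DifferentiableAt ℂ (fun t : ℂ => f (p + t • v)) t :=
  DifferentiableAt.comp t (f := fun t : ℂ => p + t • v) h (by fun_prop)

theorem analyticOnNhd_line [CompleteSpace H] {f : F → H} {x : F} {R : ℝ}
    (hf : ∀ y ∈ ball x R, DifferentiableAt ℂ f y) (p v : F) :
    AnalyticOnNhd ℂ (fun t : ℂ => f (p + t • v)) {t : ℂ | p + t • v ∈ ball x R} :=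
  DifferentiableOn.analyticOnNhd
    (fun _ ht => (differentiableAt_line (hf _ ht)).differentiableWithinAt)
    (isOpen_line_preimage_ball p v x R)

theorem eq_zero_of_eventuallyEq_zero [CompleteSpace H] {f : F → H} {x : F} {R : ℝ}
    (hf : ∀ y ∈ ball x R, DifferentiableAt ℂ f y) {p : F} (hp : p ∈ ball x R)
    (h0 : ∀ᶠ y in 𝓝 p, f y = 0) {y : F} (hy : y ∈ ball x R) : f y = 0 := by
  have ha := analyticOnNhd_line hf p (y - p)
  have hev : (fun t : ℂ => f (p + t • (y - p))) =ᶠ[𝓝 0] 0 := by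
    have hc : ContinuousAt (fun t : ℂ => p + t • (y - p)) 0 := by fun_prop
    have := hc.eventually (p := fun y => f y = 0) (by simpa using h0)
    exact this
  have := ha.eqOn_zero_of_preconnected_of_eventuallyEq_zero
    (convex_line_preimage_ball p (y - p) x R).isPreconnected (by simpa using hp) hev
    (show (1 : ℂ) ∈ _ by simpa using hy)
  simpa using this

theorem HolAt.exists_ball {f : F → H} {x : F} (h : HolAt f x) :
    ∃ R > 0, ∀ y ∈ ball x R, DifferentiableAt ℂ f y :=
  Metric.eventually_nhds_iff_ball.1 h

theorem HolAt.eventually_frequently_ne [CompleteSpace H] {f : F → H} {x : F} (h : HolAt f x)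
    (hne : ∃ᶠ y in 𝓝 x, f y ≠ 0) : ∀ᶠ y in 𝓝 x, ∃ᶠ z in 𝓝 y, f z ≠ 0 := by
  obtain ⟨R, hR, hB⟩ := h.exists_ball
  filter_upwards [ball_mem_nhds x hR] with y hy
  intro hz
  refine hne ?_
  filter_upwards [ball_mem_nhds x hR] with z hz'
  exact not_not.2 (eq_zero_of_eventuallyEq_zero hB hy (hz.mono fun _ => not_not.1) hz')

theorem HolAt.exists_line_ne [CompleteSpace H] {f : F → H} {x : F} (h : HolAt f x)
    (hne : ∃ᶠ y in 𝓝 x, f y ≠ 0) :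
    ∃ m : F, ∀ᶠ t in 𝓝[≠] (0 : ℂ), f (x + t • m) ≠ 0 := by
  obtain ⟨R, hR, hB⟩ := h.exists_ball
  obtain ⟨y, hy, hyR⟩ := (hne.and_eventually (ball_mem_nhds x hR)).exists
  refine ⟨y - x, ?_⟩
  have ha := analyticOnNhd_line hB x (y - x)
  have h0 : (0 : ℂ) ∈ {t : ℂ | x + t • (y - x) ∈ ball x R} := by simpa using hR
  rcases (ha 0 h0).eventually_eq_zero_or_eventually_ne_zero with h1 | h1
  · have := ha.eqOn_zero_of_preconnected_of_eventuallyEq_zero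
      (convex_line_preimage_ball x (y - x) x R).isPreconnected h0 h1
      (show (1 : ℂ) ∈ _ by simpa [dist_eq_norm] using hyR)
    exact absurd (by simpa using this) hy
  · exact h1

/-- A set contained near `b` in the zero set of a nontrivial holomorphic function. -/
def ThinAt (P : Set F) (b : F) : Prop :=
  ∃ s : F → ℂ, HolAt s b ∧ (∃ᶠ y in 𝓝 b, s y ≠ 0) ∧ ∀ᶠ y in 𝓝 b, y ∈ P → s y = 0

theorem ThinAt.mono_eventually {P Q : Set F} {b : F} (h : ThinAt P b)
    (hPQ : ∀ᶠ y in 𝓝 b, y ∈ Q → y ∈ P) : ThinAt Q b := by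
  obtain ⟨s, h1, h2, h3⟩ := h
  exact ⟨s, h1, h2, by filter_upwards [h3, hPQ] with y h3 h4 h5 using h3 (h4 h5)⟩

theorem ThinAt.mono {P Q : Set F} {b : F} (h : ThinAt P b) (hPQ : Q ⊆ P) : ThinAt Q b :=
  h.mono_eventually (Eventually.of_forall fun _ hy => hPQ hy)

theorem thinAt_empty (b : F) : ThinAt (∅ : Set F) b :=
  ⟨fun _ => 1, Eventually.of_forall fun _ => differentiableAt_const _,
    (Eventually.of_forall fun _ => one_ne_zero).frequently, Eventually.of_forall fun _ h => h.elim⟩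

theorem ThinAt.eventually {P : Set F} {b : F} (h : ThinAt P b) : ∀ᶠ y in 𝓝 b, ThinAt P y := by
  obtain ⟨s, h1, h2, h3⟩ := h
  filter_upwards [h1.eventually, h1.eventually_frequently_ne h2,
    eventually_eventually_nhds.2 h3] with y h1 h2 h3
  exact ⟨s, h1, h2, h3⟩

theorem ThinAt.frequently_notMem {P : Set F} {b : F} (h : ThinAt P b) : ∃ᶠ y in 𝓝 b, y ∉ P := by
  obtain ⟨s, h1, h2, h3⟩ := h
  exact (h2.and_eventually h3).mono fun y h4 h5 => h4.1 (h4.2 h5)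

theorem ThinAt.union {P Q : Set F} {b : F} (hP : ThinAt P b) (hQ : ThinAt Q b) :
    ThinAt (P ∪ Q) b := by
  obtain ⟨s, h1, h2, h3⟩ := hP
  obtain ⟨t, k1, k2, k3⟩ := hQ
  refine ⟨fun y => s y * t y, h1.mul k1, ?_, ?_⟩
  · rw [← frequently_frequently_nhds] at h2
    have h5 : ∃ᶠ y in 𝓝 b, ∃ᶠ z in 𝓝 y, s z * t z ≠ 0 := by
      rw [frequently_frequently_nhds] at h2
      have h6 := h2.and_eventually (h1.eventually.and (k1.eventually_frequently_ne k2))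
      refine h6.mono fun y ⟨hy1, hy2, hy3⟩ => ?_
      exact (hy3.and_eventually (hy2.continuousAt.eventually_ne hy1)).mono
        fun z hz => mul_ne_zero hz.2 hz.1
    exact frequently_frequently_nhds.1 h5
  · filter_upwards [h3, k3] with y h3 k3
    rintro (h | h)
    · simp [h3 h]
    · simp [k3 h]

theorem ThinAt.preimage_fst {G : Type*} [NormedAddCommGroup G] [NormedSpace ℂ G] {P : Set F}
    {b : F × G} (h : ThinAt P b.1) : ThinAt (Prod.fst ⁻¹' P) b := by
  obtain ⟨s, h1, h2, h3⟩ := h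
  refine ⟨fun y => s y.1, HolAt.comp_of_differentiable (u := Prod.fst) h1 differentiable_fst,
    ?_, continuousAt_fst.eventually h3⟩
  intro h
  have : ∀ᶠ y in 𝓝 b.1, s y = 0 := by
    have hc : ContinuousAt (fun y : F => (y, b.2)) b.1 := by fun_prop
    exact (hc.eventually h).mono fun y hy => not_not.1 hy
  exact h2 (this.mono fun _ h => not_not.2 h)

/-- One-variable removal of isolated singularities. -/
theorem differentiableAt_limUnder {u : ℂ → ℂ} {t : ℂ}
    (hd : ∀ᶠ τ in 𝓝[≠] t, DifferentiableAt ℂ u τ) {M : ℝ} (hb : ∀ᶠ τ in 𝓝[≠] t, ‖u τ‖ ≤ M) :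
    DifferentiableAt ℂ (fun t => limUnder (𝓝[≠] t) u) t := by
  have h := (eventually_nhdsWithin_iff.1 (hd.and hb))
  obtain ⟨R, hR, hB⟩ := Metric.eventually_nhds_iff_ball.1 h
  have h1 := Complex.differentiableOn_update_limUnder_of_bddAbove (ball_mem_nhds t hR)
    (f := u) (fun z hz => (hB z hz.1 hz.2).1.differentiableWithinAt)
    ⟨M, by rintro _ ⟨z, hz, rfl⟩; exact (hB z hz.1 hz.2).2⟩
  refine (h1.differentiableAt (ball_mem_nhds t hR)).congr_of_eventuallyEq ?_
  filter_upwards [ball_mem_nhds t hR] with z hz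
  rcases eq_or_ne z t with rfl | hzt
  · simp
  · rw [Function.update_of_ne hzt]
    exact ((hB z hz hzt).1.continuousAt.tendsto.mono_left nhdsWithin_le_nhds).limUnder_eq

theorem exists_local_extension {N : Set F} {b : F} (hN : ThinAt N b) {f : F → ℂ}
    (hf : ∀ᶠ y in 𝓝 b, y ∉ N → DifferentiableAt ℂ f y) {M : ℝ}
    (hM : ∀ᶠ y in 𝓝 b, y ∉ N → ‖f y‖ ≤ M) :
    ∃ g : F → ℂ, HolAt g b ∧ ∀ᶠ y in 𝓝 b, y ∉ N → g y = f y := by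
  obtain ⟨s, h1, h2, h3⟩ := hN
  obtain ⟨m, hm⟩ := h1.exists_line_ne h2
  obtain ⟨R, hR, hB⟩ := Metric.eventually_nhds_iff_ball.1 (h1.and (h3.and (hf.and hM)))
  have hin : ∀ᶠ t : ℂ in 𝓝 0, b + t • m ∈ ball b R :=
    (isOpen_line_preimage_ball b m b R).mem_nhds (by simpa using hR)
  obtain ⟨r, hr, hrB⟩ := Metric.nhds_basis_closedBall.eventually_iff.1
    (hin.and (eventually_nhdsWithin_iff.1 hm))
  have hs0 : ∀ t ∈ sphere (0 : ℂ) r, s (b + t • m) ≠ 0 := by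
    intro t ht
    refine (hrB (sphere_subset_closedBall ht)).2 ?_
    rintro rfl
    simp at ht
    exact hr.ne ht
  have hU1 : ∀ᶠ b' in 𝓝 b, ∀ t ∈ closedBall (0 : ℂ) r, b' + t • m ∈ ball b R := by
    refine (isCompact_closedBall (0 : ℂ) r).eventually_forall_of_forall_eventually
      (P := fun b' t => b' + t • m ∈ ball b R) fun t ht => ?_
    have hc : ContinuousAt (fun p : F × ℂ => p.1 + p.2 • m) (b, t) := by fun_prop
    exact hc.eventually (isOpen_ball.mem_nhds (hrB ht).1)
  have hsev : ∀ b', (∀ t ∈ closedBall (0 : ℂ) r, b' + t • m ∈ ball b R) →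
      ∀ t ∈ sphere (0 : ℂ) r, s (b' + t • m) ≠ 0 →
      ∀ᶠ p : F × ℂ in 𝓝 (b', t), p.1 + p.2 • m ∈ ball b R ∧ s (p.1 + p.2 • m) ≠ 0 := by
    intro b' hb' t ht hst
    have hc : ContinuousAt (fun p : F × ℂ => p.1 + p.2 • m) (b', t) := by fun_prop
    refine (hc.eventually (isOpen_ball.mem_nhds (hb' t (sphere_subset_closedBall ht)))).and ?_
    exact hc.eventually ((hB _ (hb' t (sphere_subset_closedBall ht))).1.continuousAt.eventually_ne
      hst)
  have hbb : ∀ t ∈ closedBall (0 : ℂ) r, b + t • m ∈ ball b R := fun t ht => (hrB ht).1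
  have hU2 : ∀ᶠ b' in 𝓝 b, ∀ t ∈ sphere (0 : ℂ) r, s (b' + t • m) ≠ 0 :=
    (isCompact_sphere (0 : ℂ) r).eventually_forall_of_forall_eventually
      (P := fun b' t => s (b' + t • m) ≠ 0) fun t ht =>
        (hsev b hbb t ht (hs0 t ht)).mono fun _ h => h.2
  refine ⟨fun b' => (2 * Real.pi * Complex.I : ℂ)⁻¹ *
      ∮ w in C(0, r), (w - 0)⁻¹ * f (b' + w • m), ?_, ?_⟩
  · refine HolAt.mul (Eventually.of_forall fun _ => differentiableAt_const _)
      (holAt_circleIntegral (φ := fun p : F × ℂ => (p.2 - 0)⁻¹ * f (p.1 + p.2 • m))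
        hr.le fun z hz => ?_)
    have hz0 : z ≠ 0 := by
      rintro rfl
      simp at hz
      exact hr.ne hz
    refine HolAt.mul ?_ ?_
    · have : ∀ᶠ p : F × ℂ in 𝓝 (b, z), p.2 ≠ 0 :=
        ContinuousAt.eventually_ne (g := fun p : F × ℂ => p.2) (by fun_prop) hz0
      filter_upwards [this] with p hp
      exact DifferentiableAt.inv (by fun_prop) (by simpa using hp)
    · filter_upwards [hsev b hbb z hz (hs0 z hz)] with p hp
      have hd : DifferentiableAt ℂ f (p.1 + p.2 • m) :=
        (hB _ hp.1).2.2.1 fun hpN => hp.2 ((hB _ hp.1).2.1 hpN)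
      exact DifferentiableAt.comp p (f := fun p : F × ℂ => p.1 + p.2 • m) hd (by fun_prop)
  · filter_upwards [hU1, hU2] with b' hb1 hb2 hbN
    set O := {t : ℂ | b' + t • m ∈ ball b R} with hO
    have hOo : IsOpen O := isOpen_line_preimage_ball b' m b R
    have ha : AnalyticOnNhd ℂ (fun t : ℂ => s (b' + t • m)) O :=
      analyticOnNhd_line (fun y hy => (hB y hy).1) b' m
    have hrs : (r : ℂ) ∈ sphere (0 : ℂ) r := by simp [abs_of_pos hr]
    have hiso : ∀ t ∈ O, ∀ᶠ τ in 𝓝[≠] t, s (b' + τ • m) ≠ 0 := by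
      intro t ht
      refine (ha t ht).eventually_eq_zero_or_eventually_ne_zero.resolve_left fun h0 => ?_
      exact hb2 r hrs (ha.eqOn_zero_of_preconnected_of_eventuallyEq_zero
        (convex_line_preimage_ball b' m b R).isPreconnected ht h0
        (hb1 r (sphere_subset_closedBall hrs)))
    have hNs : ∀ y ∈ ball b R, s y ≠ 0 → y ∉ N := fun y hy hsy hyN => hsy ((hB y hy).2.1 hyN)
    set u : ℂ → ℂ := fun t => f (b' + t • m) with hu
    have hud : ∀ t ∈ O, b' + t • m ∉ N → DifferentiableAt ℂ u t := fun t ht htN =>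
      differentiableAt_line ((hB _ ht).2.2.1 htN)
    set v : ℂ → ℂ := fun t => limUnder (𝓝[≠] t) u with hv
    have hvd : ∀ t ∈ O, DifferentiableAt ℂ v t := by
      intro t ht
      have hev : ∀ᶠ τ in 𝓝[≠] t, τ ∈ O ∧ s (b' + τ • m) ≠ 0 :=
        (eventually_nhdsWithin_of_eventually_nhds (hOo.eventually_mem ht)).and (hiso t ht)
      refine differentiableAt_limUnder (M := M) ?_ ?_
      · filter_upwards [hev] with τ hτ using hud τ hτ.1 (hNs _ hτ.1 hτ.2)
      · filter_upwards [hev] with τ hτ using (hB _ hτ.1).2.2.2 (hNs _ hτ.1 hτ.2)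
    have huv : ∀ t ∈ O, b' + t • m ∉ N → v t = u t := fun t ht htN =>
      ((hud t ht htN).continuousAt.tendsto.mono_left nhdsWithin_le_nhds).limUnder_eq
    have hcau := Complex.two_pi_I_inv_smul_circleIntegral_sub_inv_smul_of_differentiable_on_off_countable
      (c := (0 : ℂ)) (R := r) (w := 0) (f := v) countable_empty (mem_ball_self hr)
      (fun t ht => (hvd t (hb1 t ht)).continuousAt.continuousWithinAt)
      (fun t ht => hvd t (hb1 t (ball_subset_closedBall ht.1)))
    have h0 : (0 : ℂ) ∈ O := hb1 0 (mem_closedBall_self hr.le)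
    rw [huv 0 h0 (by simpa using hbN)] at hcau
    simp only [hu, zero_smul, add_zero] at hcau
    rw [← hcau, smul_eq_mul]
    congr 1
    refine circleIntegral.integral_congr hr.le fun t ht => ?_
    have htc := hb1 t (sphere_subset_closedBall ht)
    simp only [smul_eq_mul]
    rw [huv t htc (hNs _ htc (hb2 t ht))]

/-- Riemann's extension theorem across thin sets. -/
theorem exists_extension {Ω N : Set F} (hΩ : IsOpen Ω) (hN : ∀ b ∈ Ω, ThinAt N b) {f : F → ℂ}
    (hf : ∀ y ∈ Ω, y ∉ N → DifferentiableAt ℂ f y)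
    (hM : ∀ b ∈ Ω, ∃ M : ℝ, ∀ᶠ y in 𝓝 b, y ∉ N → ‖f y‖ ≤ M) :
    ∃ g : F → ℂ, (∀ b ∈ Ω, HolAt g b) ∧ ∀ b ∈ Ω, b ∉ N → g b = f b := by
  refine ⟨fun b => limUnder (𝓝[Nᶜ] b) f, fun b hb => ?_, fun b hb hbN => ?_⟩
  · obtain ⟨M, hM⟩ := hM b hb
    obtain ⟨g, hg, hgf⟩ := exists_local_extension (hN b hb)
      (by filter_upwards [hΩ.mem_nhds hb] with y hy using hf y hy) hM
    refine hg.congr ?_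
    filter_upwards [hg.eventually, eventually_eventually_nhds.2 hgf, hΩ.mem_nhds hb]
      with y hy1 hy2 hy3
    have : (𝓝[Nᶜ] y).NeBot := by
      rw [← mem_closure_iff_nhdsWithin_neBot, mem_closure_iff_frequently]
      exact (hN y hy3).frequently_notMem
    refine (Tendsto.limUnder_eq ?_).symm
    refine (hy1.continuousAt.tendsto.mono_left nhdsWithin_le_nhds).congr' ?_
    exact eventually_nhdsWithin_iff.2 hy2
  · have : (𝓝[Nᶜ] b).NeBot := by
      rw [← mem_closure_iff_nhdsWithin_neBot, mem_closure_iff_frequently]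
      exact (hN b hb).frequently_notMem
    exact ((hf b hb hbN).continuousAt.tendsto.mono_left nhdsWithin_le_nhds).limUnder_eq

theorem isPreconnected_diff_thin {Ω N : Set F} (hΩ : IsOpen Ω) (hc : IsPreconnected Ω)
    (hN : ∀ b ∈ Ω, ThinAt N b) (ho : IsOpen (Ω \ N)) : IsPreconnected (Ω \ N) := by
  refine isPreconnected_of_forall_constant fun φ hφ x hx y hy => ?_
  classical
  have hloc : ∀ z ∈ Ω \ N, ∀ᶠ w in 𝓝 z, φ w = φ z := fun z hz =>
    (hφ.continuousAt (ho.mem_nhds hz)).eventually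
      ((isOpen_discrete {φ z}).eventually_mem rfl)
  obtain ⟨g, hg, hgf⟩ := exists_extension hΩ hN (f := fun z => if φ z then 1 else 0)
    (fun z hz hzN => (differentiableAt_const (if φ z then (1 : ℂ) else 0)).congr_of_eventuallyEq
      ((hloc z ⟨hz, hzN⟩).mono fun w hw => by simp only [hw]))
    (fun b _ => ⟨1, Eventually.of_forall fun z _ => by split_ifs <;> simp⟩)
  have hmaps : MapsTo g Ω ({0, 1} : Set ℂ) := by
    intro z hz
    have hcl : IsClosed ({0, 1} : Set ℂ) := (Set.toFinite _).isClosed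
    by_contra h
    refine (hN z hz).frequently_notMem ?_
    filter_upwards [(hg z hz).continuousAt.eventually (hcl.isOpen_compl.mem_nhds h),
      hΩ.mem_nhds hz] with w hw hwΩ
    intro hwN
    refine hw ?_
    rw [hgf w hwΩ hwN]
    split_ifs <;> simp
  have hgc : ContinuousOn g Ω := fun z hz => (hg z hz).continuousAt.continuousWithinAt
  have := hc.image g hgc
  have hsub : (g '' Ω).Subsingleton :=
    (((Set.toFinite ({0, 1} : Set ℂ)).subset hmaps.image_subset).countable.isTotallyDisconnected)
      _ subset_rfl this
  have e := hsub (mem_image_of_mem g hx.1) (mem_image_of_mem g hy.1)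
  rw [hgf x hx.1 hx.2, hgf y hy.1 hy.2] at e
  revert e
  cases φ x <;> cases φ y <;> simp

end Thin

section ArgumentPrinciple

variable {c : ℂ} {r : ℝ}

theorem argument_principle_aux (hr : 0 < r) (Z : Finset ℂ) : ∀ f : ℂ → ℂ,
    (∀ z ∈ closedBall c r, AnalyticAt ℂ f z) → (∀ z ∈ sphere c r, f z ≠ 0) →
    (∀ z, z ∈ Z ↔ z ∈ closedBall c r ∧ f z = 0) →
    ∃ m : ℂ → ℕ, (∀ z ∈ Z, 0 < m z) ∧
      ∀ φ : ℂ → ℂ, (∀ z ∈ closedBall c r, DifferentiableAt ℂ φ z) →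
        ∮ z in C(c, r), φ z * (deriv f z / f z) =
          2 * Real.pi * Complex.I * ∑ z ∈ Z, m z * φ z := by
  induction Z using Finset.induction_on with
  | empty =>
    intro f hf hs hZ
    refine ⟨fun _ => 0, by simp, fun φ hφ => ?_⟩
    have h0 : ∀ z ∈ closedBall c r, f z ≠ 0 := fun z hz h => by
      have := (hZ z).2 ⟨hz, h⟩
      simp at this
    have hd : ∀ z ∈ closedBall c r, DifferentiableAt ℂ (fun z => φ z * (deriv f z / f z)) z :=
      fun z hz => (hφ z hz).mul
        ((hf z hz).deriv.differentiableAt.div (hf z hz).differentiableAt (h0 z hz))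
    rw [Complex.circleIntegral_eq_zero_of_differentiable_on_off_countable hr.le countable_empty
      (fun z hz => (hd z hz).continuousAt.continuousWithinAt)
      (fun z hz => hd z (ball_subset_closedBall hz.1))]
    simp
  | insert ζ Z hζ ih =>
    intro f hf hs hZ
    obtain ⟨hζc, hζ0⟩ := (hZ ζ).1 (Finset.mem_insert_self _ _)
    have hrs : c + r ∈ sphere c r := by simp [abs_of_pos hr]
    have hnz : ¬ ∀ᶠ z in 𝓝 ζ, f z = 0 := fun h => by
      have := AnalyticOnNhd.eqOn_zero_of_preconnected_of_eventuallyEq_zero (fun z hz => hf z hz)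
        (convex_closedBall c r).isPreconnected hζc h (sphere_subset_closedBall hrs)
      exact hs _ hrs this
    obtain ⟨n, g, hg, hg0, hfg⟩ := (hf ζ hζc).exists_eventuallyEq_pow_smul_nonzero_iff.2 hnz
    have hn : n ≠ 0 := by
      rintro rfl
      have := hfg.self_of_nhds
      simp [hζ0] at this
      exact hg0 this.symm
    set h : ℂ → ℂ := Function.update (fun z => f z / (z - ζ) ^ n) ζ (g ζ) with hh
    have hhz : ∀ z, z ≠ ζ → h z = f z / (z - ζ) ^ n := fun z hz => by
      rw [hh, Function.update_of_ne hz]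
    have hhζ : h ζ = g ζ := by rw [hh, Function.update_self]
    have hhg : g =ᶠ[𝓝 ζ] h := by
      filter_upwards [hfg] with z hz
      rcases eq_or_ne z ζ with rfl | hne
      · exact hhζ.symm
      · rw [hhz z hne, hz, smul_eq_mul, mul_div_cancel_left₀]
        exact pow_ne_zero _ (sub_ne_zero.2 hne)
    have hha : ∀ z ∈ closedBall c r, AnalyticAt ℂ h z := by
      intro z hz
      rcases eq_or_ne z ζ with rfl | hne
      · exact hg.congr hhg
      · have h1 : AnalyticAt ℂ (fun z => f z / (z - ζ) ^ n) z :=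
          (hf z hz).div (by fun_prop) (pow_ne_zero _ (sub_ne_zero.2 hne))
        refine h1.congr ?_
        filter_upwards [isOpen_ne.mem_nhds hne] with w hw using (hhz w hw).symm
    have hζs : ∀ z ∈ sphere c r, z ≠ ζ := by
      rintro z hz rfl
      exact hs z hz hζ0
    obtain ⟨m, hm, hI⟩ := ih h hha
      (fun z hz => by
        rw [hhz z (hζs z hz)]
        exact div_ne_zero (hs z hz) (pow_ne_zero _ (sub_ne_zero.2 (hζs z hz))))
      (fun z => by
        rcases eq_or_ne z ζ with rfl | hne
        · simp [hζ, hhζ, hg0]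
        · rw [hhz z hne, div_eq_zero_iff, or_iff_left (pow_ne_zero _ (sub_ne_zero.2 hne)), ← hZ]
          simp [hne])
    refine ⟨Function.update m ζ n, ?_, fun φ hφ => ?_⟩
    · intro z hz
      rcases eq_or_ne z ζ with rfl | hne
      · simpa using Nat.pos_of_ne_zero hn
      · rw [Function.update_of_ne hne]
        exact hm z ((Finset.mem_insert.1 hz).resolve_left hne)
    have hζb : ζ ∈ ball c r := by
      rcases (mem_closedBall.1 hζc).lt_or_eq with h | h
      · exact h
      · exact absurd rfl (hζs ζ h)
    have hlog : ∀ z ∈ sphere c r, φ z * (deriv f z / f z) =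
        n * ((z - ζ)⁻¹ • φ z) + φ z * (deriv h z / h z) := by
      intro z hz
      have hne := hζs z hz
      have hsub := sub_ne_zero.2 hne
      have hev : (fun w => (w - ζ) ^ n * h w) =ᶠ[𝓝 z] f := by
        filter_upwards [isOpen_ne.mem_nhds hne] with w hw
        rw [hhz w hw, mul_div_cancel₀]
        exact pow_ne_zero _ (sub_ne_zero.2 hw)
      have hdh := (hha z (sphere_subset_closedBall hz)).differentiableAt.hasDerivAt
      have hd : HasDerivAt (fun w => (w - ζ) ^ n * h w) _ z :=
        (((hasDerivAt_id z).sub_const ζ).pow n).mul hdh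
      have e1 := hev.deriv_eq.symm.trans hd.deriv
      have e2 : f z = (z - ζ) ^ n * h z := hev.self_of_nhds.symm
      have hh0 : h z ≠ 0 := fun h0 => hs z hz (by rw [e2, h0, mul_zero])
      rw [e1, e2]
      obtain ⟨k, rfl⟩ := Nat.exists_eq_succ_of_ne_zero hn
      simp only [id, Nat.succ_eq_add_one, Nat.add_sub_cancel, smul_eq_mul, Pi.pow_apply]
      field_simp
      ring
    rw [circleIntegral.integral_congr hr.le hlog, circleIntegral.integral_add,
      circleIntegral.integral_const_mul,
      Complex.circleIntegral_sub_inv_smul_of_differentiable_on_off_countable countable_empty hζb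
        (fun z hz => (hφ z hz).continuousAt.continuousWithinAt)
        (fun z hz => hφ z (ball_subset_closedBall hz.1)), hI φ hφ, Finset.sum_insert hζ]
    · have e : ∑ z ∈ Z, (Function.update m ζ n z : ℂ) * φ z = ∑ z ∈ Z, (m z : ℂ) * φ z :=
        Finset.sum_congr rfl fun z hz => by
          rw [Function.update_of_ne (show z ≠ ζ by rintro rfl; exact hζ hz)]
      rw [Function.update_self, smul_eq_mul, e]
      ring
    · refine ContinuousOn.circleIntegrable hr.le fun z hz => ContinuousAt.continuousWithinAt ?_
      have := (hφ z (sphere_subset_closedBall hz)).continuousAt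
      have hsub := sub_ne_zero.2 (hζs z hz)
      fun_prop (disch := assumption)
    · refine ContinuousOn.circleIntegrable hr.le fun z hz => ContinuousAt.continuousWithinAt ?_
      have hz' := sphere_subset_closedBall hz
      refine (hφ z hz').continuousAt.mul
        ((hha z hz').deriv.continuousAt.div (hha z hz').continuousAt ?_)
      rw [hhz z (hζs z hz)]
      exact div_ne_zero (hs z hz) (pow_ne_zero _ (sub_ne_zero.2 (hζs z hz)))

theorem finite_zeros (hr : 0 < r) {f : ℂ → ℂ} (hf : ∀ z ∈ closedBall c r, AnalyticAt ℂ f z)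
    (hs : ∀ z ∈ sphere c r, f z ≠ 0) : {z | z ∈ closedBall c r ∧ f z = 0}.Finite := by
  have hrs : c + r ∈ sphere c r := by simp [abs_of_pos hr]
  refine (isCompact_closedBall c r).induction_on (p := fun S => {z | z ∈ S ∧ f z = 0}.Finite)
    (by simp) (fun S T hST hT => hT.subset fun z hz => ⟨hST hz.1, hz.2⟩)
    (fun S T hS hT => (hS.union hT).subset ?_) fun z hz => ?_
  · rintro z ⟨hz | hz, h⟩
    · exact Or.inl ⟨hz, h⟩
    · exact Or.inr ⟨hz, h⟩
  · rcases (hf z hz).eventually_eq_zero_or_eventually_ne_zero with h | h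
    · exact absurd (AnalyticOnNhd.eqOn_zero_of_preconnected_of_eventuallyEq_zero
        (fun z hz => hf z hz) (convex_closedBall c r).isPreconnected hz h
        (sphere_subset_closedBall hrs)) (hs _ hrs)
    · refine ⟨_, mem_nhdsWithin_of_mem_nhds (eventually_nhdsWithin_iff.1 h),
        (finite_singleton z).subset ?_⟩
      rintro w ⟨hw, hw0⟩
      by_contra hne
      exact hw hne hw0

/-- The argument principle with a holomorphic weight. -/
theorem argument_principle (hr : 0 < r) {f : ℂ → ℂ}
    (hf : ∀ z ∈ closedBall c r, AnalyticAt ℂ f z) (hs : ∀ z ∈ sphere c r, f z ≠ 0) :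
    ∃ (Z : Finset ℂ) (m : ℂ → ℕ), (∀ z, z ∈ Z ↔ z ∈ ball c r ∧ f z = 0) ∧ (∀ z ∈ Z, 0 < m z) ∧
      ∀ φ : ℂ → ℂ, (∀ z ∈ closedBall c r, DifferentiableAt ℂ φ z) →
        (2 * Real.pi * Complex.I)⁻¹ * ∮ z in C(c, r), φ z * (deriv f z / f z) =
          ∑ z ∈ Z, m z * φ z := by
  obtain ⟨m, hm, h⟩ := argument_principle_aux hr (finite_zeros hr hf hs).toFinset f hf hs (by simp)
  refine ⟨_, m, fun z => ?_, hm, fun φ hφ => ?_⟩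
  · simp only [Finite.mem_toFinset, mem_ofPred_eq, mem_ball, mem_closedBall]
    refine ⟨fun hz => ⟨hz.1.lt_of_ne fun h => hs z h hz.2, hz.2⟩, fun hz => ⟨hz.1.le, hz.2⟩⟩
  · rw [h φ hφ, inv_mul_cancel_left₀ Complex.two_pi_I_ne_zero]

end ArgumentPrinciple

section Sheets

variable {F : Type*} [NormedAddCommGroup F] [NormedSpace ℂ F]

theorem holAt_const {G H : Type*} [NormedAddCommGroup G] [NormedSpace ℂ G] [NormedAddCommGroup H]
    [NormedSpace ℂ H] (a : H) (x : G) : HolAt (fun _ => a) x :=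
  Eventually.of_forall fun _ => differentiableAt_const _

theorem HolAt.div {f g : F → ℂ} {x : F} (hf : HolAt f x) (hg : HolAt g x) (h0 : g x ≠ 0) :
    HolAt (fun y => f y / g y) x := by
  filter_upwards [hf, hg, hg.continuousAt.eventually_ne h0] with y h1 h2 h3
  simp only [div_eq_mul_inv]
  exact h1.mul (h2.inv h3)

/-- Near `x` the set `C` is a graph over the base, or empty. -/
def GraphAt (C : Set (F × ℂ)) (x : F × ℂ) : Prop :=
  ∃ ζ : F → ℂ, HolAt ζ x.1 ∧ ∀ᶠ y in 𝓝 x, (y ∈ C ↔ y.2 = ζ y.1)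

theorem GraphAt.eventually {C : Set (F × ℂ)} {x : F × ℂ} (h : GraphAt C x) :
    ∀ᶠ y in 𝓝 x, GraphAt C y := by
  obtain ⟨ζ, h1, h2⟩ := h
  filter_upwards [continuousAt_fst.eventually h1.eventually, eventually_eventually_nhds.2 h2]
    with y h1 h2 using ⟨ζ, h1, h2⟩

theorem GraphAt.congr {C D : Set (F × ℂ)} {x : F × ℂ} (h : GraphAt C x)
    (hCD : ∀ᶠ y in 𝓝 x, (y ∈ C ↔ y ∈ D)) : GraphAt D x := by
  obtain ⟨ζ, h1, h2⟩ := h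
  exact ⟨ζ, h1, by filter_upwards [h2, hCD] with y h2 h3 using h3.symm.trans h2⟩

theorem graphAt_of_eventually_notMem {C : Set (F × ℂ)} {x : F × ℂ} (h : ∀ᶠ y in 𝓝 x, y ∉ C) :
    GraphAt C x := by
  refine ⟨fun _ => x.2 + 1, holAt_const _ _, ?_⟩
  have : ∀ᶠ y in 𝓝 x, y.2 ≠ x.2 + 1 :=
    ContinuousAt.eventually_ne (g := fun y : F × ℂ => y.2) (by fun_prop) (by simp)
  filter_upwards [h, this] with y h1 h2
  simp [h1, h2]

/-- `g` is holomorphic near the closed disc over `b` and does not vanish on its boundary. -/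
def GoodDisc (g : F × ℂ → ℂ) (c : ℂ) (r : ℝ) (b : F) : Prop :=
  (∀ z ∈ closedBall c r, HolAt g (b, z)) ∧ ∀ z ∈ sphere c r, g (b, z) ≠ 0

theorem GoodDisc.eventually {g : F × ℂ → ℂ} {c : ℂ} {r : ℝ} {b : F} (h : GoodDisc g c r b) :
    ∀ᶠ b' in 𝓝 b, GoodDisc g c r b' :=
  ((isCompact_closedBall c r).eventually_forall_of_forall_eventually
    (P := fun b z => HolAt g (b, z)) fun z hz => (h.1 z hz).eventually).and
  ((isCompact_sphere c r).eventually_forall_of_forall_eventually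
    (P := fun b z => g (b, z) ≠ 0) fun z hz =>
      (h.1 z (sphere_subset_closedBall hz)).continuousAt.eventually_ne (h.2 z hz))

/-- The sum of `φ` over the zeros of `g (b, ·)` in a disc, with multiplicities. -/
def zeroSum (g : F × ℂ → ℂ) (c : ℂ) (r : ℝ) (φ : ℂ → ℂ) (b : F) : ℂ :=
  (2 * Real.pi * Complex.I)⁻¹ * ∮ z in C(c, r), φ z * (fderiv ℂ g (b, z) (0, 1) / g (b, z))

theorem GoodDisc.holAt_zeroSum {g : F × ℂ → ℂ} {c : ℂ} {r : ℝ} {b : F} (h : GoodDisc g c r b)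
    (hr : 0 < r) {φ : ℂ → ℂ} (hφ : Differentiable ℂ φ) : HolAt (zeroSum g c r φ) b := by
  refine (holAt_const _ _).mul (holAt_circleIntegral
    (φ := fun p : F × ℂ => φ p.2 * (fderiv ℂ g p (0, 1) / g p)) hr.le fun z hz => ?_)
  have hz' := h.1 z (sphere_subset_closedBall hz)
  exact HolAt.mul (Eventually.of_forall fun p => (hφ p.2).comp p differentiableAt_snd)
    ((hz'.fderiv_apply (0, 1)).div hz' (h.2 z hz))

theorem holAt_fiber {g : F × ℂ → ℂ} {b : F} {z : ℂ} (h : HolAt g (b, z)) :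
    HolAt (fun z => g (b, z)) z :=
  HolAt.comp_of_differentiable (u := fun z : ℂ => (b, z)) h (by fun_prop)

theorem GoodDisc.exists_zeros {g : F × ℂ → ℂ} {c : ℂ} {r : ℝ} {b : F} (h : GoodDisc g c r b)
    (hr : 0 < r) : ∃ (Z : Finset ℂ) (m : ℂ → ℕ), (∀ z, z ∈ Z ↔ z ∈ ball c r ∧ g (b, z) = 0) ∧
      (∀ z ∈ Z, 0 < m z) ∧
      ∀ φ : ℂ → ℂ, Differentiable ℂ φ → zeroSum g c r φ b = ∑ z ∈ Z, m z * φ z := by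
  obtain ⟨Z, m, h1, h2, h3⟩ := argument_principle hr (f := fun z => g (b, z))
    (fun z hz => holAt_iff_analyticAt.1 (holAt_fiber (h.1 z hz))) h.2
  refine ⟨Z, m, h1, h2, fun φ hφ => ?_⟩
  rw [← h3 φ fun z _ => hφ z, zeroSum]
  congr 1
  refine circleIntegral.integral_congr hr.le fun z hz => ?_
  have hd : HasDerivAt (fun z : ℂ => (b, z)) ((0 : F), (1 : ℂ)) z :=
    (hasDerivAt_const z b).prodMk (hasDerivAt_id z)
  have := ((h.1 z (sphere_subset_closedBall hz)).differentiableAt.hasFDerivAt.comp_hasDerivAt z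
    hd).deriv
  rw [← this]
  rfl

theorem graphAt_of_unique_zero {g : F × ℂ → ℂ} {c : ℂ} {r : ℝ} {b : F} (h : GoodDisc g c r b)
    (hr : 0 < r) (hu : ∀ᶠ b' in 𝓝 b, ∃! z, z ∈ ball c r ∧ g (b', z) = 0) {z₀ : ℂ}
    (hz₀ : z₀ ∈ ball c r) : GraphAt {p | g p = 0} (b, z₀) := by
  have key : ∀ b', GoodDisc g c r b' → (∃! z, z ∈ ball c r ∧ g (b', z) = 0) →
      zeroSum g c r (fun _ => 1) b' ≠ 0 ∧ ∀ z ∈ ball c r,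
        (g (b', z) = 0 ↔ z = zeroSum g c r id b' / zeroSum g c r (fun _ => 1) b') := by
    rintro b' hb' ⟨z', hz', hzu⟩
    obtain ⟨Z, m, h1, h2, h3⟩ := hb'.exists_zeros hr
    have hZ : Z = {z'} := by
      ext z
      rw [h1, Finset.mem_singleton]
      exact ⟨fun hz => hzu z hz, fun hz => hz ▸ hz'⟩
    have hm : (m z' : ℂ) ≠ 0 := by
      have := h2 z' (by simp [hZ])
      exact_mod_cast this.ne'
    have e0 : zeroSum g c r (fun _ => 1) b' = m z' := by
      rw [h3 _ (by fun_prop), hZ]; simp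
    have e1 : zeroSum g c r id b' = m z' * z' := by
      rw [h3 _ differentiable_id, hZ]; simp
    refine ⟨e0 ▸ hm, fun z hz => ?_⟩
    rw [e0, e1, mul_div_cancel_left₀ _ hm]
    exact ⟨fun hg => hzu z ⟨hz, hg⟩, fun hg => hg ▸ hz'.2⟩
  refine ⟨fun b' => zeroSum g c r id b' / zeroSum g c r (fun _ => 1) b',
    (h.holAt_zeroSum hr differentiable_id).div (h.holAt_zeroSum hr (by fun_prop))
      (key b h hu.self_of_nhds).1, ?_⟩
  have hc1 : ContinuousAt (Prod.fst : F × ℂ → F) (b, z₀) := continuousAt_fst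
  have hc2 : ContinuousAt (Prod.snd : F × ℂ → ℂ) (b, z₀) := continuousAt_snd
  filter_upwards [hc1.eventually h.eventually, hc1.eventually hu,
    hc2.eventually (isOpen_ball.mem_nhds hz₀)] with y hy1 hy2 hy3
  exact (key y.1 hy1 hy2).2 y.2 hy3

/-- The number of zeros in a disc, without multiplicities. -/
def zeroCount (g : F × ℂ → ℂ) (c : ℂ) (r : ℝ) (b : F) : ℕ :=
  {z | z ∈ ball c r ∧ g (b, z) = 0}.ncard

theorem zeroCount_eq_card {F : Type*} {g : F × ℂ → ℂ} {c : ℂ} {r : ℝ} {b : F} {Z : Finset ℂ}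
    (hZ : ∀ z, z ∈ Z ↔ z ∈ ball c r ∧ g (b, z) = 0) : zeroCount g c r b = Z.card := by
  rw [zeroCount, ← Set.ncard_coe_finset]
  congr 1
  ext z
  exact (hZ z).symm

theorem exists_radius_pairwise (Z : Finset ℂ) (c : ℂ) (r : ℝ) (hZ : ∀ z ∈ Z, z ∈ ball c r) :
    ∃ ε > 0, (∀ z ∈ Z, closedBall z ε ⊆ ball c r) ∧
      ∀ z ∈ Z, ∀ w ∈ Z, z ≠ w → Disjoint (closedBall z ε) (closedBall w ε) := by
  have h1 : ∀ z ∈ Z, ∀ᶠ ε : ℝ in 𝓝[>] 0, closedBall z ε ⊆ ball c r := by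
    intro z hz
    have : ∀ᶠ ε : ℝ in 𝓝 0, ε < r - dist z c := Iio_mem_nhds (sub_pos.2 (hZ z hz))
    filter_upwards [eventually_nhdsWithin_of_eventually_nhds this] with ε hε w hw
    rw [mem_closedBall] at hw
    rw [mem_ball]
    linarith [dist_triangle w z c]
  have h2 : ∀ z ∈ Z, ∀ w ∈ Z, ∀ᶠ ε : ℝ in 𝓝[>] 0, z ≠ w →
      Disjoint (closedBall z ε) (closedBall w ε) := by
    intro z _ w _
    rcases eq_or_ne z w with rfl | hne
    · simp
    have : ∀ᶠ ε : ℝ in 𝓝 0, ε < dist z w / 2 := Iio_mem_nhds (by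
      have := dist_pos.2 hne
      positivity)
    filter_upwards [eventually_nhdsWithin_of_eventually_nhds this] with ε hε _
    exact closedBall_disjoint_closedBall (by linarith)
  have h3 := (Filter.eventually_all_finset Z).2 h1
  have h4 := (Filter.eventually_all_finset Z).2 fun z hz =>
    (Filter.eventually_all_finset Z).2 (h2 z hz)
  obtain ⟨ε, ⟨h3, h4⟩, h5⟩ := ((h3.and h4).and self_mem_nhdsWithin).exists
  exact ⟨ε, h5, h3, h4⟩

theorem graphAt_of_zeroCount_max {g : F × ℂ → ℂ} {c : ℂ} {r : ℝ} {b : F} (h : GoodDisc g c r b)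
    (hr : 0 < r) (hk : ∀ᶠ b' in 𝓝 b, zeroCount g c r b' ≤ zeroCount g c r b) {w : ℂ}
    (hw : w ∈ ball c r) (hgw : g (b, w) = 0) : GraphAt {p | g p = 0} (b, w) := by
  classical
  obtain ⟨Z, m, h1, h2, h3⟩ := h.exists_zeros hr
  obtain ⟨ε, hε, hsub, hdisj⟩ := exists_radius_pairwise Z c r fun z hz => ((h1 z).1 hz).1
  have hgood : ∀ z ∈ Z, GoodDisc g z ε b := fun z hz =>
    ⟨fun u hu => h.1 u (ball_subset_closedBall (hsub z hz hu)), fun u hu h0 => by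
      have huZ : u ∈ Z := (h1 u).2 ⟨hsub z hz (sphere_subset_closedBall hu), h0⟩
      have hne : z ≠ u := by
        rintro rfl
        simp at hu
        exact hε.ne hu
      exact Set.disjoint_left.1 (hdisj z hz u huZ hne) (sphere_subset_closedBall hu)
        (mem_closedBall_self hε.le)⟩
  have hex : ∀ z ∈ Z, ∀ᶠ b' in 𝓝 b, ∃ u, u ∈ ball z ε ∧ g (b', u) = 0 := by
    intro z hz
    have hc := ((hgood z hz).holAt_zeroSum hε (φ := fun _ => 1) (by fun_prop)).continuousAt
    have hne : zeroSum g z ε (fun _ => 1) b ≠ 0 := by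
      obtain ⟨Z', m', k1, k2, k3⟩ := (hgood z hz).exists_zeros hε
      rw [k3 _ (by fun_prop)]
      simp only [mul_one]
      have hzZ : z ∈ Z' := (k1 z).2 ⟨mem_ball_self hε, ((h1 z).1 hz).2⟩
      have : 0 < ∑ u ∈ Z', m' u := Finset.sum_pos k2 ⟨z, hzZ⟩
      exact_mod_cast this.ne'
    filter_upwards [hc.eventually_ne hne, (hgood z hz).eventually] with b' hb1 hb2
    obtain ⟨Z', m', k1, k2, k3⟩ := hb2.exists_zeros hε
    rw [k3 _ (by fun_prop)] at hb1
    obtain ⟨u, hu, -⟩ := Finset.exists_ne_zero_of_sum_ne_zero hb1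
    exact ⟨u, (k1 u).1 hu⟩
  have hwZ : w ∈ Z := (h1 w).2 ⟨hw, hgw⟩
  refine graphAt_of_unique_zero (hgood w hwZ) hε ?_ (mem_ball_self hε)
  filter_upwards [(Filter.eventually_all_finset Z).2 hex, hk, h.eventually] with b' hb1 hb2 hb3
  rw [zeroCount_eq_card h1] at hb2
  obtain ⟨Z', m', k1, k2, k3⟩ := hb3.exists_zeros hr
  rw [zeroCount_eq_card k1] at hb2
  choose! σ hσ using hb1
  have hσZ : ∀ z ∈ Z, σ z ∈ Z' := fun z hz =>
    (k1 _).2 ⟨hsub z hz (ball_subset_closedBall (hσ z hz).1), (hσ z hz).2⟩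
  have hinj : Set.InjOn σ Z := by
    intro z hz u hu hzu
    by_contra hne
    exact Set.disjoint_left.1 (hdisj z hz u hu hne) (ball_subset_closedBall (hσ z hz).1)
      (hzu ▸ ball_subset_closedBall (hσ u hu).1)
  have himg : Z.image σ = Z' := Finset.eq_of_subset_of_card_le
    (fun u hu => by
      obtain ⟨z, hz, rfl⟩ := Finset.mem_image.1 hu
      exact hσZ z hz) (by rw [Finset.card_image_of_injOn hinj]; exact hb2)
  refine ⟨σ w, hσ w hwZ, fun u hu => ?_⟩
  have huZ : u ∈ Z' := (k1 u).2 ⟨hsub w hwZ (ball_subset_closedBall hu.1), hu.2⟩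
  rw [← himg] at huZ
  obtain ⟨z, hz, rfl⟩ := Finset.mem_image.1 huZ
  by_contra hne
  have hzw : z ≠ w := fun h => hne (h ▸ rfl)
  exact Set.disjoint_left.1 (hdisj z hz w hwZ hzw) (ball_subset_closedBall (hσ z hz).1)
    (ball_subset_closedBall hu.1)

/-- The Hankel determinant of the power sums of the zeros. -/
def hankel (g : F × ℂ → ℂ) (c : ℂ) (r : ℝ) (k : ℕ) (b : F) : ℂ :=
  Matrix.det (Matrix.of fun i j : Fin k => zeroSum g c r (fun z => z ^ (i + j : ℕ)) b)

theorem HolAt.sum {ι : Type*} {s : Finset ι} {f : ι → F → ℂ} {x : F}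
    (h : ∀ i ∈ s, HolAt (f i) x) : HolAt (fun y => ∑ i ∈ s, f i y) x := by
  filter_upwards [(Filter.eventually_all_finset s).2 h] with y hy
  exact DifferentiableAt.fun_sum hy

theorem HolAt.prod {ι : Type*} {s : Finset ι} {f : ι → F → ℂ} {x : F}
    (h : ∀ i ∈ s, HolAt (f i) x) : HolAt (fun y => ∏ i ∈ s, f i y) x := by
  classical
  induction s using Finset.induction_on with
  | empty => simpa using holAt_const (1 : ℂ) x
  | insert a s ha ih =>
    simp only [Finset.prod_insert ha]
    exact (h a (Finset.mem_insert_self a s)).mul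
      (ih fun i hi => h i (Finset.mem_insert_of_mem hi))

theorem GoodDisc.holAt_hankel {g : F × ℂ → ℂ} {c : ℂ} {r : ℝ} {b : F} (h : GoodDisc g c r b)
    (hr : 0 < r) (k : ℕ) : HolAt (hankel g c r k) b := by
  have : hankel g c r k = fun b => ∑ σ : Equiv.Perm (Fin k), ((Equiv.Perm.sign σ : ℤ) : ℂ) *
      ∏ i, zeroSum g c r (fun z => z ^ ((σ i : ℕ) + i)) b := by
    ext b
    rw [hankel, Matrix.det_apply']
    rfl
  rw [this]
  exact HolAt.sum fun σ _ => (holAt_const _ _).mul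
    (HolAt.prod fun i _ => h.holAt_zeroSum hr (by fun_prop))

theorem GoodDisc.hankel_eq {g : F × ℂ → ℂ} {c : ℂ} {r : ℝ} {b : F} (h : GoodDisc g c r b)
    (hr : 0 < r) (k : ℕ) :
    (zeroCount g c r b < k → hankel g c r k b = 0) ∧
      (zeroCount g c r b = k → hankel g c r k b ≠ 0) := by
  obtain ⟨Z, m, h1, h2, h3⟩ := h.exists_zeros hr
  rw [zeroCount_eq_card h1]
  constructor
  · intro hk
    set W : Matrix Z (Fin k) ℂ := Matrix.of fun z j => (z : ℂ) ^ (j : ℕ)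
    have hM : (Matrix.of fun i j : Fin k => zeroSum g c r (fun z => z ^ (i + j : ℕ)) b) =
        W.transpose * (Matrix.diagonal (fun z : Z => (m z : ℂ)) * W) := by
      ext i j
      rw [Matrix.mul_apply, Matrix.of_apply, h3 _ (by fun_prop), ← Finset.sum_coe_sort]
      refine Finset.sum_congr rfl fun z _ => ?_
      rw [Matrix.diagonal_mul]
      simp only [W, Matrix.transpose_apply, Matrix.of_apply, pow_add]
      ring
    by_contra hne
    have hu := (Matrix.isUnit_iff_isUnit_det _).2 (isUnit_iff_ne_zero.2 hne)
    have hrank := Matrix.rank_of_isUnit _ hu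
    rw [hM] at hrank
    have := (Matrix.rank_mul_le_left W.transpose
      (Matrix.diagonal (fun z : Z => (m z : ℂ)) * W)).trans (Matrix.rank_le_card_width _)
    simp at this hrank
    omega
  · rintro hk
    set e : Fin k ≃ Z := (Fintype.equivFinOfCardEq (by simpa using hk)).symm
    set W : Matrix (Fin k) (Fin k) ℂ := Matrix.vandermonde fun l => (e l : ℂ)
    have hM : (Matrix.of fun i j : Fin k => zeroSum g c r (fun z => z ^ (i + j : ℕ)) b) =
        W.transpose * (Matrix.diagonal (fun l => (m (e l) : ℂ)) * W) := by
      ext i j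
      rw [Matrix.mul_apply, Matrix.of_apply, h3 _ (by fun_prop), ← Finset.sum_coe_sort,
        ← e.sum_comp]
      refine Finset.sum_congr rfl fun z _ => ?_
      rw [Matrix.diagonal_mul]
      simp only [W, Matrix.transpose_apply, Matrix.vandermonde_apply, pow_add]
      ring
    rw [hankel, hM, Matrix.det_mul, Matrix.det_mul, Matrix.det_transpose, Matrix.det_diagonal]
    have hW : W.det ≠ 0 := Matrix.det_vandermonde_ne_zero_iff.2
      (Subtype.val_injective.comp e.injective)
    refine mul_ne_zero hW (mul_ne_zero (Finset.prod_ne_zero_iff.2 fun l _ => ?_) hW)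
    have := h2 _ (e l).2
    exact_mod_cast this.ne'

/-- The zero set of a holomorphic function is a union of graphs off a thin set of base points. -/
theorem exists_thin_graphAt {g : F × ℂ → ℂ} {b₀ : F} {w : ℂ} (hg : HolAt g (b₀, w))
    (hne : ¬ ∀ᶠ z in 𝓝 w, g (b₀, z) = 0) :
    ∃ P : Set F, ThinAt P b₀ ∧
      ∀ᶠ y in 𝓝 (b₀, w), y.1 ∉ P → GraphAt {p | g p = 0} y := by
  have h1 := (holAt_iff_analyticAt.1 (holAt_fiber hg)).eventually_eq_zero_or_eventually_ne_zero
  have h1 := h1.resolve_left hne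
  have h2 : ∀ᶠ z in 𝓝 w, HolAt g (b₀, z) :=
    (Continuous.continuousAt (by fun_prop : Continuous fun z : ℂ => (b₀, z))).eventually
      hg.eventually
  obtain ⟨r, hr, hB⟩ := Metric.nhds_basis_closedBall.eventually_iff.1
    (h2.and (eventually_nhdsWithin_iff.1 h1))
  have hgood : GoodDisc g w r b₀ := ⟨fun z hz => (hB hz).1, fun z hz =>
    (hB (sphere_subset_closedBall hz)).2 (by
      rintro rfl
      simp at hz
      exact hr.ne hz)⟩
  have hbd : ∃ K : ℕ, ∀ᶠ b in 𝓝 b₀, zeroCount g w r b ≤ K := by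
    have hc := (hgood.holAt_zeroSum hr (φ := fun _ => 1) (by fun_prop)).continuousAt
    obtain ⟨K, hK⟩ := exists_nat_gt (‖zeroSum g w r (fun _ => 1) b₀‖)
    refine ⟨K, ?_⟩
    filter_upwards [hc.norm.eventually (Iio_mem_nhds hK), hgood.eventually] with b hb1 hb2
    obtain ⟨Z, m, k1, k2, k3⟩ := hb2.exists_zeros hr
    rw [zeroCount_eq_card k1]
    have hb1 : ‖zeroSum g w r (fun _ => 1) b‖ < K := hb1
    rw [k3 _ (by fun_prop)] at hb1
    simp only [mul_one] at hb1
    have e : Z.card ≤ ∑ z ∈ Z, m z := by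
      rw [Finset.card_eq_sum_ones]
      exact Finset.sum_le_sum k2
    have hb1 : ∑ z ∈ Z, m z < K := by
      rw [← Nat.cast_sum, Complex.norm_natCast] at hb1
      exact_mod_cast hb1
    omega
  obtain ⟨k, hk1, hk2⟩ : ∃ k, (∀ᶠ b in 𝓝 b₀, zeroCount g w r b ≤ k) ∧
      ∃ᶠ b in 𝓝 b₀, zeroCount g w r b = k := by
    classical
    refine ⟨Nat.find hbd, Nat.find_spec hbd, ?_⟩
    have hs := Nat.find_spec hbd
    rcases hK : Nat.find hbd with _ | j
    · rw [hK] at hs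
      exact (hs.mono fun b hb => Nat.le_zero.1 hb).frequently
    · have hmin := Nat.find_min hbd (m := j) (by omega)
      rw [hK] at hs
      refine (Filter.Frequently.and_eventually (not_eventually.1 hmin) hs).mono fun b hb => ?_
      omega
  refine ⟨{b | hankel g w r k b = 0}, ⟨hankel g w r k, hgood.holAt_hankel hr k, ?_,
    Eventually.of_forall fun _ h => h⟩, ?_⟩
  · exact (hk2.and_eventually hgood.eventually).mono fun b hb => (hb.2.hankel_eq hr k).2 hb.1
  · have hc1 : ContinuousAt (Prod.fst : F × ℂ → F) (b₀, w) := continuousAt_fst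
    have hc2 : ContinuousAt (Prod.snd : F × ℂ → ℂ) (b₀, w) := continuousAt_snd
    filter_upwards [hc1.eventually hgood.eventually, hc1.eventually hk1.eventually_nhds,
      hc2.eventually (ball_mem_nhds w hr)] with y hy1 hy2 hy3 hyP
    by_cases hy0 : g y = 0
    · have hcount : zeroCount g w r y.1 = k := by
        refine le_antisymm hy2.self_of_nhds (not_lt.1 fun hlt => hyP ((hy1.hankel_eq hr k).1 hlt))
      exact graphAt_of_zeroCount_max hy1 hr (by rwa [hcount]) hy3 hy0
    · exact graphAt_of_eventually_notMem
        ((hy1.1 y.2 (ball_subset_closedBall hy3)).continuousAt.eventually_ne hy0)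

end Sheets

section LocalStructure

variable {F : Type*} [NormedAddCommGroup F] [NormedSpace ℂ F]

/-- Near `x` the set `C` is the zero set of a holomorphic map into `ℓ²`. -/
def AnalyticSetAt {G : Type*} [NormedAddCommGroup G] [NormedSpace ℂ G] (C : Set G) (x : G) : Prop :=
  ∃ h : G → EllTwo, HolAt h x ∧ ∀ᶠ y in 𝓝 x, (y ∈ C ↔ h y = 0)

theorem AnalyticSetAt.eventually_notMem {G : Type*} [NormedAddCommGroup G] [NormedSpace ℂ G]
    {C : Set G} {x : G} (h : AnalyticSetAt C x) (hx : x ∉ C) : ∀ᶠ y in 𝓝 x, y ∉ C := by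
  obtain ⟨h, h1, h2⟩ := h
  filter_upwards [h2, h1.continuousAt.eventually_ne (mt h2.self_of_nhds.2 hx)] with y hy hy'
  exact mt hy.1 hy'

/-- Every plane through `y` containing the fibre direction meets `C` arbitrarily near `y`. -/
def PlaneAcc (C : Set (F × ℂ)) (y : F × ℂ) : Prop :=
  ∀ m : F, m ≠ 0 → ∃ᶠ t : ℂ × ℂ in 𝓝[≠] 0, (y.1 + t.1 • m, y.2 + t.2) ∈ C

theorem HolAt.coord {G : Type*} [NormedAddCommGroup G] [NormedSpace ℂ G] {h : G → EllTwo} {x : G}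
    (hh : HolAt h x) (i : ℕ) : HolAt (fun y => h y i) x := by
  have e : (fun y => h y i) = fun y => lp.evalCLM ℂ (fun _ : ℕ => ℂ) 2 i (h y) := rfl
  rw [e]
  filter_upwards [hh] with y hy
  exact (lp.evalCLM ℂ (fun _ : ℕ => ℂ) 2 i).differentiableAt.comp y hy

theorem exists_coord_ne {v : EllTwo} (hv : v ≠ 0) : ∃ i, v i ≠ 0 := by
  by_contra! h
  exact hv (lp.ext (funext h))

theorem HolAt.exists_coord_frequently_ne {G : Type*} [NormedAddCommGroup G] [NormedSpace ℂ G]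
    {h : G → EllTwo} {x : G} (hh : HolAt h x) (hne : ∃ᶠ y in 𝓝 x, h y ≠ 0) :
    ∃ i, ∃ᶠ y in 𝓝 x, h y i ≠ 0 := by
  obtain ⟨R, hR, hB⟩ := hh.exists_ball
  obtain ⟨y, hy, hyR⟩ := (hne.and_eventually (ball_mem_nhds x hR)).exists
  obtain ⟨i, hi⟩ := exists_coord_ne hy
  refine ⟨i, fun h0 => hi ?_⟩
  exact eq_zero_of_eventuallyEq_zero (f := fun y => h y i) (x := x) (R := R)
    (fun z hz => (HolAt.coord (holAt_of_differentiableOn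
      (fun w hw => (hB w hw).differentiableWithinAt) isOpen_ball hz) i).differentiableAt)
    (mem_ball_self hR) (h0.mono fun _ => not_not.1) hyR

theorem tendsto_fiber {F : Type*} [TopologicalSpace F] (b : F) (z : ℂ) :
    Tendsto (fun w : ℂ => (b, w)) (𝓝 z) (𝓝 (b, z)) :=
  (Continuous.continuousAt (by fun_prop : Continuous fun w : ℂ => (b, w)))

theorem exists_thin_graphAt_of_analyticSetAt {C : Set (F × ℂ)} {b : F} {z : ℂ}
    (hC : AnalyticSetAt C (b, z)) (hiso : ∀ᶠ w in 𝓝[≠] z, (b, w) ∉ C)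
    (hacc : ∀ᶠ y in 𝓝 (b, z), y ∈ C → PlaneAcc C y) :
    ∃ P : Set F, ThinAt P b ∧ ∀ᶠ y in 𝓝 (b, z), y.1 ∉ P → GraphAt C y := by
  obtain ⟨h, h1, h2⟩ := hC
  have hfib : HolAt (fun w => h (b, w)) z :=
    HolAt.comp_of_differentiable (u := fun w : ℂ => (b, w)) h1 (by fun_prop)
  have hne : ∃ᶠ w in 𝓝 z, h (b, w) ≠ 0 := by
    have h3 := (eventually_nhdsWithin_of_eventually_nhds ((tendsto_fiber b z).eventually h2)).and
      hiso
    have h4 : ∀ᶠ w in 𝓝[≠] z, h (b, w) ≠ 0 := by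
      filter_upwards [h3] with w hw using fun h0 => hw.2 (hw.1.2 h0)
    exact h4.frequently.filter_mono nhdsWithin_le_nhds
  obtain ⟨i, hi⟩ := hfib.exists_coord_frequently_ne hne
  obtain ⟨P, hP, hPg⟩ := exists_thin_graphAt (g := fun y => h y i) (h1.coord i)
    (fun h0 => hi (h0.mono fun _ h => not_not.2 h))
  refine ⟨P, hP, ?_⟩
  filter_upwards [hPg, h1.eventually, h2.eventually_nhds, hacc] with y hyg hyh hyC hyacc hyP
  by_cases hy : y ∈ C
  swap
  · exact graphAt_of_eventually_notMem (AnalyticSetAt.eventually_notMem ⟨h, hyh, hyC⟩ hy)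
  obtain ⟨ζ, hζ, hζg⟩ := hyg hyP
  have hCζ : ∀ᶠ y' in 𝓝 y, y' ∈ C → y'.2 = ζ y'.1 := by
    filter_upwards [hζg, hyC] with y' k1 k2 k3
    refine k1.1 ?_
    have := k2.1 k3
    simp [this]
  have hyζ : y.2 = ζ y.1 := hCζ.self_of_nhds hy
  have hψ : HolAt (fun b' => h (b', ζ b')) y.1 := by
    have hu : HolAt (fun b' => (b', ζ b')) y.1 := by
      filter_upwards [hζ] with b' hb'
      exact differentiableAt_id.prodMk hb'
    refine HolAt.comp (f := h) (u := fun b' => (b', ζ b')) ?_ hu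
    rw [← hyζ]
    exact hyh
  by_cases h0 : ∀ᶠ b' in 𝓝 y.1, h (b', ζ b') = 0
  · refine ⟨ζ, hζ, ?_⟩
    filter_upwards [hCζ, hyC, continuousAt_fst.eventually h0] with y' k1 k2 k3
    refine ⟨k1, fun k4 => k2.2 ?_⟩
    rw [← k4] at k3
    exact k3
  · exfalso
    obtain ⟨m, hm⟩ := hψ.exists_line_ne (not_eventually.1 h0)
    have hy0 : h (y.1, ζ y.1) = 0 := by
      rw [← hyζ]
      exact hyC.self_of_nhds.1 hy
    have hm0 : m ≠ 0 := by
      rintro rfl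
      obtain ⟨t, ht⟩ := hm.exists
      simp [hy0] at ht
    refine hyacc hy m hm0 ?_
    have hc : ContinuousAt (fun t : ℂ × ℂ => (y.1 + t.1 • m, y.2 + t.2)) 0 := by fun_prop
    have hc' : Tendsto (fun t : ℂ × ℂ => (y.1 + t.1 • m, y.2 + t.2)) (𝓝 0) (𝓝 y) := by
      simpa [ContinuousAt] using hc
    have hm' : ∀ᶠ t : ℂ × ℂ in 𝓝 0, t.1 ≠ 0 → h (y.1 + t.1 • m, ζ (y.1 + t.1 • m)) ≠ 0 :=
      (continuousAt_fst (p := (0 : ℂ × ℂ))).eventually (eventually_nhdsWithin_iff.1 hm)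
    refine eventually_nhdsWithin_iff.2 ?_
    filter_upwards [hc'.eventually hCζ, hc'.eventually hyC, hm'] with t k1 k2 k3 ht htC
    have e1 := k1 htC
    have e2 := k2.1 htC
    have e3 : t.1 = 0 := by
      by_contra hne
      refine k3 hne ?_
      rw [← e1]
      exact e2
    have e4 : t.2 = 0 := by
      rw [e3, zero_smul, add_zero, ← hyζ] at e1
      simpa using e1
    exact ht (Prod.ext e3 e4)

/-- A set meeting all planes through a point is not locally contained in a thin preimage. -/
theorem frequently_notMem_thin {C : Set (F × ℂ)} {y : F × ℂ} (hy : y ∈ C)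
    (hiso : ∀ᶠ w in 𝓝[≠] y.2, (y.1, w) ∉ C) (hacc : PlaneAcc C y) {P : Set F}
    (hP : ThinAt P y.1) : ∃ᶠ y' in 𝓝 y, y' ∈ C ∧ y'.1 ∉ P := by
  intro hcon
  have hcon : ∀ᶠ y' in 𝓝 y, y' ∈ C → y'.1 ∈ P := by
    filter_upwards [hcon] with y' h1 h2
    by_contra h3
    exact h1 ⟨h2, h3⟩
  obtain ⟨s, h1, h2, h3⟩ := hP
  obtain ⟨m, hm⟩ := h1.exists_line_ne h2
  have hs0 : s y.1 = 0 := h3.self_of_nhds (hcon.self_of_nhds hy)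
  have hm0 : m ≠ 0 := by
    rintro rfl
    obtain ⟨t, ht⟩ := hm.exists
    simp [hs0] at ht
  refine hacc m hm0 ?_
  have hc : ContinuousAt (fun t : ℂ × ℂ => (y.1 + t.1 • m, y.2 + t.2)) 0 := by fun_prop
  have hc' : Tendsto (fun t : ℂ × ℂ => (y.1 + t.1 • m, y.2 + t.2)) (𝓝 0) (𝓝 y) := by
    simpa [ContinuousAt] using hc
  have hm' : ∀ᶠ t : ℂ × ℂ in 𝓝 0, t.1 ≠ 0 → s (y.1 + t.1 • m) ≠ 0 :=
    (continuousAt_fst (p := (0 : ℂ × ℂ))).eventually (eventually_nhdsWithin_iff.1 hm)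
  have hc2 : Tendsto (fun t : ℂ × ℂ => y.2 + t.2) (𝓝 0) (𝓝 y.2) := by
    have : ContinuousAt (fun t : ℂ × ℂ => y.2 + t.2) 0 := by fun_prop
    simpa [ContinuousAt] using this
  refine eventually_nhdsWithin_iff.2 ?_
  filter_upwards [hc'.eventually hcon, hc'.eventually (continuousAt_fst.eventually h3), hm',
    hc2.eventually (eventually_nhdsWithin_iff.1 hiso)] with t k1 k2 k3 k4 ht htC
  have e3 : t.1 = 0 := by
    by_contra hne
    exact k3 hne (k2 (k1 htC))
  have e4 : t.2 ≠ 0 := fun e4 => ht (Prod.ext e3 e4)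
  rw [e3, zero_smul, add_zero] at htC
  exact k4 (by simpa using e4) htC

theorem forall_or_forall_of_dichotomy {D S : Set ℂ} (hD : IsPreconnected D)
    (h : ∀ z ∈ D, (∀ᶠ w in 𝓝 z, w ∈ S) ∨ ∀ᶠ w in 𝓝[≠] z, w ∉ S) :
    (∀ z ∈ D, ∀ᶠ w in 𝓝 z, w ∈ S) ∨ ∀ z ∈ D, ∀ᶠ w in 𝓝[≠] z, w ∉ S := by
  refine isPreconnected_iff_subset_of_disjoint.1 hD {z | ∀ᶠ w in 𝓝 z, w ∈ S}
    {z | ∀ᶠ w in 𝓝[≠] z, w ∉ S} ?_ ?_ h ?_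
  · exact isOpen_iff_mem_nhds.2 fun z hz => eventually_eventually_nhds.2 hz
  · refine isOpen_iff_mem_nhds.2 fun z (hz : ∀ᶠ w in 𝓝[≠] z, w ∉ S) => ?_
    filter_upwards [eventually_eventually_nhds.2 (eventually_nhdsWithin_iff.1 hz)] with w hw
    rcases eq_or_ne w z with rfl | hne
    · exact hz
    · refine eventually_nhdsWithin_of_eventually_nhds ?_
      filter_upwards [hw, isOpen_ne.mem_nhds hne] with u h1 h2 using h1 h2
  · refine eq_empty_of_forall_notMem fun z hz => ?_
    have h1 : ∀ᶠ w in 𝓝[≠] z, w ∈ S := eventually_nhdsWithin_of_eventually_nhds hz.2.1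
    obtain ⟨w, hw⟩ := (h1.and hz.2.2).exists
    exact hw.2 hw.1

theorem AnalyticSetAt.fiber_dichotomy {C : Set (F × ℂ)} {b : F} {z : ℂ}
    (hC : AnalyticSetAt C (b, z)) :
    (∀ᶠ w in 𝓝 z, (b, w) ∈ C) ∨ ∀ᶠ w in 𝓝[≠] z, (b, w) ∉ C := by
  obtain ⟨h, h1, h2⟩ := hC
  have hfib : HolAt (fun w => h (b, w)) z :=
    HolAt.comp_of_differentiable (u := fun w : ℂ => (b, w)) h1 (by fun_prop)
  have h3 := (tendsto_fiber b z).eventually h2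
  refine (holAt_iff_analyticAt.1 hfib).eventually_eq_zero_or_eventually_ne_zero.imp
    (fun h4 => ?_) fun h4 => ?_
  · filter_upwards [h3, h4] with w k1 k2 using k1.2 k2
  · filter_upwards [eventually_nhdsWithin_of_eventually_nhds h3, h4] with w k1 k2 using mt k1.1 k2

end LocalStructure

section Fibers

variable {F : Type*} [NormedAddCommGroup F] [NormedSpace ℂ F]

theorem GraphAt.eventually_notMem {C : Set (F × ℂ)} {x : F × ℂ} (h : GraphAt C x) (hx : x ∉ C) :
    ∀ᶠ y in 𝓝 x, y ∉ C := by
  obtain ⟨ζ, h1, h2⟩ := h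
  have hx' : x.2 ≠ ζ x.1 := fun h => hx (h2.self_of_nhds.2 h)
  have c1 : ContinuousAt (fun y : F × ℂ => ζ y.1) x :=
    ContinuousAt.comp (f := Prod.fst) h1.continuousAt continuousAt_fst
  have c2 : ContinuousAt (fun y : F × ℂ => y.2 - ζ y.1) x := continuousAt_snd.sub c1
  filter_upwards [h2, c2.eventually_ne (sub_ne_zero.2 hx')] with y a b c
  exact sub_ne_zero.1 b (a.1 c)

theorem GraphAt.eventually_fiber_notMem {C : Set (F × ℂ)} {b : F} {z : ℂ}
    (h : GraphAt C (b, z)) : ∀ᶠ w in 𝓝[≠] z, (b, w) ∉ C := by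
  by_cases hz : (b, z) ∈ C
  · obtain ⟨ζ, h1, h2⟩ := h
    have hz' : z = ζ b := h2.self_of_nhds.1 hz
    refine eventually_nhdsWithin_iff.2 ?_
    filter_upwards [(tendsto_fiber b z).eventually h2] with w hw hwz hwC
    exact hwz ((hw.1 hwC).trans hz'.symm)
  · exact ((tendsto_fiber b z).eventually (h.eventually_notMem hz)).filter_mono nhdsWithin_le_nhds

theorem finite_of_forall_isolated {K S : Set ℂ} (hK : IsCompact K)
    (h : ∀ z ∈ K, ∀ᶠ w in 𝓝[≠] z, w ∉ S) : (K ∩ S).Finite := by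
  refine hK.induction_on (p := fun s => (s ∩ S).Finite) (by simp)
    (fun s t hst ht => ht.subset (inter_subset_inter_left _ hst))
    (fun s t hs ht => by rw [union_inter_distrib_right]; exact hs.union ht) fun z hz => ?_
  refine ⟨{w | w ≠ z → w ∉ S}, mem_nhdsWithin_of_mem_nhds
    (eventually_nhdsWithin_iff.1 (h z hz)), (finite_singleton z).subset ?_⟩
  rintro w ⟨h1, h2⟩
  by_contra h3
  exact h1 h3 h2

/-- Over the closed disc of radius `r`, the set `C` is near `b` a union of graphs not meeting the
boundary. -/
def Sheeted (C : Set (F × ℂ)) (r : ℝ) (b : F) : Prop :=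
  (∀ z ∈ closedBall (0 : ℂ) r, GraphAt C (b, z)) ∧ ∀ z ∈ sphere (0 : ℂ) r, (b, z) ∉ C

/-- The points of `C` over `b` in the closed disc of radius `r`. -/
def discFiber (C : Set (F × ℂ)) (r : ℝ) (b : F) : Set ℂ :=
  {z | z ∈ closedBall (0 : ℂ) r ∧ (b, z) ∈ C}

theorem eventually_forall_mem {F : Type*} [TopologicalSpace F] {K : Set ℂ} (hK : IsCompact K)
    {p : F × ℂ → Prop} {b : F}
    (h : ∀ z ∈ K, ∀ᶠ y in 𝓝 (b, z), p y) : ∀ᶠ b' in 𝓝 b, ∀ z ∈ K, p (b', z) :=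
  hK.eventually_forall_of_forall_eventually (P := fun b z => p (b, z)) h

theorem Sheeted.eventually {C : Set (F × ℂ)} {r : ℝ} {b : F} (h : Sheeted C r b) :
    ∀ᶠ b' in 𝓝 b, Sheeted C r b' := by
  filter_upwards [eventually_forall_mem (isCompact_closedBall (0 : ℂ) r)
    (fun z hz => (h.1 z hz).eventually), eventually_forall_mem (isCompact_sphere (0 : ℂ) r)
    (fun z hz => (h.1 z (sphere_subset_closedBall hz)).eventually_notMem (h.2 z hz))]
    with b' h1 h2 using ⟨h1, h2⟩

theorem Sheeted.exists_sheets {C : Set (F × ℂ)} {r : ℝ} {b : F} (h : Sheeted C r b) :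
    ∃ (Z : Finset ℂ) (ζ : ℂ → F → ℂ), (∀ w ∈ Z, HolAt (ζ w) b ∧ ζ w b ∈ closedBall (0 : ℂ) r) ∧
      ∀ᶠ b' in 𝓝 b, InjOn (fun w => ζ w b') Z ∧ discFiber C r b' = (fun w => ζ w b') '' Z := by
  have hfin : (discFiber C r b).Finite :=
    finite_of_forall_isolated (S := {z | (b, z) ∈ C}) (isCompact_closedBall 0 r)
      fun z hz => (h.1 z hz).eventually_fiber_notMem
  choose! ζ h1 h2 using h.1
  have hZ : ∀ w, w ∈ hfin.toFinset → w ∈ ball (0 : ℂ) r ∧ (b, w) ∈ C := by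
    intro w hw
    have hw' : w ∈ discFiber C r b := by simpa using hw
    refine ⟨?_, hw'.2⟩
    rcases (mem_closedBall.1 hw'.1).lt_or_eq with h | h'
    · exact h
    · exact absurd hw'.2 (h.2 w h')
  have hζb : ∀ w ∈ hfin.toFinset, ζ w b = w := fun w hw =>
    ((h2 w (ball_subset_closedBall (hZ w hw).1)).self_of_nhds.1 (hZ w hw).2).symm
  refine ⟨hfin.toFinset, ζ, fun w hw => ⟨h1 w (ball_subset_closedBall (hZ w hw).1), ?_⟩, ?_⟩
  · rw [hζb w hw]
    exact ball_subset_closedBall (hZ w hw).1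
  have ha : ∀ᶠ b' in 𝓝 b, ∀ z ∈ closedBall (0 : ℂ) r, (b', z) ∈ C →
      ∃ w ∈ hfin.toFinset, z = ζ w b' := by
    refine eventually_forall_mem (p := fun y => y ∈ C → ∃ w ∈ hfin.toFinset, y.2 = ζ w y.1)
      (isCompact_closedBall (0 : ℂ) r) fun z hz => ?_
    by_cases hzC : (b, z) ∈ C
    · filter_upwards [h2 z hz] with y hy hyC
      exact ⟨z, hfin.mem_toFinset.2 ⟨hz, hzC⟩, hy.1 hyC⟩
    · filter_upwards [(h.1 z hz).eventually_notMem hzC] with y hy hyC using absurd hyC hy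
  have hb : ∀ᶠ b' in 𝓝 b, ∀ w ∈ hfin.toFinset, (b', ζ w b') ∈ C ∧ ζ w b' ∈ ball (0 : ℂ) r := by
    refine (Filter.eventually_all_finset _).2 fun w hw => ?_
    have hc : ContinuousAt (fun b' => (b', ζ w b')) b :=
      continuousAt_id.prodMk (h1 w (ball_subset_closedBall (hZ w hw).1)).continuousAt
    have hc' : Tendsto (fun b' => (b', ζ w b')) (𝓝 b) (𝓝 (b, w)) := by
      have := hc.tendsto
      rwa [hζb w hw] at this
    have hc2 : Tendsto (fun b' => ζ w b') (𝓝 b) (𝓝 w) := (continuous_snd.tendsto _).comp hc'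
    filter_upwards [hc'.eventually (h2 w (ball_subset_closedBall (hZ w hw).1)),
      hc2.eventually (isOpen_ball.mem_nhds (hZ w hw).1)] with b' k1 k2
    exact ⟨k1.2 rfl, k2⟩
  have hc : ∀ᶠ b' in 𝓝 b, ∀ w ∈ hfin.toFinset, ∀ w' ∈ hfin.toFinset, w ≠ w' →
      ζ w b' ≠ ζ w' b' := by
    refine (Filter.eventually_all_finset _).2 fun w hw =>
      (Filter.eventually_all_finset _).2 fun w' hw' => ?_
    by_cases hww : w = w'
    · exact Eventually.of_forall fun _ h => absurd hww h
    have c1 := (h1 w (ball_subset_closedBall (hZ w hw).1)).continuousAt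
    have c2 := (h1 w' (ball_subset_closedBall (hZ w' hw').1)).continuousAt
    filter_upwards [(c1.sub c2).eventually_ne (y := 0)
      (by simpa [hζb w hw, hζb w' hw'] using sub_ne_zero.2 hww)] with b' hb' _
    exact sub_ne_zero.1 hb'
  filter_upwards [ha, hb, hc] with b' ha hb hc
  refine ⟨fun w hw w' hw' hww => by_contra fun hne => hc w hw w' hw' hne hww, ?_⟩
  ext z
  constructor
  · rintro ⟨hz, hzC⟩
    obtain ⟨w, hw, rfl⟩ := ha z hz hzC
    exact ⟨w, hw, rfl⟩
  · rintro ⟨w, hw, rfl⟩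
    exact ⟨ball_subset_closedBall (hb w hw).2, (hb w hw).1⟩

theorem Sheeted.finite_discFiber {C : Set (F × ℂ)} {r : ℝ} {b : F} (h : Sheeted C r b) :
    (discFiber C r b).Finite :=
  finite_of_forall_isolated (S := {z | (b, z) ∈ C}) (isCompact_closedBall 0 r)
      fun z hz => (h.1 z hz).eventually_fiber_notMem

theorem Sheeted.eventually_ncard_eq {C : Set (F × ℂ)} {r : ℝ} {b : F} (h : Sheeted C r b) :
    ∀ᶠ b' in 𝓝 b, (discFiber C r b').ncard = (discFiber C r b).ncard := by
  obtain ⟨Z, ζ, -, hZ⟩ := h.exists_sheets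
  have key : ∀ᶠ b' in 𝓝 b, (discFiber C r b').ncard = Z.card := by
    filter_upwards [hZ] with b' hb'
    rw [hb'.2, hb'.1.ncard_image, ncard_coe_finset]
  filter_upwards [key] with b' hb'
  rw [hb', key.self_of_nhds]

/-- The number of sheets is constant over connected open sets. -/
theorem ncard_discFiber_eq {C : Set (F × ℂ)} {r : ℝ} {W : Set F} (hW : IsPreconnected W)
    (h : ∀ b ∈ W, Sheeted C r b) {b b' : F} (hb : b ∈ W) (hb' : b' ∈ W) :
    (discFiber C r b).ncard = (discFiber C r b').ncard := by
  refine hW.constant (f := fun b => (discFiber C r b).ncard) (fun x hx => ?_) hb hb'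
  refine ContinuousAt.continuousWithinAt ?_
  exact (continuousAt_const (y := (discFiber C r x).ncard)).congr
    ((h x hx).eventually_ncard_eq.mono fun _ h => h.symm)

theorem HolAt.prodMk {G H K : Type*} [NormedAddCommGroup G] [NormedSpace ℂ G]
    [NormedAddCommGroup H] [NormedSpace ℂ H] [NormedAddCommGroup K] [NormedSpace ℂ K]
    {f : G → H} {g : G → K} {x : G} (hf : HolAt f x) (hg : HolAt g x) :
    HolAt (fun y => (f y, g y)) x := by
  filter_upwards [hf, hg] with y h1 h2 using h1.prodMk h2

theorem Sheeted.holAt_finprod {G : Type*} [NormedAddCommGroup G] [NormedSpace ℂ G]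
    {C : Set (F × ℂ)} {r : ℝ} {u : G → F} (hu : Differentiable ℂ u) {x : G}
    (h : Sheeted C r (u x)) {φ : G × ℂ → ℂ}
    (hφ : ∀ w ∈ closedBall (0 : ℂ) r, HolAt φ (x, w)) :
    HolAt (fun y => ∏ᶠ w ∈ discFiber C r (u y), φ (y, w)) x := by
  obtain ⟨Z, ζ, hζ, hZ⟩ := h.exists_sheets
  have h1 : HolAt (fun y => ∏ w ∈ Z, φ (y, ζ w (u y))) x := by
    refine HolAt.prod fun w hw => ?_
    have hp : HolAt (fun y => (y, ζ w (u y))) x :=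
      HolAt.prodMk (Eventually.of_forall fun y => differentiableAt_id)
        (HolAt.comp_of_differentiable (hζ w hw).1 hu)
    exact HolAt.comp (f := φ) (hφ _ (hζ w hw).2) hp
  refine h1.congr ?_
  filter_upwards [hu.continuous.continuousAt.eventually hZ] with y hy
  rw [hy.2, finprod_mem_image hy.1, finprod_mem_coe_finset]

end Fibers

section Projection

variable {F : Type*} [NormedAddCommGroup F] [NormedSpace ℂ F]

theorem exists_thin_of_compact {K : Set ℂ} (hK : IsCompact K) {b : F} {Q : F × ℂ → Prop}
    (h : ∀ z ∈ K, ∃ P : Set F, ThinAt P b ∧ ∀ᶠ y in 𝓝 (b, z), y.1 ∉ P → Q y) :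
    ∃ P : Set F, ThinAt P b ∧ ∀ᶠ b' in 𝓝 b, b' ∉ P → ∀ z ∈ K, Q (b', z) := by
  refine hK.induction_on
    (p := fun s => ∃ P : Set F, ThinAt P b ∧ ∀ᶠ b' in 𝓝 b, b' ∉ P → ∀ z ∈ s, Q (b', z))
    ⟨∅, thinAt_empty b, by simp⟩ ?_ ?_ ?_
  · rintro s t hst ⟨P, hP, hPt⟩
    exact ⟨P, hP, hPt.mono fun b' h hb z hz => h hb z (hst hz)⟩
  · rintro s t ⟨P, hP, hPs⟩ ⟨P', hP', hPt⟩
    refine ⟨P ∪ P', hP.union hP', ?_⟩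
    filter_upwards [hPs, hPt] with b' h1 h2 hb z hz
    rcases hz with hz | hz
    · exact h1 (fun h => hb (Or.inl h)) z hz
    · exact h2 (fun h => hb (Or.inr h)) z hz
  · intro z hz
    obtain ⟨P, hP, hPz⟩ := h z hz
    obtain ⟨u, hu, v, hv, huv⟩ := mem_nhds_prod_iff.1 hPz
    refine ⟨v, mem_nhdsWithin_of_mem_nhds hv, P, hP, ?_⟩
    filter_upwards [hu] with b' hb' hP' z' hz'
    exact huv (mk_mem_prod hb' hz') hP'

theorem thinAt_not_sheeted {C : Set (F × ℂ)} {r : ℝ} {b : F}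
    (h : ∀ z ∈ closedBall (0 : ℂ) r, ∃ P : Set F, ThinAt P b ∧
      ∀ᶠ y in 𝓝 (b, z), y.1 ∉ P → GraphAt C y)
    (hs : ∀ᶠ b' in 𝓝 b, ∀ z ∈ sphere (0 : ℂ) r, (b', z) ∉ C) :
    ThinAt {b' | ¬ Sheeted C r b'} b := by
  obtain ⟨P, hP, hP'⟩ := exists_thin_of_compact (isCompact_closedBall 0 r) h
  refine hP.mono_eventually ?_
  filter_upwards [hP', hs] with b' h1 h2 h3
  by_contra h4
  exact h3 ⟨h1 h4, h2⟩

theorem not_eventually_zero_of_sphere {r : ℝ} (hr : 0 ≤ r) {f : ℂ → ℂ}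
    (hf : ∀ z ∈ closedBall (0 : ℂ) r, HolAt f z) (hs : ∀ z ∈ sphere (0 : ℂ) r, f z ≠ 0) {z : ℂ}
    (hz : z ∈ closedBall (0 : ℂ) r) : ¬ ∀ᶠ w in 𝓝 z, f w = 0 := by
  intro h0
  have ha : AnalyticOnNhd ℂ f (closedBall (0 : ℂ) r) := fun w hw =>
    holAt_iff_analyticAt.1 (hf w hw)
  have hr' : (r : ℂ) ∈ sphere (0 : ℂ) r := by simp [abs_of_nonneg hr]
  exact hs _ hr' (ha.eqOn_zero_of_preconnected_of_eventuallyEq_zero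
    (convex_closedBall (0 : ℂ) r).isPreconnected hz h0 (sphere_subset_closedBall hr'))

theorem norm_finprod_mem_le {S : Set ℂ} (hS : S.Finite) {φ : ℂ → ℂ} {M : ℝ}
    (h : ∀ w ∈ S, ‖φ w‖ ≤ M) : ‖∏ᶠ w ∈ S, φ w‖ ≤ M ^ S.ncard := by
  rw [finprod_mem_eq_finite_toFinset_prod _ hS, norm_prod, ncard_eq_toFinset_card S hS,
    ← Finset.prod_const]
  exact Finset.prod_le_prod (fun _ _ => norm_nonneg _) fun w hw => h w (hS.mem_toFinset.1 hw)

theorem le_norm_finprod_mem {S : Set ℂ} (hS : S.Finite) {φ : ℂ → ℂ} {m : ℝ} (hm : 0 ≤ m)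
    (h : ∀ w ∈ S, m ≤ ‖φ w‖) : m ^ S.ncard ≤ ‖∏ᶠ w ∈ S, φ w‖ := by
  rw [finprod_mem_eq_finite_toFinset_prod _ hS, norm_prod, ncard_eq_toFinset_card S hS,
    ← Finset.prod_const]
  exact Finset.prod_le_prod (fun _ _ => hm) fun w hw => h w (hS.mem_toFinset.1 hw)

theorem finprod_mem_eq_zero {S : Set ℂ} (hS : S.Finite) {φ : ℂ → ℂ} {w : ℂ} (hw : w ∈ S)
    (h0 : φ w = 0) : ∏ᶠ w ∈ S, φ w = 0 := by
  rw [finprod_mem_eq_finite_toFinset_prod _ hS]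
  exact Finset.prod_eq_zero (hS.mem_toFinset.2 hw) h0

theorem finprod_mem_ne_zero {S : Set ℂ} (hS : S.Finite) {φ : ℂ → ℂ} (h : ∀ w ∈ S, φ w ≠ 0) :
    ∏ᶠ w ∈ S, φ w ≠ 0 := by
  rw [finprod_mem_eq_finite_toFinset_prod _ hS]
  exact Finset.prod_ne_zero_iff.2 fun w hw => h w (hS.mem_toFinset.1 hw)

theorem exists_bound_over_compact {F : Type*} [TopologicalSpace F] {K : Set ℂ} (hK : IsCompact K)
    {b : F} {φ : F × ℂ → ℂ}
    (hφ : ∀ z ∈ K, ContinuousAt φ (b, z)) :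
    ∃ M : ℝ, ∀ᶠ b' in 𝓝 b, ∀ z ∈ K, ‖φ (b', z)‖ ≤ M := by
  obtain ⟨M, hM⟩ := hK.exists_bound_of_continuousOn (f := fun z => φ (b, z))
    fun z hz => ((hφ z hz).tendsto.comp (tendsto_fiber b z)).mono_left nhdsWithin_le_nhds
  refine ⟨M + 1, eventually_forall_mem (p := fun y => ‖φ y‖ ≤ M + 1) hK fun z hz => ?_⟩
  have h1 : ‖φ (b, z)‖ < M + 1 := (hM z hz).trans_lt (lt_add_one M)
  filter_upwards [(hφ z hz).norm.eventually (gt_mem_nhds h1)] with y hy using hy.le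

theorem exists_functional_ne_zero {ι : Type*} [Finite ι] (v : ι → EllTwo) (hv : ∀ i, v i ≠ 0) :
    ∃ L : EllTwo →L[ℂ] ℂ, ∀ i, L (v i) ≠ 0 := by
  obtain ⟨L, hL⟩ := Module.Dual.exists_forall_ne_zero_of_forall_exists
    (K := ℂ) (M := EllTwo →L[ℂ] ℂ)
    (fun i => (ContinuousLinearMap.apply ℂ ℂ (v i)).toLinearMap)
    fun i => SeparatingDual.exists_ne_zero (R := ℂ) (hv i)
  exact ⟨L, hL⟩

theorem thinAt_projection {x : F} {R r : ℝ} (hr : 0 ≤ r) {h : F × ℂ → EllTwo}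
    (hh : ∀ b ∈ ball x R, ∀ z ∈ closedBall (0 : ℂ) r, HolAt h (b, z)) {i : ℕ}
    (hi : ∀ b ∈ ball x R, ∀ z ∈ sphere (0 : ℂ) r, h (b, z) i ≠ 0) {b₁ : F} (hb₁ : b₁ ∈ ball x R)
    (hb₁h : ∀ z ∈ closedBall (0 : ℂ) r, h (b₁, z) ≠ 0) :
    ∀ b ∈ ball x R, ThinAt {b | ∃ z ∈ closedBall (0 : ℂ) r, h (b, z) = 0} b := by
  set Z : Set (F × ℂ) := {y | h y i = 0} with hZ
  set N : Set F := {b | ¬ Sheeted Z r b} with hNdef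
  have hN : ∀ b ∈ ball x R, ThinAt N b := by
    intro b hb
    refine thinAt_not_sheeted (fun z hz => ?_) ?_
    · refine exists_thin_graphAt (g := fun y => h y i) ((hh b hb z hz).coord i) ?_
      exact not_eventually_zero_of_sphere hr (fun w hw => holAt_fiber ((hh b hb w hw).coord i))
        (hi b hb) hz
    · filter_upwards [isOpen_ball.mem_nhds hb] with b' hb' using hi b' hb'
  have hS : ∀ b ∈ ball x R \ N, Sheeted Z r b := fun b hb => not_not.1 hb.2
  have ho : IsOpen (ball x R \ N) := isOpen_iff_mem_nhds.2 fun b hb => by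
    filter_upwards [isOpen_ball.mem_nhds hb.1, (hS b hb).eventually] with b' h1 h2
    exact ⟨h1, fun h3 => h3 h2⟩
  have hpc : IsPreconnected (ball x R \ N) :=
    isPreconnected_diff_thin isOpen_ball (convex_ball x R).isPreconnected hN ho
  obtain ⟨b₂, ⟨hb₂, hb₂h⟩, hb₂N⟩ : ∃ b₂, (b₂ ∈ ball x R ∧
      ∀ z ∈ closedBall (0 : ℂ) r, h (b₂, z) ≠ 0) ∧ b₂ ∉ N := by
    have h1 : ∀ᶠ b in 𝓝 b₁, b ∈ ball x R ∧ ∀ z ∈ closedBall (0 : ℂ) r, h (b, z) ≠ 0 :=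
      Filter.Eventually.and (isOpen_ball.mem_nhds hb₁)
        (eventually_forall_mem (p := fun y => h y ≠ 0) (isCompact_closedBall 0 r) fun z hz =>
          (hh b₁ hb₁ z hz).continuousAt.eventually_ne (hb₁h z hz))
    obtain ⟨b₂, h2, h3⟩ := ((hN b₁ hb₁).frequently_notMem.and_eventually h1).exists
    exact ⟨b₂, h3, h2⟩
  have hfin : (discFiber Z r b₂).Finite := (hS b₂ ⟨hb₂, hb₂N⟩).finite_discFiber
  have : Finite (discFiber Z r b₂) := hfin
  obtain ⟨L, hL⟩ := exists_functional_ne_zero (fun w : discFiber Z r b₂ => h (b₂, w))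
    fun w => hb₂h w w.2.1
  have hLh : ∀ b ∈ ball x R, ∀ z ∈ closedBall (0 : ℂ) r, HolAt (fun y => L (h y)) (b, z) :=
    fun b hb z hz => HolAt.comp (f := fun v => L v)
      (Eventually.of_forall fun _ => L.differentiableAt) (hh b hb z hz)
  set Φ : F → ℂ := fun b => ∏ᶠ w ∈ discFiber Z r b, L (h (b, w)) with hΦ
  obtain ⟨g, hg, hgΦ⟩ := exists_extension (f := Φ) isOpen_ball hN (fun b hb hbN =>
      (Sheeted.holAt_finprod (u := fun b => b) differentiable_id (hS b ⟨hb, hbN⟩)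
        (φ := fun y => L (h y)) (hLh b hb)).differentiableAt) (by
    intro b hb
    obtain ⟨M, hM⟩ := exists_bound_over_compact (isCompact_closedBall (0 : ℂ) r)
      fun z hz => (hLh b hb z hz).continuousAt
    refine ⟨M ^ (discFiber Z r b₂).ncard, ?_⟩
    filter_upwards [hM, isOpen_ball.mem_nhds hb] with b' h1 h2 h3
    rw [← ncard_discFiber_eq hpc hS ⟨h2, h3⟩ ⟨hb₂, hb₂N⟩]
    exact norm_finprod_mem_le (hS b' ⟨h2, h3⟩).finite_discFiber fun w hw => h1 w hw.1)
  have hg₂ : g b₂ ≠ 0 := by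
    rw [hgΦ b₂ hb₂ hb₂N]
    exact finprod_mem_ne_zero hfin fun w hw => hL ⟨w, hw⟩
  intro b hb
  have hgt : ThinAt {b | g b = 0} b := by
    refine ⟨g, hg b hb, fun h0 => hg₂ ?_, Eventually.of_forall fun _ h => h⟩
    exact eq_zero_of_eventuallyEq_zero (fun y hy => (hg y hy).differentiableAt) hb
      (h0.mono fun _ => not_not.1) hb₂
  refine ((hN b hb).union hgt).mono_eventually ?_
  filter_upwards [isOpen_ball.mem_nhds hb] with b' hb' hz
  obtain ⟨z, hz, hz0⟩ := hz
  by_cases hbN : b' ∈ N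
  · exact Or.inl hbN
  refine Or.inr ?_
  change g b' = 0
  rw [hgΦ b' hb' hbN]
  refine finprod_mem_eq_zero (hS b' ⟨hb', hbN⟩).finite_discFiber (w := z) ⟨hz, ?_⟩ ?_
  · simp [hZ, hz0]
  · simp [hz0]

end Projection

section ClosedDisc

variable {F : Type*} [NormedAddCommGroup F] [NormedSpace ℂ F]

theorem eq_zero_of_frequently {G : Type*} [TopologicalSpace G] {f : G → ℂ} {p : G}
    (hf : ContinuousAt f p) (h : ∃ᶠ y in 𝓝 p, f y = 0) : f p = 0 := by
  by_contra h0
  exact h (hf.eventually_ne h0)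

theorem eventually_fiber_notMem_of_exists {r : ℝ} (hr : 0 ≤ r) {h : F × ℂ → EllTwo} {i : ℕ}
    {C : Set (F × ℂ)} {b : F} (hh : ∀ z ∈ closedBall (0 : ℂ) r, HolAt h (b, z))
    (hi : ∀ z ∈ sphere (0 : ℂ) r, h (b, z) i ≠ 0)
    (hCan : ∀ z ∈ ball (0 : ℂ) r, h (b, z) ≠ 0 → AnalyticSetAt C (b, z))
    (hex : ∃ z ∈ ball (0 : ℂ) r, h (b, z) ≠ 0 ∧ (b, z) ∉ C) {z : ℂ}
    (hz : z ∈ ball (0 : ℂ) r) (hz0 : h (b, z) ≠ 0) : ∀ᶠ w in 𝓝[≠] z, (b, w) ∉ C := by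
  have hcont : ∀ z ∈ closedBall (0 : ℂ) r, ContinuousAt (fun w => h (b, w)) z := fun z hz =>
    (hh z hz).continuousAt.tendsto.comp (tendsto_fiber b z)
  set P : Set ℂ := {w | h (b, w) = 0} with hP
  have hPt : ∀ w ∈ ball (0 : ℂ) r, ThinAt P w := fun w hw =>
    ⟨fun w => h (b, w) i, holAt_fiber ((hh w (ball_subset_closedBall hw)).coord i),
      fun h0 => not_eventually_zero_of_sphere hr (f := fun w => h (b, w) i)
        (fun w hw => holAt_fiber ((hh w hw).coord i)) hi (ball_subset_closedBall hw)
        (h0.mono fun _ => not_not.1),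
      Eventually.of_forall fun w hw => by
        have hw' : h (b, w) = 0 := hw
        simp [hw']⟩
  have ho : IsOpen (ball (0 : ℂ) r \ P) := isOpen_iff_mem_nhds.2 fun w hw => by
    filter_upwards [isOpen_ball.mem_nhds hw.1,
      (hcont w (ball_subset_closedBall hw.1)).eventually_ne hw.2] with w' h1 h2 using ⟨h1, h2⟩
  have hpc := isPreconnected_diff_thin isOpen_ball (convex_ball (0 : ℂ) r).isPreconnected hPt ho
  rcases forall_or_forall_of_dichotomy (S := {w | (b, w) ∈ C}) hpc (fun w hw =>
    (hCan w hw.1 hw.2).fiber_dichotomy) with hall | hall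
  · obtain ⟨w, hw, hw0, hwC⟩ := hex
    exact absurd (hall w ⟨hw, hw0⟩).self_of_nhds hwC
  · exact hall z ⟨hz, hz0⟩

theorem eventually_fiber_notMem {r : ℝ} (hr : 0 < r) {h : F × ℂ → EllTwo} {i : ℕ}
    {C : Set (F × ℂ)} {b : F} (hh : ∀ z ∈ closedBall (0 : ℂ) r, HolAt h (b, z))
    (hi : ∀ z ∈ sphere (0 : ℂ) r, h (b, z) i ≠ 0) (hCs : ∀ z ∈ sphere (0 : ℂ) r, (b, z) ∉ C)
    (hCan : ∀ z ∈ closedBall (0 : ℂ) r, h (b, z) ≠ 0 → AnalyticSetAt C (b, z)) {z : ℂ}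
    (hz : z ∈ closedBall (0 : ℂ) r) (hz0 : h (b, z) ≠ 0) : ∀ᶠ w in 𝓝[≠] z, (b, w) ∉ C := by
  have hne : ∀ z ∈ sphere (0 : ℂ) r, h (b, z) ≠ 0 := fun z hz h0 => hi z hz (by simp [h0])
  have hsph : ∀ z ∈ sphere (0 : ℂ) r, ∀ᶠ w in 𝓝 z, (b, w) ∉ C := fun z hz =>
    (tendsto_fiber b z).eventually
      ((hCan z (sphere_subset_closedBall hz) (hne z hz)).eventually_notMem (hCs z hz))
  rcases (mem_closedBall.1 hz).lt_or_eq with hz' | hz'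
  swap
  · exact (hsph z hz').filter_mono nhdsWithin_le_nhds
  refine eventually_fiber_notMem_of_exists hr.le hh hi
    (fun z hz => hCan z (ball_subset_closedBall hz)) ?_ hz' hz0
  have hrs : (r : ℂ) ∈ sphere (0 : ℂ) r := by simp [abs_of_nonneg hr.le]
  have hrb : (r : ℂ) ∈ closure (ball (0 : ℂ) r) := by
    rw [closure_ball _ hr.ne']
    exact sphere_subset_closedBall hrs
  have hcont : ContinuousAt (fun w => h (b, w)) r :=
    (hh _ (sphere_subset_closedBall hrs)).continuousAt.tendsto.comp (tendsto_fiber b r)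
  obtain ⟨w, hw1, hw2, hw3⟩ := ((mem_closure_iff_frequently.1 hrb).and_eventually
    ((hsph _ hrs).and (hcont.eventually_ne (hne _ hrs)))).exists
  exact ⟨w, hw1, hw3, hw2⟩

theorem exists_holAt_closure_iff {x : F} {R r : ℝ} (hr : 0 < r) {h : F × ℂ → EllTwo}
    (hh : ∀ b ∈ ball x R, ∀ z ∈ closedBall (0 : ℂ) r, HolAt h (b, z)) {i : ℕ}
    (hi : ∀ b ∈ ball x R, ∀ z ∈ sphere (0 : ℂ) r, h (b, z) i ≠ 0) {b₁ : F} (hb₁ : b₁ ∈ ball x R)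
    (hb₁h : ∀ z ∈ closedBall (0 : ℂ) r, h (b₁, z) ≠ 0) {C : Set (F × ℂ)}
    (hCs : ∀ b ∈ ball x R, ∀ z ∈ sphere (0 : ℂ) r, (b, z) ∉ C)
    (hCan : ∀ b ∈ ball x R, ∀ z ∈ closedBall (0 : ℂ) r, h (b, z) ≠ 0 → AnalyticSetAt C (b, z))
    (hCacc : ∀ b ∈ ball x R, ∀ z ∈ closedBall (0 : ℂ) r, (b, z) ∈ C →
      h (b, z) ≠ 0 ∧ PlaneAcc C (b, z)) :
    ∃ f : F × ℂ → ℂ, ∀ p ∈ ball x R ×ˢ ball (0 : ℂ) r,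
      HolAt f p ∧ (p ∈ closure C ↔ f p = 0) := by
  set N₁ : Set F := {b | ∃ z ∈ closedBall (0 : ℂ) r, h (b, z) = 0} with hN₁def
  have hN₁ : ∀ b ∈ ball x R, ThinAt N₁ b := thinAt_projection hr.le hh hi hb₁ hb₁h
  have hiso : ∀ b ∈ ball x R, ∀ z ∈ closedBall (0 : ℂ) r, h (b, z) ≠ 0 →
      ∀ᶠ w in 𝓝[≠] z, (b, w) ∉ C := fun b hb z hz hz0 =>
    eventually_fiber_notMem hr (hh b hb) (hi b hb) (hCs b hb) (hCan b hb) hz hz0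
  have hne : ∀ b ∈ ball x R \ N₁, ∀ z ∈ closedBall (0 : ℂ) r, h (b, z) ≠ 0 :=
    fun b hb z hz h0 => hb.2 ⟨z, hz, h0⟩
  have hΩ₁ : IsOpen (ball x R \ N₁) := isOpen_iff_mem_nhds.2 fun b hb => by
    filter_upwards [isOpen_ball.mem_nhds hb.1, eventually_forall_mem (p := fun y => h y ≠ 0)
      (isCompact_closedBall 0 r) fun z hz => (hh b hb.1 z hz).continuousAt.eventually_ne
        (hne b hb z hz)] with b' h1 h2
    exact ⟨h1, fun ⟨z, hz, h0⟩ => h2 z hz h0⟩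
  have hΩ₁c : IsPreconnected (ball x R \ N₁) :=
    isPreconnected_diff_thin isOpen_ball (convex_ball x R).isPreconnected hN₁ hΩ₁
  set N₂ : Set F := {b | ¬ Sheeted C r b} with hN₂def
  have hN₂ : ∀ b ∈ ball x R \ N₁, ThinAt N₂ b := by
    intro b hb
    refine thinAt_not_sheeted (fun z hz => ?_) ?_
    · have han := hCan b hb.1 z hz (hne b hb z hz)
      refine exists_thin_graphAt_of_analyticSetAt han (hiso b hb.1 z hz (hne b hb z hz)) ?_
      rcases (mem_closedBall.1 hz).lt_or_eq with hz' | hz'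
      · filter_upwards [prod_mem_nhds (isOpen_ball.mem_nhds hb.1) (isOpen_ball.mem_nhds hz')]
          with y hy hyC
        exact (hCacc y.1 hy.1 y.2 (ball_subset_closedBall hy.2) hyC).2
      · filter_upwards [han.eventually_notMem (hCs b hb.1 z hz')] with y hy hyC
          using absurd hyC hy
    · filter_upwards [isOpen_ball.mem_nhds hb.1] with b' hb' using hCs b' hb'
  have hS : ∀ b ∈ (ball x R \ N₁) \ N₂, Sheeted C r b := fun b hb => not_not.1 hb.2
  have hW : IsOpen ((ball x R \ N₁) \ N₂) := isOpen_iff_mem_nhds.2 fun b hb => by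
    filter_upwards [hΩ₁.mem_nhds hb.1, (hS b hb).eventually] with b' h1 h2
    exact ⟨h1, fun h3 => h3 h2⟩
  have hWc : IsPreconnected ((ball x R \ N₁) \ N₂) := isPreconnected_diff_thin hΩ₁ hΩ₁c hN₂ hW
  obtain ⟨b₂, hb₂⟩ : ∃ b₂, b₂ ∈ (ball x R \ N₁) \ N₂ := by
    have hb₁' : b₁ ∈ ball x R \ N₁ := ⟨hb₁, fun ⟨z, hz, h0⟩ => hb₁h z hz h0⟩
    obtain ⟨b₂, h1, h2⟩ := ((hN₂ b₁ hb₁').frequently_notMem.and_eventually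
      (hΩ₁.mem_nhds hb₁')).exists
    exact ⟨b₂, h2, h1⟩
  set k := (discFiber C r b₂).ncard with hk
  have hcard : ∀ b ∈ (ball x R \ N₁) \ N₂, (discFiber C r b).ncard = k := fun b hb =>
    ncard_discFiber_eq hWc hS hb hb₂
  set f₀ : F × ℂ → ℂ := fun p => ∏ᶠ w ∈ discFiber C r p.1, (p.2 - w) with hf₀
  have hf₀b : ∀ p : F × ℂ, p.1 ∈ (ball x R \ N₁) \ N₂ → p.2 ∈ ball (0 : ℂ) r →
      ‖f₀ p‖ ≤ (r + r) ^ k := by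
    intro p hp hp2
    rw [← hcard p.1 hp]
    refine norm_finprod_mem_le (hS p.1 hp).finite_discFiber fun w hw => ?_
    refine (norm_sub_le _ _).trans (add_le_add ?_ ?_)
    · exact (mem_ball_zero_iff.1 hp2).le
    · exact mem_closedBall_zero_iff.1 hw.1
  obtain ⟨f₁, hf₁, hf₁₀⟩ := exists_extension (f := f₀) (N := Prod.fst ⁻¹' N₂)
    (Ω := (ball x R \ N₁) ×ˢ ball (0 : ℂ) r) (hΩ₁.prod isOpen_ball)
    (fun p hp => (hN₂ p.1 hp.1).preimage_fst)
    (fun p hp hpN => (Sheeted.holAt_finprod (u := fun p : F × ℂ => p.1) (by fun_prop)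
      (hS p.1 ⟨hp.1, hpN⟩) (φ := fun q => q.1.2 - q.2)
      fun w _ => Eventually.of_forall fun q => by fun_prop).differentiableAt)
    (fun p hp => ⟨(r + r) ^ k, by
      filter_upwards [(hΩ₁.prod isOpen_ball).mem_nhds hp] with y h1 h2
      exact hf₀b y ⟨h1.1, h2⟩ h1.2⟩)
  have hf₁b : ∀ p ∈ (ball x R \ N₁) ×ˢ ball (0 : ℂ) r, ‖f₁ p‖ ≤ (r + r) ^ k := by
    intro p hp
    by_contra! hcon
    obtain ⟨y, ⟨h1, h2⟩, h3⟩ := (((hN₂ p.1 hp.1).preimage_fst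
      (P := N₂)).frequently_notMem.and_eventually
        ((hΩ₁.prod isOpen_ball).mem_nhds hp) |>.and_eventually
        ((hf₁ p hp).continuousAt.norm.eventually (lt_mem_nhds hcon))).exists
    rw [hf₁₀ y h2 h1] at h3
    exact absurd (hf₀b y ⟨h2.1, h1⟩ h2.2) h3.not_ge
  obtain ⟨f, hf, hff₁⟩ := exists_extension (f := f₁) (N := Prod.fst ⁻¹' N₁)
    (Ω := ball x R ×ˢ ball (0 : ℂ) r) (isOpen_ball.prod isOpen_ball)
    (fun p hp => (hN₁ p.1 hp.1).preimage_fst)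
    (fun p hp hpN => (hf₁ p ⟨⟨hp.1, hpN⟩, hp.2⟩).differentiableAt)
    (fun p hp => ⟨(r + r) ^ k, by
      filter_upwards [(isOpen_ball.prod isOpen_ball).mem_nhds hp] with y h1 h2
      exact hf₁b y ⟨⟨h1.1, h2⟩, h1.2⟩⟩)
  have hff₀ : ∀ p : F × ℂ, p.1 ∈ (ball x R \ N₁) \ N₂ → p.2 ∈ ball (0 : ℂ) r → f p = f₀ p :=
    fun p hp hp2 => (hff₁ p ⟨hp.1.1, hp2⟩ hp.1.2).trans (hf₁₀ p ⟨hp.1, hp2⟩ hp.2)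
  have hCf : ∀ c ∈ C, c ∈ ball x R ×ˢ ball (0 : ℂ) r → f c = 0 := by
    intro c hc hcB
    refine eq_zero_of_frequently (hf c hcB).continuousAt ?_
    have hacc : ∀ y ∈ C, y ∈ ball x R ×ˢ ball (0 : ℂ) r →
        (∀ᶠ w in 𝓝[≠] y.2, (y.1, w) ∉ C) ∧ PlaneAcc C y := fun y hy hyB =>
      have h1 := hCacc y.1 hyB.1 y.2 (ball_subset_closedBall hyB.2) hy
      ⟨hiso y.1 hyB.1 y.2 (ball_subset_closedBall hyB.2) h1.1, h1.2⟩
    rw [← frequently_frequently_nhds]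
    refine ((frequently_notMem_thin hc (hacc c hc hcB).1 (hacc c hc hcB).2
      (hN₁ c.1 hcB.1)).and_eventually ((isOpen_ball.prod isOpen_ball).mem_nhds hcB)).mono ?_
    rintro y ⟨⟨hyC, hyN⟩, hyB⟩
    refine ((frequently_notMem_thin hyC (hacc y hyC hyB).1 (hacc y hyC hyB).2
      (hN₂ y.1 ⟨hyB.1, hyN⟩)).and_eventually
        ((hΩ₁.prod isOpen_ball).mem_nhds ⟨⟨hyB.1, hyN⟩, hyB.2⟩)).mono ?_
    rintro z ⟨⟨hzC, hzN⟩, hzB⟩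
    rw [hff₀ z ⟨hzB.1, hzN⟩ hzB.2]
    exact finprod_mem_eq_zero (hS z.1 ⟨hzB.1, hzN⟩).finite_discFiber
      (w := z.2) ⟨ball_subset_closedBall hzB.2, hzC⟩ (sub_self _)
  have hdense : ∀ p ∈ ball x R ×ˢ ball (0 : ℂ) r,
      ∃ᶠ y in 𝓝 p, y.1 ∈ (ball x R \ N₁) \ N₂ ∧ y.2 ∈ ball (0 : ℂ) r := by
    intro p hp
    rw [← frequently_frequently_nhds]
    refine (((hN₁ p.1 hp.1).preimage_fst (P := N₁)).frequently_notMem.and_eventually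
      ((isOpen_ball.prod isOpen_ball).mem_nhds hp)).mono ?_
    rintro y ⟨hyN, hyB⟩
    refine (((hN₂ y.1 ⟨hyB.1, hyN⟩).preimage_fst (P := N₂)).frequently_notMem.and_eventually
      ((hΩ₁.prod isOpen_ball).mem_nhds ⟨⟨hyB.1, hyN⟩, hyB.2⟩)).mono ?_
    rintro z ⟨hzN, hzB⟩
    exact ⟨⟨hzB.1, hzN⟩, hzB.2⟩
  refine ⟨f, fun p hp => ⟨hf p hp, fun hpC => ?_, fun h0 => ?_⟩⟩
  · refine eq_zero_of_frequently (hf p hp).continuousAt ?_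
    refine ((mem_closure_iff_frequently.1 hpC).and_eventually
      ((isOpen_ball.prod isOpen_ball).mem_nhds hp)).mono ?_
    rintro c ⟨hc, hcB⟩
    exact hCf c hc hcB
  · by_contra hpC
    obtain ⟨ε, hε, hεC⟩ := Metric.mem_nhds_iff.1 (isClosed_closure.isOpen_compl.mem_nhds hpC)
    have hpos : ‖f p‖ < (ε / 2) ^ k := by
      rw [h0, norm_zero]
      positivity
    obtain ⟨y, ⟨hyW, hy2⟩, hyp, hyf⟩ := ((hdense p hp).and_eventually
      (Filter.Eventually.and (ball_mem_nhds p (half_pos hε))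
        ((hf p hp).continuousAt.norm.eventually (gt_mem_nhds hpos)))).exists
    rw [hff₀ y hyW hy2, ← hcard y.1 hyW] at hyf
    refine absurd hyf (not_lt.2 (le_norm_finprod_mem (hS y.1 hyW).finite_discFiber
      (half_pos hε).le fun w hw => ?_))
    by_contra! hlt
    have hd : dist (y.1, w) y < ε / 2 := by
      rw [Prod.dist_eq, dist_self, dist_comm, dist_eq_norm]
      exact max_lt (half_pos hε) hlt
    refine hεC (?_ : (y.1, w) ∈ ball p ε) (subset_closure hw.2)
    calc dist (y.1, w) p ≤ dist (y.1, w) y + dist y p := dist_triangle _ _ _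
      _ < ε / 2 + ε / 2 := add_lt_add hd hyp
      _ = ε := add_halves ε

end ClosedDisc

section Localization

variable {F : Type*} [NormedAddCommGroup F] [NormedSpace ℂ F]

theorem exists_holAt_closure_iff_nhds {h : F × ℂ → EllTwo} {C V : Set (F × ℂ)} (hV : IsOpen V)
    (hh : ∀ y ∈ V, HolAt h y) (hCan : ∀ y ∈ V, h y ≠ 0 → AnalyticSetAt C y)
    (hCacc : ∀ y ∈ V, y ∈ C → h y ≠ 0 ∧ PlaneAcc C y) {ε : ℝ} (hε : 0 < ε)
    (hεV : ∀ z ∈ closedBall (0 : ℂ) ε, ((0 : F), z) ∈ V) {i : ℕ}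
    (hi : ∀ z ∈ closedBall (0 : ℂ) ε, ε / 2 ≤ ‖z‖ → h (0, z) i ≠ 0)
    (hex : ∃ z ∈ ball (0 : ℂ) ε, h (0, z) ≠ 0 ∧ ((0 : F), z) ∉ C)
    (hfr : ∃ᶠ b in 𝓝 (0 : F), ∀ z ∈ closedBall (0 : ℂ) ε, h (b, z) ≠ 0) :
    ∃ f : F × ℂ → ℂ, ∀ᶠ p in 𝓝 (0 : F × ℂ), HolAt f p ∧ (p ∈ closure C ↔ f p = 0) := by
  have hne : ∀ z ∈ closedBall (0 : ℂ) ε, ε / 2 ≤ ‖z‖ → h (0, z) ≠ 0 :=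
    fun z hz hz' h0 => hi z hz hz' (by simp [h0])
  have hiso : ∀ z ∈ ball (0 : ℂ) ε, h (0, z) ≠ 0 → ∀ᶠ w in 𝓝[≠] z, ((0 : F), w) ∉ C :=
    fun z => eventually_fiber_notMem_of_exists hε.le (fun z hz => hh _ (hεV z hz))
      (fun z hz => hi z (sphere_subset_closedBall hz)
        (by rw [mem_sphere_zero_iff_norm.1 hz]; linarith))
      (fun z hz => hCan _ (hεV z (ball_subset_closedBall hz))) hex
  have hfin : ((closedBall (0 : ℂ) (3 * ε / 4) \ ball 0 (ε / 2)) ∩ {z | ((0 : F), z) ∈ C}).Finite := by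
    refine finite_of_forall_isolated ((isCompact_closedBall _ _).diff isOpen_ball) fun z hz => ?_
    have hz1 : z ∈ ball (0 : ℂ) ε := closedBall_subset_ball (by linarith) hz.1
    refine hiso z hz1 (hne z (ball_subset_closedBall hz1) ?_)
    simpa using hz.2
  obtain ⟨r, hr, hrC⟩ := ((Ioo_infinite (by linarith : ε / 2 < 3 * ε / 4)).sdiff
    (hfin.image norm)).nonempty
  have hr0 : 0 < r := (half_pos hε).trans hr.1
  have hrε : r < ε := by linarith [hr.2]
  have hrb : closedBall (0 : ℂ) r ⊆ closedBall 0 ε := closedBall_subset_closedBall hrε.le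
  have hsC : ∀ z ∈ sphere (0 : ℂ) r, ((0 : F), z) ∉ C := by
    intro z hz hzC
    have hzr : ‖z‖ = r := mem_sphere_zero_iff_norm.1 hz
    refine hrC ⟨z, ⟨⟨?_, ?_⟩, hzC⟩, hzr⟩
    · rw [mem_closedBall_zero_iff, hzr]
      exact hr.2.le
    · rw [mem_ball_zero_iff, hzr]
      exact hr.1.le.not_gt
  have hsi : ∀ z ∈ sphere (0 : ℂ) r, h (0, z) i ≠ 0 := fun z hz =>
    hi z (hrb (sphere_subset_closedBall hz)) (by rw [mem_sphere_zero_iff_norm.1 hz]; exact hr.1.le)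
  have e1 : ∀ᶠ b in 𝓝 (0 : F), ∀ z ∈ closedBall (0 : ℂ) r, (b, z) ∈ V :=
    eventually_forall_mem (isCompact_closedBall 0 r) fun z hz => hV.mem_nhds (hεV z (hrb hz))
  have e2 : ∀ᶠ b in 𝓝 (0 : F), ∀ z ∈ sphere (0 : ℂ) r, h (b, z) i ≠ 0 ∧ (b, z) ∉ C := by
    refine eventually_forall_mem (p := fun y => h y i ≠ 0 ∧ y ∉ C)
      (isCompact_sphere 0 r) fun z hz => ?_
    have hzV := hεV z (hrb (sphere_subset_closedBall hz))
    exact (((hh _ hzV).coord i).continuousAt.eventually_ne (hsi z hz)).and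
      ((hCan _ hzV fun h0 => hsi z hz (by simp [h0])).eventually_notMem (hsC z hz))
  obtain ⟨R, hR, hball⟩ := Metric.eventually_nhds_iff_ball.1 (e1.and e2)
  obtain ⟨b₁, hb₁h, hb₁⟩ := (hfr.and_eventually (ball_mem_nhds (0 : F) hR)).exists
  obtain ⟨f, hf⟩ := exists_holAt_closure_iff (x := 0) (R := R) (C := C) hr0
    (fun b hb z hz => hh _ ((hball b hb).1 z hz)) (fun b hb z hz => ((hball b hb).2 z hz).1) hb₁
    (fun z hz => hb₁h z (hrb hz)) (fun b hb z hz => ((hball b hb).2 z hz).2)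
    (fun b hb z hz => hCan _ ((hball b hb).1 z hz))
    (fun b hb z hz => hCacc _ ((hball b hb).1 z hz))
  refine ⟨f, ?_⟩
  filter_upwards [prod_mem_nhds (ball_mem_nhds (0 : F) hR) (ball_mem_nhds (0 : ℂ) hr0)]
    with p hp using hf p hp

/-- A direction `e`, transverse to the kernel of `ℓ`, along which `A = {h = 0}` is isolated at `a`
and which meets the complement of `C`. -/
theorem exists_good_direction {h : F → EllTwo} {C V : Set F} {a : F} (hV : IsOpen V) (ha : a ∈ V)
    (hh : ∀ y ∈ V, HolAt h y) {t₁ t₂ : F} {ℓ : F →L[ℂ] ℂ} (hℓ : ℓ t₁ = 1)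
    (hT : ∀ α β : ℂ, (α ≠ 0 ∨ β ≠ 0) → a + (α • t₁ + β • t₂) ∈ V →
      h (a + (α • t₁ + β • t₂)) ≠ 0)
    (hC : ∀ y ∈ V, h y ≠ 0 → ∃ᶠ p in 𝓝 y, p ∉ C) :
    ∃ ε > 0, ∃ (i : ℕ) (e : F), ℓ e = 1 ∧ (∀ z ∈ closedBall (0 : ℂ) ε, a + z • e ∈ V) ∧
      (∀ z ∈ closedBall (0 : ℂ) ε, ε / 2 ≤ ‖z‖ → h (a + z • e) i ≠ 0) ∧
      (∃ z ∈ ball (0 : ℂ) ε, h (a + z • e) ≠ 0 ∧ a + z • e ∉ C) ∧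
      ∃ᶠ δ in 𝓝 (0 : ℂ), ∀ z ∈ closedBall (0 : ℂ) ε, h (a + (z • e + δ • t₂)) ≠ 0 := by
  have hu : Differentiable ℂ (fun z : ℂ => a + z • t₁) := by fun_prop
  have hφ : HolAt (fun z : ℂ => h (a + z • t₁)) 0 :=
    HolAt.comp_of_differentiable (u := fun z : ℂ => a + z • t₁) (by simpa using hh a ha) hu
  have hline : ∀ᶠ z : ℂ in 𝓝 0, a + z • t₁ ∈ V :=
    hu.continuous.continuousAt.eventually (hV.mem_nhds (by simpa using ha))
  obtain ⟨i, hi⟩ : ∃ i, ∃ᶠ z : ℂ in 𝓝 0, h (a + z • t₁) i ≠ 0 := by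
    refine hφ.exists_coord_frequently_ne ?_
    have h1 : ∀ᶠ z : ℂ in 𝓝[≠] 0, h (a + z • t₁) ≠ 0 := by
      filter_upwards [hline.filter_mono nhdsWithin_le_nhds, self_mem_nhdsWithin] with z hz hz0
      simpa using hT z 0 (Or.inl hz0) (by simpa using hz)
    exact h1.frequently.filter_mono nhdsWithin_le_nhds
  have hi' : ∀ᶠ z : ℂ in 𝓝[≠] 0, h (a + z • t₁) i ≠ 0 :=
    ((holAt_iff_analyticAt.1 (hφ.coord i)).eventually_eq_zero_or_eventually_ne_zero).resolve_left
      fun h0 => hi (h0.mono fun _ h => not_not.2 h)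
  obtain ⟨ε₀, hε₀, hball⟩ := Metric.eventually_nhds_iff_ball.1
    (hline.and (eventually_nhdsWithin_iff.1 hi'))
  have hε : 0 < ε₀ / 2 := half_pos hε₀
  generalize hεdef : ε₀ / 2 = ε at hε
  have hεb : ∀ z ∈ closedBall (0 : ℂ) ε, z ∈ ball (0 : ℂ) ε₀ := fun z hz =>
    closedBall_subset_ball (by linarith) hz
  have e1 : ∀ᶠ q : F × ℂ in 𝓝 (t₁, 0), ∀ z ∈ closedBall (0 : ℂ) ε,
      a + (z • q.1 + q.2 • t₂) ∈ V := by
    refine eventually_forall_mem (p := fun y : (F × ℂ) × ℂ => a + (y.2 • y.1.1 + y.1.2 • t₂) ∈ V)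
      (isCompact_closedBall 0 ε) fun z hz => ?_
    have hc : Continuous fun y : (F × ℂ) × ℂ => a + (y.2 • y.1.1 + y.1.2 • t₂) := by fun_prop
    exact hc.continuousAt.eventually (hV.mem_nhds (by simpa using (hball z (hεb z hz)).1))
  have e2 : ∀ᶠ q : F × ℂ in 𝓝 (t₁, 0), ∀ z ∈ closedBall (0 : ℂ) ε \ ball 0 (ε / 2),
      h (a + (z • q.1 + q.2 • t₂)) i ≠ 0 := by
    refine eventually_forall_mem
      (p := fun y : (F × ℂ) × ℂ => h (a + (y.2 • y.1.1 + y.1.2 • t₂)) i ≠ 0)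
      ((isCompact_closedBall 0 ε).diff isOpen_ball) fun z hz => ?_
    have hc : Tendsto (fun y : (F × ℂ) × ℂ => a + (y.2 • y.1.1 + y.1.2 • t₂)) (𝓝 ((t₁, 0), z))
        (𝓝 (a + z • t₁)) := Continuous.tendsto' (by fun_prop) _ _ (by simp)
    have hz0 : z ≠ 0 := by
      rintro rfl
      exact hz.2 (mem_ball_self (half_pos hε))
    have hb := hball z (hεb z hz.1)
    have hev : ∀ᶠ y in 𝓝 (a + z • t₁), h y i ≠ 0 :=
      ((hh _ hb.1).coord i).continuousAt.eventually_ne (hb.2 hz0)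
    exact hc.eventually hev
  obtain ⟨u, hu1, v, hv1, huv⟩ := mem_nhds_prod_iff.1 (e1.and e2)
  obtain ⟨ρ, hρ, hρv⟩ := Metric.mem_nhds_iff.1 hv1
  have hδ : ((ρ / 2 : ℝ) : ℂ) ∈ ball (0 : ℂ) ρ := by
    rw [mem_ball_zero_iff, Complex.norm_real, Real.norm_of_nonneg (half_pos hρ).le]
    exact half_lt_self hρ
  have hδ0 : ((ρ / 2 : ℝ) : ℂ) ≠ 0 := Complex.ofReal_ne_zero.2 (half_pos hρ).ne'
  generalize ((ρ / 2 : ℝ) : ℂ) = δ at hδ hδ0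
  have hV₁ : ∀ e ∈ u, ∀ β ∈ ball (0 : ℂ) ρ, ∀ z ∈ closedBall (0 : ℂ) ε,
      a + (z • e + β • t₂) ∈ V := fun e he β hβ => (huv (mk_mem_prod he (hρv hβ))).1
  have e3 : ∀ᶠ e in 𝓝 t₁, ∀ z ∈ closedBall (0 : ℂ) ε, h (a + (z • e + δ • t₂)) ≠ 0 := by
    refine eventually_forall_mem (p := fun y : F × ℂ => h (a + (y.2 • y.1 + δ • t₂)) ≠ 0)
      (isCompact_closedBall 0 ε) fun z hz => ?_
    have hzV := hV₁ t₁ (mem_of_mem_nhds hu1) δ hδ z hz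
    have hc : Tendsto (fun y : F × ℂ => a + (y.2 • y.1 + δ • t₂)) (𝓝 (t₁, z))
        (𝓝 (a + (z • t₁ + δ • t₂))) := Continuous.tendsto' (by fun_prop) _ _ rfl
    exact hc.eventually
      ((hh _ hzV).continuousAt.eventually_ne (hT z δ (Or.inr hδ0) hzV))
  have hz₀ : ((3 * ε / 4 : ℝ) : ℂ) ≠ 0 := Complex.ofReal_ne_zero.2 (by positivity)
  have hz₀n : ‖((3 * ε / 4 : ℝ) : ℂ)‖ = 3 * ε / 4 := by
    rw [Complex.norm_real, Real.norm_of_nonneg (by positivity)]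
  generalize ((3 * ε / 4 : ℝ) : ℂ) = z₀ at hz₀ hz₀n
  have hz₀b : z₀ ∈ ball (0 : ℂ) ε := by
    rw [mem_ball_zero_iff, hz₀n]
    linarith
  have hp₀ : ∃ᶠ p in 𝓝 (a + z₀ • t₁), p ∉ C := by
    have hb := hball z₀ (hεb z₀ (ball_subset_closedBall hz₀b))
    refine hC _ hb.1 fun h0 => hb.2 hz₀ ?_
    simp [h0]
  have hℓp : ContinuousAt (fun p => ℓ (p - a)) (a + z₀ • t₁) := by fun_prop
  have hℓ0 : ℓ (a + z₀ • t₁ - a) = z₀ := by simp [hℓ]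
  have hep : Tendsto (fun p => (ℓ (p - a))⁻¹ • (p - a)) (𝓝 (a + z₀ • t₁)) (𝓝 t₁) := by
    have h1 : ContinuousAt (fun p => (ℓ (p - a))⁻¹ • (p - a)) (a + z₀ • t₁) :=
      (hℓp.inv₀ (by rw [hℓ0]; exact hz₀)).smul (by fun_prop)
    have h2 := h1.tendsto
    rw [hℓ0, add_sub_cancel_left, inv_smul_smul₀ hz₀] at h2
    exact h2
  have hℓt : Tendsto (fun p => ℓ (p - a)) (𝓝 (a + z₀ • t₁)) (𝓝 z₀) := by
    have h2 := hℓp.tendsto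
    rwa [hℓ0] at h2
  have hz₀A : ∀ᶠ z in 𝓝 z₀, z ∈ ball (0 : ℂ) ε ∧ ε / 2 < ‖z‖ :=
    Filter.Eventually.and (isOpen_ball.mem_nhds hz₀b)
      ((continuous_norm.tendsto z₀).eventually (lt_mem_nhds (by rw [hz₀n]; linarith)))
  obtain ⟨p, hpC, ⟨hpe, hpu⟩, hpz, hpn⟩ := (hp₀.and_eventually
    ((hep.eventually (e3.and hu1)).and (hℓt.eventually hz₀A))).exists
  have hp0 : ℓ (p - a) ≠ 0 := by
    intro h0
    rw [h0, norm_zero] at hpn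
    linarith
  set e := (ℓ (p - a))⁻¹ • (p - a) with he
  have hepa : a + ℓ (p - a) • e = p := by
    rw [he, smul_inv_smul₀ hp0, add_sub_cancel]
  have hρ0 : (0 : ℂ) ∈ ball (0 : ℂ) ρ := mem_ball_self hρ
  have hann : ∀ β ∈ ball (0 : ℂ) ρ, ∀ z ∈ closedBall (0 : ℂ) ε, ε / 2 ≤ ‖z‖ →
      h (a + (z • e + β • t₂)) i ≠ 0 := fun β hβ z hz hz' =>
    (huv (mk_mem_prod hpu (hρv hβ))).2 z ⟨hz, by simpa using hz'⟩
  have hann0 : ∀ z ∈ closedBall (0 : ℂ) ε, ε / 2 ≤ ‖z‖ → h (a + z • e) i ≠ 0 := by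
    simpa using hann 0 hρ0
  refine ⟨ε, hε, i, e, ?_, by simpa using hV₁ e hpu 0 hρ0, hann0, ⟨ℓ (p - a), hpz, ?_, ?_⟩, ?_⟩
  · rw [he, map_smul, smul_eq_mul, inv_mul_cancel₀ hp0]
  · exact fun h0 => hann0 _ (ball_subset_closedBall hpz) hpn.le (by rw [h0]; rfl)
  · rwa [hepa]
  · have hthin := thinAt_projection (x := (0 : ℂ)) (R := ρ) (i := i) hε.le
      (h := fun y : ℂ × ℂ => h (a + (y.2 • e + y.1 • t₂)))
      (fun β hβ z hz => HolAt.comp_of_differentiable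
        (u := fun y : ℂ × ℂ => a + (y.2 • e + y.1 • t₂)) (hh _ (hV₁ e hpu β hβ z hz))
        (by fun_prop))
      (fun β hβ z hz => hann β hβ z (sphere_subset_closedBall hz)
        (by rw [mem_sphere_zero_iff_norm.1 hz]; linarith)) hδ hpe 0 hρ0
    refine hthin.frequently_notMem.mono fun β hβ z hz h0 => hβ ⟨z, hz, h0⟩

end Localization

section Transport

variable {E : Type*} [NormedAddCommGroup E] [NormedSpace ℂ E]

theorem AnalyticSetAt.preimage {G : Type*} [NormedAddCommGroup G] [NormedSpace ℂ G] {C : Set E}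
    {u : G → E} (hu : Differentiable ℂ u) {x : G} (h : AnalyticSetAt C (u x)) :
    AnalyticSetAt (u ⁻¹' C) x := by
  obtain ⟨h, h1, h2⟩ := h
  exact ⟨fun y => h (u y), h1.comp_of_differentiable hu,
    hu.continuous.continuousAt.eventually h2⟩

theorem analyticSetAt_of_isHilbertAnalyticIn {C Ω : Set E} (h : IsHilbertAnalyticIn C Ω) {y : E}
    (hy : y ∈ Ω) : AnalyticSetAt C y := by
  obtain ⟨V, hV, hyV, -, g, hg, hCV⟩ := h.2 y hy
  refine ⟨g, holAt_of_differentiableOn hg hV hyV, ?_⟩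
  filter_upwards [hV.mem_nhds hyV] with z hz
  have := Set.ext_iff.1 hCV z
  simpa [hz] using this

theorem frequently_notMem_of_germCodimAtLeast_one {C : Set E} {y : E}
    (h : GermCodimAtLeast C y 1) : ∃ᶠ p in 𝓝 y, p ∉ C := by
  obtain ⟨T, hT, V, hV, hyV, hTV⟩ := h
  obtain ⟨v, hvT, hv⟩ := T.exists_mem_ne_zero_of_ne_bot (by
    rintro rfl
    simp at hT)
  have hc : Tendsto (fun s : ℂ => y + s • v) (𝓝[≠] 0) (𝓝 y) :=
    (Continuous.tendsto' (by fun_prop) _ _ (by simp)).mono_left nhdsWithin_le_nhds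
  refine hc.frequently (Eventually.frequently ?_)
  filter_upwards [hc.eventually (hV.mem_nhds hyV), self_mem_nhdsWithin] with s hs hs0 hsC
  have := hTV _ ⟨hsC, hs⟩ (by simpa using T.smul_mem s hvT)
  simp [hv] at this
  exact hs0 this

theorem frequently_mem_plane {C : Set E} {y : E} (h : ¬ GermCodimAtLeast C y 2) {ℓ : E →L[ℂ] ℂ}
    {m e : E} (hm : m ≠ 0) (hℓm : ℓ m = 0) (hℓe : ℓ e = 1) :
    ∃ᶠ t : ℂ × ℂ in 𝓝[≠] 0, y + (t.1 • m + t.2 • e) ∈ C := by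
  intro hcon
  obtain ⟨μ, hμ⟩ := SeparatingDual.exists_eq_one (R := ℂ) hm
  refine h ⟨Submodule.span ℂ (range ![m, e]), ?_, ?_⟩
  · rw [finrank_span_eq_card, Fintype.card_fin]
    refine LinearIndependent.pair_iff.2 fun s t hst => ?_
    have ht : t = 0 := by simpa [hℓm, hℓe] using congrArg ℓ hst
    subst ht
    simpa [hm] using hst
  have hc : Tendsto (fun z : E => (μ (z - y - ℓ (z - y) • e), ℓ (z - y))) (𝓝 y) (𝓝 (0 : ℂ × ℂ)) :=
    Continuous.tendsto' (by fun_prop) _ _ (by simp)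
  obtain ⟨V, hVs, hV, hyV⟩ :=
    _root_.eventually_nhds_iff.1 (hc.eventually (eventually_nhdsWithin_iff.1 hcon))
  refine ⟨V, hV, hyV, fun z hz hzT => ?_⟩
  obtain ⟨α, β, hαβ⟩ := Submodule.mem_span_pair.1
    (by simpa only [Matrix.range_cons, Matrix.range_empty, union_empty, singleton_union,
      SetLike.mem_coe] using hzT)
  have hβ : ℓ (z - y) = β := by simp [← hαβ, hℓm, hℓe]
  have hα : μ (z - y - ℓ (z - y) • e) = α := by
    rw [hβ, ← hαβ]
    simp [hμ]
  have hzV := hVs z hz.2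
  rw [hα, hβ] at hzV
  by_contra hzy
  refine hzV ?_ ?_
  · intro h0
    obtain ⟨rfl, rfl⟩ := Prod.mk.inj h0
    refine hzy (sub_eq_zero.1 ?_)
    rw [← hαβ, zero_smul, zero_smul, add_zero]
  · change y + (α • m + β • e) ∈ C
    rw [hαβ, add_sub_cancel]
    exact hz.1

/-- The splitting of a space along a hyperplane and a transverse direction. -/
theorem exists_splitting {ℓ : E →L[ℂ] ℂ} {e : E} (he : ℓ e = 1) :
    ∃ Θ : (ℓ.ker × ℂ) ≃L[ℂ] E, ∀ y, Θ y = y.2 • e + y.1 := by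
  refine ⟨(ContinuousLinearEquiv.prodComm ℂ ℓ.ker ℂ).trans
    (ContinuousLinearEquiv.equivOfRightInverse ℓ
      ((ContinuousLinearMap.id ℂ ℂ).smulRight e) (fun z => by simp [he])).symm, fun y => ?_⟩
  simp

theorem exists_holAt_closure_iff_of_codim {A C U : Set E}
    (hC : IsHilbertAnalyticIn C (U \ A))
    (hcodimC : ∀ a ∈ C, GermCodimAtLeast C a 1 ∧ ¬ GermCodimAtLeast C a 2) {a : E} {V : Set E}
    (hV : IsOpen V) (ha : a ∈ V) (hVU : V ⊆ U) {h : E → EllTwo} (hh : ∀ y ∈ V, HolAt h y)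
    (hA : ∀ y ∈ V, (y ∈ A ↔ h y = 0)) {t₁ t₂ : E} {ℓ : E →L[ℂ] ℂ} (hℓ₁ : ℓ t₁ = 1)
    (hℓ₂ : ℓ t₂ = 0)
    (hT : ∀ α β : ℂ, (α ≠ 0 ∨ β ≠ 0) → a + (α • t₁ + β • t₂) ∈ V → a + (α • t₁ + β • t₂) ∉ A) :
    ∃ f : E → ℂ, ∀ᶠ y in 𝓝 a, HolAt f y ∧ (y ∈ closure C ↔ f y = 0) := by
  have hCan : ∀ y ∈ V, h y ≠ 0 → AnalyticSetAt C y := fun y hy hy0 =>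
    analyticSetAt_of_isHilbertAnalyticIn hC ⟨hVU hy, fun hyA => hy0 ((hA y hy).1 hyA)⟩
  obtain ⟨ε, hε, i, e, he, hεV, hi, hex, hfr⟩ := exists_good_direction (C := C) hV ha hh hℓ₁
    (fun α β h0 hm h1 => hT α β h0 hm ((hA _ hm).2 h1)) fun y hy hy0 => by
      by_cases hyC : y ∈ C
      · exact frequently_notMem_of_germCodimAtLeast_one (hcodimC y hyC).1
      · exact ((hCan y hy hy0).eventually_notMem hyC).frequently
  obtain ⟨Θ, hΘ⟩ := exists_splitting he
  have hΦ : Differentiable ℂ fun y => a + Θ y := by fun_prop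
  set Φ : ℓ.ker × ℂ ≃ₜ E := Θ.toHomeomorph.trans (Homeomorph.addLeft a) with hΦdef
  have hΦa : ∀ y, Φ y = a + Θ y := fun y => rfl
  have hΦs : ∀ y, Φ.symm y = Θ.symm (y - a) := fun y => by
    rw [Homeomorph.symm_apply_eq, hΦa, ContinuousLinearEquiv.apply_symm_apply, add_sub_cancel]
  have hΦd : Differentiable ℂ Φ := hΦ
  have hΦ0 : ∀ z, Φ (0, z) = a + z • e := fun z => by simp [hΦa, hΘ]
  obtain ⟨f, hf⟩ := exists_holAt_closure_iff_nhds (h := fun y => h (Φ y)) (C := Φ ⁻¹' C)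
    (V := Φ ⁻¹' V) (hV.preimage Φ.continuous)
    (fun y hy => HolAt.comp_of_differentiable (hh _ hy) hΦd)
    (fun y hy hy0 => (hCan _ hy hy0).preimage hΦd)
    (fun y hy hyC => ⟨fun h0 => (hC.1 hyC).2 ((hA _ hy).2 h0), fun m hm => by
      refine (frequently_mem_plane (hcodimC _ hyC).2 (m := (m : E)) (by simpa using hm)
        (LinearMap.mem_ker.1 m.2) he).mono fun t ht => ?_
      change Φ (y.1 + t.1 • m, y.2 + t.2) ∈ C
      convert ht using 1
      simp only [hΦa, hΘ, Submodule.coe_add, Submodule.coe_smul, add_smul]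
      abel⟩)
    hε (fun z hz => by simpa [hΦ0] using hεV z hz) (i := i)
    (fun z hz hz' => by simpa only [hΦ0] using hi z hz hz')
    (by simpa only [mem_preimage, hΦ0] using hex) (by
      have hc : Tendsto (fun δ : ℂ => δ • (⟨t₂, hℓ₂⟩ : ℓ.ker)) (𝓝 0) (𝓝 0) :=
        Continuous.tendsto' (by fun_prop) _ _ (by simp)
      refine hc.frequently (hfr.mono fun δ hδ z hz => ?_)
      simpa [hΦa, hΘ] using hδ z hz)
  have hΨ : Differentiable ℂ Φ.symm := by
    have : (Φ.symm : E → ℓ.ker × ℂ) = fun y => Θ.symm (y - a) := funext hΦs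
    rw [this]
    fun_prop
  refine ⟨fun y => f (Φ.symm y), ?_⟩
  have hf' : ∀ᶠ p in 𝓝 (Φ.symm a), HolAt f p ∧ (p ∈ closure (Φ ⁻¹' C) ↔ f p = 0) := by
    have : Φ.symm a = 0 := by rw [hΦs, sub_self, map_zero]
    rwa [this]
  filter_upwards [Φ.symm.continuous.continuousAt.eventually hf'] with y hy
  refine ⟨HolAt.comp_of_differentiable hy.1 hΨ, ?_⟩
  rw [← hy.2, ← Φ.preimage_closure, mem_preimage, Homeomorph.apply_symm_apply]

end Transport

section Hilbert

variable {E : Type*} [NormedAddCommGroup E] [InnerProductSpace ℂ E]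

theorem exists_basis_dual_of_finrank_eq_two {T : Submodule ℂ E} (hT : Module.finrank ℂ T = 2) :
    ∃ (t₁ t₂ : E) (ℓ : E →L[ℂ] ℂ), t₁ ∈ T ∧ t₂ ∈ T ∧ t₂ ≠ 0 ∧ ℓ t₁ = 1 ∧ ℓ t₂ = 0 := by
  have : FiniteDimensional ℂ T := Module.finite_of_finrank_pos (by omega)
  let b := (stdOrthonormalBasis ℂ T).reindex (finCongr hT)
  refine ⟨b 0, b 1, innerSL ℂ (b 0 : E), (b 0).2, (b 1).2, ?_, ?_, ?_⟩
  · simpa using b.orthonormal.ne_zero 1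
  · have : ‖(b 0 : E)‖ = 1 := b.orthonormal.1 0
    simp [inner_self_eq_norm_sq_to_K, this]
  · have : inner ℂ (b 0 : E) (b 1 : E) = 0 := b.orthonormal.2 (by decide : (0 : Fin 2) ≠ 1)
    exact this

end Hilbert

theorem exists_ellTwo_of_holAt {E : Type*} [NormedAddCommGroup E] [NormedSpace ℂ E] {f : E → ℂ}
    {C U : Set E} (hU : IsOpen U) {a : E} (ha : a ∈ U)
    (hf : ∀ᶠ y in 𝓝 a, HolAt f y ∧ (y ∈ closure C ↔ f y = 0)) :
    ∃ V : Set E, IsOpen V ∧ a ∈ V ∧ V ⊆ U ∧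
      ∃ h : E → EllTwo, DifferentiableOn ℂ h V ∧ closure C ∩ U ∩ V = {z ∈ V | h z = 0} := by
  obtain ⟨V, hVs, hV, haV⟩ := _root_.eventually_nhds_iff.1 (hf.and (hU.mem_nhds ha))
  let L : ℂ →L[ℂ] EllTwo := (ContinuousLinearMap.id ℂ ℂ).smulRight (lp.single 2 0 (1 : ℂ))
  have hL : ∀ z, L z = 0 ↔ z = 0 := fun z => by
    have h1 : (lp.single 2 0 (1 : ℂ) : EllTwo) ≠ 0 := by
      rw [← norm_ne_zero_iff, lp.norm_single (by norm_num)]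
      simp
    simp [L, h1]
  refine ⟨V, hV, haV, fun y hy => (hVs y hy).2, fun y => L (f y), fun y hy => ?_, ?_⟩
  · exact (L.differentiableAt.comp y (hVs y hy).1.1.differentiableAt).differentiableWithinAt
  · ext y
    constructor
    · rintro ⟨⟨h1, -⟩, h2⟩
      exact ⟨h2, (hL _).2 ((hVs y h2).1.2.1 h1)⟩
    · rintro ⟨h1, h2⟩
      exact ⟨⟨(hVs y h1).1.2.2 ((hL _).1 h2), (hVs y h1).2⟩, h1⟩


end RemmertStein

/- STATEMENT 8: Remmert–Stein type theorem.  If A is a Hilbert analytic subset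
of codimension ≥ 2 of (an open set of) a complex Hilbert manifold and C is an
analytic subset of pure codimension one of U \ A, then the closure of C is
analytic in U. -/

theorem closure_of_pure_codim_one_is_analytic
    {E : Type*} [NormedAddCommGroup E] [InnerProductSpace ℂ E] [CompleteSpace E]
    [TopologicalSpace.SeparableSpace E]
    (U : Set E) (hU : IsOpen U)
    (A : Set E) (hA : IsHilbertAnalyticIn A U)
    (hcodimA : ∀ a ∈ A, GermCodimAtLeast A a 2)
    (C : Set E) (hC : IsHilbertAnalyticIn C (U \ A))
    (hcodimC : ∀ a ∈ C, GermCodimAtLeast C a 1 ∧ ¬ GermCodimAtLeast C a 2) :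
    IsHilbertAnalyticIn (closure C ∩ U) U := by
  refine ⟨inter_subset_right, fun a ha => ?_⟩
  by_cases haA : a ∈ A
  · obtain ⟨V, hV, haV, hVU, h, hh, hAV⟩ := hA.2 a ha
    obtain ⟨T, hT, V', hV', haV', hTV⟩ := hcodimA a haA
    obtain ⟨t₁, t₂, ℓ, ht₁, ht₂, ht₂0, hℓ₁, hℓ₂⟩ := RemmertStein.exists_basis_dual_of_finrank_eq_two hT
    obtain ⟨f, hf⟩ := RemmertStein.exists_holAt_closure_iff_of_codim hC hcodimC
      (hV.inter hV') ⟨haV, haV'⟩ (inter_subset_left.trans hVU)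
      (fun y hy => RemmertStein.holAt_of_differentiableOn hh hV hy.1)
      (fun y hy => by simpa [hy.1] using Set.ext_iff.1 hAV y) hℓ₁ hℓ₂ (by
        intro α β h0 hm hmA
        have h1 := hTV _ ⟨hmA, hm.2⟩ (by
          rw [add_sub_cancel_left]
          exact T.add_mem (T.smul_mem α ht₁) (T.smul_mem β ht₂))
        have h2 : α • t₁ + β • t₂ = 0 := by simpa using h1
        have hα : α = 0 := by simpa [hℓ₁, hℓ₂] using congrArg ℓ h2
        rw [hα, zero_smul, zero_add, smul_eq_zero] at h2
        exact h0.elim (fun h => h hα) fun h => h (h2.resolve_right ht₂0))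
    exact RemmertStein.exists_ellTwo_of_holAt hU ha hf
  · obtain ⟨V, hV, haV, hVU, h, hh, hCV⟩ := hC.2 a ⟨ha, haA⟩
    refine ⟨V, hV, haV, hVU.trans sdiff_subset, h, hh, ?_⟩
    ext y
    constructor
    · rintro ⟨⟨hyC, -⟩, hyV⟩
      refine ⟨hyV, ?_⟩
      by_contra h0
      obtain ⟨z, hzC, hzV, hz0⟩ := ((mem_closure_iff_frequently.1 hyC).and_eventually
        (Filter.Eventually.and (hV.mem_nhds hyV)
          ((hh.differentiableAt (hV.mem_nhds hyV)).continuousAt.eventually_ne h0))).exists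
      exact hz0 ((Set.ext_iff.1 hCV z).1 ⟨hzC, hzV⟩).2
    · intro hy
      have hyC := ((Set.ext_iff.1 hCV y).2 hy).1
      exact ⟨⟨subset_closure hyC, (hC.1 hyC).1⟩, hy.1⟩
end
end

section
/- Let B be the open unit ball of a separable complex Hilbert space L, A an analytic subset of B that does not contain a principal germ at any of its points (in particular, codim A ≥ 2), and F a complex Hilbert space. Then every holomorphic map h : B \ A → F extends holomorphically to B. -/
noncomputable section
open Set Metric

/-- The Fréchet derivative of a holomorphic map on an open subset of a normed space is
continuous. -/
lemma continuousOn_fderiv_of_differentiableOn {E F : Type*} [NormedAddCommGroup E]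
    [NormedSpace ℂ E] [NormedAddCommGroup F] [NormedSpace ℂ F] {f : E → F} {Ω : Set E}
    (hΩ : IsOpen Ω) (hf : DifferentiableOn ℂ f Ω) : ContinuousOn (fderiv ℂ f) Ω := by
  intro x hx
  refine ContinuousAt.continuousWithinAt ?_
  have hcont : ContinuousAt f x := hf.continuousOn.continuousAt (hΩ.mem_nhds hx)
  obtain ⟨R, hR, hball⟩ : ∃ R > 0, ball x R ⊆ Ω ∩ {y | dist (f y) (f x) < 1} :=
    Metric.mem_nhds_iff.1 (Filter.inter_mem (hΩ.mem_nhds hx) (hcont (ball_mem_nhds _ one_pos)))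
  have hdiff : ∀ y ∈ ball x R, DifferentiableAt ℂ f y := fun y hy =>
    hf.differentiableAt (hΩ.mem_nhds (hball hy).1)
  have hbound : ∀ y ∈ ball x (R / 2), ‖fderiv ℂ f y‖ ≤ 2 / (R / 2) := by
    intro y hy
    have hsub : ball y (R / 2) ⊆ ball x R := by
      refine ball_subset_ball' ?_
      have := mem_ball.1 hy
      linarith
    refine Complex.norm_fderiv_le_div_of_mapsTo_ball
      (fun z hz => (hdiff z (hsub hz)).differentiableWithinAt) (fun z hz => ?_) (by positivity)
    have h1 := (hball (hsub hz)).2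
    have h2 := (hball (hsub (mem_ball_self (by positivity : 0 < R / 2)))).2
    simp only [mem_ofPred_eq] at h1 h2
    rw [mem_closedBall]
    have := dist_triangle_right (f z) (f y) (f x)
    linarith
  set K : ℝ := 2 / (R / 2) with hK
  have hlip : ∀ y ∈ ball x (R / 2), ∀ z ∈ ball x (R / 2), ‖f z - f y‖ ≤ K * ‖z - y‖ :=
    fun y hy z hz => (convex_ball x (R / 2)).norm_image_sub_le_of_norm_fderiv_le (𝕜 := ℂ)
      (fun w hw => hdiff w (ball_subset_ball (by linarith) hw)) hbound hy hz
  have hmain : ∀ y ∈ ball x (R / 4),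
      ‖fderiv ℂ f y - fderiv ℂ f x‖ ≤ (2 * K * ‖y - x‖) / (R / 4) := by
    intro y hy
    have hy' : ‖y - x‖ < R / 4 := by rwa [← dist_eq_norm]
    have hshift : ∀ z ∈ ball x (R / 4), z + (y - x) ∈ ball x (R / 2) := by
      intro z hz
      rw [mem_ball, dist_eq_norm] at hz ⊢
      calc ‖z + (y - x) - x‖ = ‖(z - x) + (y - x)‖ := by congr 1; abel
        _ ≤ ‖z - x‖ + ‖y - x‖ := norm_add_le _ _
        _ < R / 2 := by linarith
    have hd1 : ∀ z ∈ ball x (R / 4), DifferentiableAt ℂ (fun z => f (z + (y - x))) z :=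
      fun z hz => (differentiableAt_comp_add_right (y - x)).2
        (hdiff _ (ball_subset_ball (by linarith) (hshift z hz)))
    have hd2 : ∀ z ∈ ball x (R / 4), DifferentiableAt ℂ f z :=
      fun z hz => hdiff _ (ball_subset_ball (by linarith) hz)
    have hxm : x ∈ ball x (R / 4) := mem_ball_self (by positivity)
    have hD : fderiv ℂ (fun z => f (z + (y - x)) - f z) x = fderiv ℂ f y - fderiv ℂ f x := by
      rw [fderiv_fun_sub (hd1 x hxm) (hd2 x hxm), fderiv_comp_add_right]
      simp
    rw [← hD]
    have hsmall : ∀ z ∈ ball x (R / 4), ‖f (z + (y - x)) - f z‖ ≤ K * ‖y - x‖ := by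
      intro z hz
      simpa using hlip z (ball_subset_ball (by linarith) hz) _ (hshift z hz)
    refine Complex.norm_fderiv_le_div_of_mapsTo_ball
      (fun z hz => ((hd1 z hz).sub (hd2 z hz)).differentiableWithinAt) (fun z hz => ?_)
      (by positivity)
    rw [mem_closedBall, dist_eq_norm]
    refine (norm_sub_le _ _).trans ?_
    have h1 := hsmall z hz
    have h2 := hsmall x hxm
    linarith
  rw [ContinuousAt, tendsto_iff_norm_sub_tendsto_zero]
  refine squeeze_zero' (Filter.Eventually.of_forall fun _ => norm_nonneg _)
    (Filter.eventually_of_mem (ball_mem_nhds x (by positivity : 0 < R / 4)) hmain) ?_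
  have : Continuous fun y : E => (2 * K * ‖y - x‖) / (R / 4) := by fun_prop
  simpa using this.tendsto x

/-- Holomorphic dependence on a translation parameter of an integral along a curve. -/
lemma differentiableAt_intervalIntegral_comp_add {E F : Type*} [NormedAddCommGroup E]
    [NormedSpace ℂ E] [NormedAddCommGroup F] [NormedSpace ℂ F] {f : E → F} {Ω : Set E}
    (hΩ : IsOpen Ω) (hf : DifferentiableOn ℂ f Ω) {γ : ℝ → E} (hγ : Continuous γ) {k : ℝ → ℂ}
    (hk : Continuous k) {a b : ℝ} {x : E} (hx : ∀ t ∈ uIcc a b, x + γ t ∈ Ω) :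
    DifferentiableAt ℂ (fun z => ∫ t in a..b, k t • f (z + γ t)) x := by
  have hfd := continuousOn_fderiv_of_differentiableOn hΩ hf
  have hcompact : IsCompact ((fun t => x + γ t) '' uIcc a b) :=
    isCompact_uIcc.image (by fun_prop)
  obtain ⟨M, hM⟩ := hcompact.exists_bound_of_continuousOn
    (hfd.mono (by rintro _ ⟨t, ht, rfl⟩; exact hx t ht))
  obtain ⟨C, hC⟩ := (isCompact_uIcc (a := a) (b := b)).exists_bound_of_continuousOn hk.continuousOn
  have hopen : IsOpen (Ω ∩ {y | ‖fderiv ℂ f y‖ < M + 1}) :=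
    hfd.norm.isOpen_inter_preimage hΩ isOpen_Iio
  obtain ⟨δ, hδ, hthick⟩ := hcompact.exists_thickening_subset_open hopen (by
    rintro _ ⟨t, ht, rfl⟩
    exact ⟨hx t ht, (hM _ ⟨t, ht, rfl⟩).trans_lt (lt_add_one M)⟩)
  have hmem : ∀ t ∈ uIcc a b, ∀ z ∈ ball x δ, z + γ t ∈ Ω ∧ ‖fderiv ℂ f (z + γ t)‖ < M + 1 := by
    intro t ht z hz
    refine hthick (mem_thickening_iff.2 ⟨x + γ t, ⟨t, ht, rfl⟩, ?_⟩)
    simpa using hz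
  have hcontf : ∀ z ∈ ball x δ, ContinuousOn (fun t => k t • f (z + γ t)) (uIcc a b) := by
    intro z hz
    refine hk.continuousOn.smul (hf.continuousOn.comp (by fun_prop) fun t ht => (hmem t ht z hz).1)
  have hxδ : x ∈ ball x δ := mem_ball_self hδ
  refine (intervalIntegral.hasFDerivAt_integral_of_dominated_of_fderiv_le
    (F' := fun z t => k t • fderiv ℂ f (z + γ t)) (bound := fun _ => C * (M + 1))
    (ball_mem_nhds x hδ) ?_ (hcontf x hxδ).intervalIntegrable ?_ ?_
    intervalIntegrable_const ?_).differentiableAt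
  · filter_upwards [ball_mem_nhds x hδ] with z hz
    exact (((hcontf z hz).mono uIoc_subset_uIcc).aestronglyMeasurable measurableSet_uIoc)
  · refine ContinuousOn.aestronglyMeasurable (ContinuousOn.mono ?_ uIoc_subset_uIcc)
      measurableSet_uIoc
    exact hk.continuousOn.smul (hfd.comp (by fun_prop) fun t ht => (hmem t ht x hxδ).1)
  · refine Filter.Eventually.of_forall fun t ht z hz => ?_
    have ht' := uIoc_subset_uIcc ht
    rw [norm_smul]
    exact mul_le_mul (hC t ht') (hmem t ht' z hz).2.le (norm_nonneg _)
      ((norm_nonneg _).trans (hC t ht'))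
  · refine Filter.Eventually.of_forall fun t ht z hz => ?_
    have ht' := uIoc_subset_uIcc ht
    have h1 := (hf.differentiableAt (hΩ.mem_nhds (hmem t ht' z hz).1)).hasFDerivAt
    exact ((hasFDerivAt_comp_add_right (γ t)).2 h1).const_smul (k t)

/-- The derivative of a holomorphic map restricted to a complex line. -/
lemma hasDerivAt_comp_add_smul {E F : Type*} [NormedAddCommGroup E] [NormedSpace ℂ E]
    [NormedAddCommGroup F] [NormedSpace ℂ F] {f : E → F} {z e : E} {w : ℂ}
    (hf : DifferentiableAt ℂ f (z + w • e)) :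
    HasDerivAt (fun u : ℂ => f (z + u • e)) (fderiv ℂ f (z + w • e) e) w := by
  have h1 : HasDerivAt (fun u : ℂ => z + u • e) e w := by
    simpa using ((hasDerivAt_id w).smul_const e).const_add z
  exact hf.hasFDerivAt.comp_hasDerivAt w h1

/-- Directional derivatives of holomorphic maps are holomorphic. -/
lemma differentiableOn_fderiv_apply {E F : Type*} [NormedAddCommGroup E] [NormedSpace ℂ E]
    [NormedAddCommGroup F] [NormedSpace ℂ F] [CompleteSpace F] {f : E → F} {Ω : Set E}
    (hΩ : IsOpen Ω) (hf : DifferentiableOn ℂ f Ω) (e : E) :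
    DifferentiableOn ℂ (fun z => fderiv ℂ f z e) Ω := by
  intro x hx
  refine DifferentiableAt.differentiableWithinAt ?_
  have hev : ∀ᶠ p : E × ℂ in nhds (x, 0), p.1 + p.2 • e ∈ Ω := by
    have hc : Continuous fun p : E × ℂ => p.1 + p.2 • e := by fun_prop
    exact hc.continuousAt.eventually (hΩ.mem_nhds (by simpa using hx))
  obtain ⟨δ, hδ, hball⟩ := Metric.eventually_nhds_iff.1 hev
  have hmem : ∀ z ∈ ball x δ, ∀ w ∈ closedBall (0 : ℂ) (δ / 2), z + w • e ∈ Ω := by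
    intro z hz w hw
    refine hball (y := (z, w)) ?_
    rw [Prod.dist_eq]
    refine max_lt hz ?_
    have := mem_closedBall.1 hw
    simp only
    linarith
  have hδ2 : 0 < δ / 2 := by positivity
  have hne : ∀ θ : ℝ, circleMap 0 (δ / 2) θ ≠ 0 := fun θ => circleMap_ne_center hδ2.ne'
  have hint := differentiableAt_intervalIntegral_comp_add hΩ hf
    (γ := fun θ => circleMap 0 (δ / 2) θ • e) (by fun_prop)
    (k := fun θ => (2 * Real.pi * Complex.I)⁻¹ *
      (deriv (circleMap 0 (δ / 2)) θ * (1 / (circleMap 0 (δ / 2) θ - 0) ^ 2)))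
    (by
      simp only [deriv_circleMap, sub_zero]
      have : Continuous fun θ => (1 / (circleMap 0 (δ / 2) θ) ^ 2) :=
        continuous_const.div (by fun_prop) fun θ => pow_ne_zero 2 (hne θ)
      fun_prop) (a := 0) (b := 2 * Real.pi) (x := x)
    (fun t _ => hmem x (mem_ball_self hδ) _ (circleMap_mem_closedBall 0 hδ2.le t))
  refine hint.congr_of_eventuallyEq ?_
  filter_upwards [ball_mem_nhds x hδ] with z hz
  have hline : ∀ w ∈ closedBall (0 : ℂ) (δ / 2),
      HasDerivAt (fun u : ℂ => f (z + u • e)) (fderiv ℂ f (z + w • e) e) w :=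
    fun w hw => hasDerivAt_comp_add_smul (hf.differentiableAt (hΩ.mem_nhds (hmem z hz w hw)))
  have hcauchy := DifferentiableOn.deriv_eq_smul_circleIntegral (f := fun u : ℂ => f (z + u • e))
    hδ2 (fun w hw => (hline w hw).differentiableAt.differentiableWithinAt)
  have h0 := (hline 0 (mem_closedBall_self hδ2.le)).deriv
  simp only [zero_smul, add_zero] at h0
  rw [h0, eq_comm, ← eq_inv_smul_iff₀ Complex.two_pi_I_ne_zero] at hcauchy
  rw [hcauchy, circleIntegral, ← intervalIntegral.integral_smul]
  simp only [smul_smul]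

/-- A holomorphic function on a neighbourhood of `b` that vanishes at `b` with nonzero derivative
in the direction `e` has at most one zero on each line parallel to `e` near `b`. -/
lemma exists_closedBall_unique_zero_on_lines {E : Type*} [NormedAddCommGroup E] [NormedSpace ℂ E]
    {g : E → ℂ} {Ω : Set E} (hΩ : IsOpen Ω) (hg : DifferentiableOn ℂ g Ω) {b e : E} (hb : b ∈ Ω)
    (hd : fderiv ℂ g b e ≠ 0) :
    ∃ ρ > 0, closedBall b ρ ⊆ Ω ∧ ∀ x ∈ closedBall b ρ, fderiv ℂ g x e ≠ 0 ∧
      ∀ w : ℂ, x + w • e ∈ closedBall b ρ → g x = 0 → g (x + w • e) = 0 → w = 0 := by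
  have hfd := continuousOn_fderiv_of_differentiableOn hΩ hg
  have hcont : ContinuousAt (fderiv ℂ g) b := hfd.continuousAt (hΩ.mem_nhds hb)
  have hstrict : HasStrictFDerivAt g (fderiv ℂ g b) b :=
    hasStrictFDerivAt_of_hasFDerivAt_of_continuousAt
      (Filter.eventually_of_mem (hΩ.mem_nhds hb) fun y hy =>
        (hg.differentiableAt (hΩ.mem_nhds hy)).hasFDerivAt) hcont
  have he : 0 < ‖e‖ := norm_pos_iff.2 fun h => hd (by simp [h])
  have hc : 0 < ‖fderiv ℂ g b e‖ / (2 * ‖e‖) := by positivity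
  have hlin := (Asymptotics.isLittleO_iff.1
    (hasStrictFDerivAt_iff_isLittleO.1 hstrict)) hc
  obtain ⟨ρ₁, hρ₁, h1⟩ := Metric.eventually_nhds_iff.1 hlin
  have hne : ∀ᶠ x in nhds b, x ∈ Ω ∧ fderiv ℂ g x e ≠ 0 :=
    (hΩ.eventually_mem hb).and ((hcont.clm_apply continuousAt_const).eventually_ne hd)
  obtain ⟨ρ₂, hρ₂, h2⟩ := Metric.eventually_nhds_iff.1 hne
  have hlt : ∀ x ∈ closedBall b (min ρ₁ ρ₂ / 2), dist x b < ρ₁ ∧ dist x b < ρ₂ := by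
    intro x hx
    have h3 := mem_closedBall.1 hx
    have h4 : min ρ₁ ρ₂ / 2 < min ρ₁ ρ₂ := half_lt_self (lt_min hρ₁ hρ₂)
    exact ⟨(h3.trans_lt h4).trans_le (min_le_left _ _), (h3.trans_lt h4).trans_le (min_le_right _ _)⟩
  refine ⟨min ρ₁ ρ₂ / 2, half_pos (lt_min hρ₁ hρ₂), fun x hx => (h2 (hlt x hx).2).1,
    fun x hx => ⟨(h2 (hlt x hx).2).2, fun w hw hgx hgw => ?_⟩⟩
  have h5 := h1 (y := (x + w • e, x)) (by
    rw [Prod.dist_eq]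
    exact max_lt (hlt _ hw).1 (hlt _ hx).1)
  simp only [hgx, hgw, add_sub_cancel_left, map_smul, sub_self, zero_sub, norm_neg,
    norm_smul] at h5
  have h6 : ‖fderiv ℂ g b e‖ / (2 * ‖e‖) * (‖w‖ * ‖e‖) = ‖w‖ * ‖fderiv ℂ g b e‖ / 2 := by
    field_simp
  rw [h6] at h5
  have h7 : 0 < ‖fderiv ℂ g b e‖ := norm_pos_iff.2 hd
  by_contra hw0
  have h8 : 0 < ‖w‖ * ‖fderiv ℂ g b e‖ := mul_pos (norm_pos_iff.2 hw0) h7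
  linarith

/-- The iterated derivative of `f` in the direction `e`. -/
def iteratedDirDeriv {E : Type*} [NormedAddCommGroup E] [NormedSpace ℂ E] (f : E → ℂ) (e : E) :
    ℕ → E → ℂ
  | 0 => f
  | k + 1 => fun z => fderiv ℂ (iteratedDirDeriv f e k) z e

lemma differentiableOn_iteratedDirDeriv {E : Type*} [NormedAddCommGroup E] [NormedSpace ℂ E]
    {f : E → ℂ} {Ω : Set E} (hΩ : IsOpen Ω) (hf : DifferentiableOn ℂ f Ω) (e : E) (k : ℕ) :
    DifferentiableOn ℂ (iteratedDirDeriv f e k) Ω := by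
  induction k with
  | zero => exact hf
  | succ k ih => exact differentiableOn_fderiv_apply hΩ ih e

lemma iteratedDeriv_comp_add_smul {E : Type*} [NormedAddCommGroup E] [NormedSpace ℂ E]
    {f : E → ℂ} {Ω : Set E} (hΩ : IsOpen Ω) (hf : DifferentiableOn ℂ f Ω) (z e : E) (k : ℕ) :
    ∀ w : ℂ, z + w • e ∈ Ω →
      iteratedDeriv k (fun u : ℂ => f (z + u • e)) w = iteratedDirDeriv f e k (z + w • e) := by
  induction k with
  | zero => intro w _; simp [iteratedDirDeriv]
  | succ k ih =>
    intro w hw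
    rw [iteratedDeriv_succ]
    have hopen : IsOpen ((fun u : ℂ => z + u • e) ⁻¹' Ω) := hΩ.preimage (by fun_prop)
    have hev : iteratedDeriv k (fun u : ℂ => f (z + u • e)) =ᶠ[nhds w]
        fun u => iteratedDirDeriv f e k (z + u • e) :=
      Filter.eventually_of_mem (hopen.mem_nhds hw) fun u hu => ih u hu
    rw [hev.deriv_eq]
    exact (hasDerivAt_comp_add_smul
      ((differentiableOn_iteratedDirDeriv hΩ hf e k).differentiableAt (hΩ.mem_nhds hw))).deriv

/-- A holomorphic function that does not vanish identically on a complex disc has a nonzero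
iterated derivative in the direction of the disc at each of its points. -/
lemma exists_iteratedDirDeriv_ne_zero {E : Type*} [NormedAddCommGroup E] [NormedSpace ℂ E]
    {f : E → ℂ} {Ω : Set E} (hΩ : IsOpen Ω) (hf : DifferentiableOn ℂ f Ω) {z e : E} {r : ℝ}
    (hdisc : ∀ w ∈ closedBall (0 : ℂ) r, z + w • e ∈ Ω) {v : ℂ} (hv : v ∈ closedBall (0 : ℂ) r)
    (hfv : f (z + v • e) ≠ 0) {w : ℂ} (hw : w ∈ closedBall (0 : ℂ) r) :
    ∃ k, iteratedDirDeriv f e k (z + w • e) ≠ 0 := by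
  by_contra! hall
  have hopen : IsOpen ((fun u : ℂ => z + u • e) ⁻¹' Ω) := hΩ.preimage (by fun_prop)
  have han : AnalyticOnNhd ℂ (fun u : ℂ => f (z + u • e)) (closedBall 0 r) := by
    refine (DifferentiableOn.analyticOnNhd (fun u hu => ?_) hopen).mono hdisc
    exact (hasDerivAt_comp_add_smul
      (hf.differentiableAt (hΩ.mem_nhds hu))).differentiableAt.differentiableWithinAt
  have htop : analyticOrderAt (fun u : ℂ => f (z + u • e)) w = ⊤ := by
    refine ENat.eq_top_iff_forall_ge.2 fun n => ?_
    rw [natCast_le_analyticOrderAt_iff_iteratedDeriv_eq_zero (han w hw)]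
    intro i _
    rw [iteratedDeriv_comp_add_smul hΩ hf z e i w (hdisc w hw), hall i]
  exact hfv (han.eqOn_zero_of_preconnected_of_eventuallyEq_zero
    (convex_closedBall 0 r).isPreconnected hw (analyticOrderAt_eq_top.1 htop) hv)

open scoped Pointwise in
/-- If a germ of `A` lies in `{f = 0}` and contains no principal germ, then for a dense set of
centres the discs in a direction along which `f` does not vanish identically avoid `A`. -/
lemma exists_disc_disjoint_of_no_principal_germ {E G : Type*} [NormedAddCommGroup E]
    [NormedSpace ℂ E] [CompleteSpace E] [TopologicalSpace.SeparableSpace E]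
    [NormedAddCommGroup G] {A V : Set E} (hV : IsOpen V) {φ : E → G} (hφ : ContinuousOn φ V)
    (hAV : A ∩ V = {z ∈ V | φ z = 0}) (hnp : ∀ a ∈ A, ¬ ContainsPrincipalGermAt A a)
    {f : E → ℂ} (hf : DifferentiableOn ℂ f V) (hfA : ∀ z ∈ A ∩ V, f z = 0) {e : E} {r : ℝ}
    {v : ℂ} (hv : v ∈ closedBall (0 : ℂ) r) {U : Set E} (hU : IsOpen U) (hUne : U.Nonempty)
    (hdisc : ∀ z ∈ U, ∀ w ∈ closedBall (0 : ℂ) r, z + w • e ∈ V)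
    (hfv : ∀ z ∈ U, f (z + v • e) ≠ 0) :
    ∃ z ∈ U, ∀ w ∈ closedBall (0 : ℂ) r, z + w • e ∉ A := by
  have := UniformSpace.secondCountable_of_separable E
  by_contra! hcon
  set g := iteratedDirDeriv f e with hg
  have hgd : ∀ k, DifferentiableOn ℂ (g k) V := differentiableOn_iteratedDirDeriv hV hf e
  let R : ℕ → Set E := fun k => {b ∈ A ∩ V | g k b = 0 ∧ g (k + 1) b ≠ 0}
  have hR : ∀ z ∈ U, ∃ w ∈ closedBall (0 : ℂ) r, ∃ k, z + w • e ∈ R k := by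
    intro z hz
    obtain ⟨w, hw, hwA⟩ := hcon z hz
    refine ⟨w, hw, ?_⟩
    have hex : ∃ k, g k (z + w • e) ≠ 0 :=
      exists_iteratedDirDeriv_ne_zero hV hf (hdisc z hz) hv (hfv z hz) hw
    classical
    have hpos : Nat.find hex ≠ 0 := by
      intro h0
      have := Nat.find_spec hex
      rw [h0] at this
      exact this (hfA _ ⟨hwA, hdisc z hz w hw⟩)
    obtain ⟨k, hk⟩ := Nat.exists_eq_succ_of_ne_zero hpos
    refine ⟨k, ⟨hwA, hdisc z hz w hw⟩, ?_, ?_⟩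
    · have := Nat.find_min hex (m := k) (by omega)
      simpa using this
    · have := Nat.find_spec hex
      rwa [hk] at this
  have hloc : ∀ k b, ∃ ρ > 0, b ∈ R k → closedBall b ρ ⊆ V ∧ ∀ x ∈ closedBall b ρ,
      fderiv ℂ (g k) x e ≠ 0 ∧
      ∀ w : ℂ, x + w • e ∈ closedBall b ρ → g k x = 0 → g k (x + w • e) = 0 → w = 0 := by
    intro k b
    by_cases hb : b ∈ R k
    · obtain ⟨ρ, hρ, h⟩ := exists_closedBall_unique_zero_on_lines hV (hgd k) hb.1.2 hb.2.2
      exact ⟨ρ, hρ, fun _ => h⟩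
    · exact ⟨1, one_pos, fun h => absurd h hb⟩
  choose ρ hρ hloc using hloc
  have hcover : ∀ k, ∃ t ⊆ R k, t.Countable ∧ R k ⊆ ⋃ b ∈ t, ball b (ρ k b / 2) := fun k =>
    TopologicalSpace.countable_cover_nhdsWithin fun b _ =>
      mem_nhdsWithin_of_mem_nhds (ball_mem_nhds b (half_pos (hρ k b)))
  choose t htR htc htU using hcover
  let C : ℕ × E → Set E := fun p =>
    {z ∈ closedBall p.2 (ρ p.1 p.2 / 2) | φ z = 0 ∧ g p.1 z = 0}
  have hhalf : ∀ k b, closedBall b (ρ k b / 2) ⊆ closedBall b (ρ k b) := fun k b =>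
    closedBall_subset_closedBall (half_le_self (hρ k b).le)
  let D : Set E := (fun w : ℂ => w • (-e)) '' closedBall 0 r
  have hD : IsCompact D := (isCompact_closedBall 0 r).image (by fun_prop)
  let T : Set (ℕ × E) := ⋃ k, (fun b => (k, b)) '' t k
  have hTc : T.Countable := countable_iUnion fun k => (htc k).image _
  have hTR : ∀ p ∈ T, p.2 ∈ R p.1 := by
    intro p hp
    obtain ⟨k, b, hb, rfl⟩ := mem_iUnion.1 hp
    exact htR k hb
  have hCclosed : ∀ p ∈ T, IsClosed (C p) := by
    intro p hp
    have hsub := (hhalf p.1 p.2).trans (hloc p.1 p.2 (hTR p hp)).1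
    have := ((hφ.mono hsub).prodMk ((hgd p.1).continuousOn.mono hsub)).preimage_isClosed_of_isClosed
      isClosed_closedBall (isClosed_singleton (x := ((0 : G), (0 : ℂ))))
    convert this using 1
    ext z
    simp [C]
  let S : Set (Set E) := insert Uᶜ ((fun p => C p + D) '' T)
  have hSclosed : ∀ s ∈ S, IsClosed s := by
    rintro s (rfl | ⟨p, hp, rfl⟩)
    · exact hU.isClosed_compl
    · exact (hCclosed p hp).add_right_of_isCompact hD
  have hSc : S.Countable := (hTc.image _).insert _
  have hSU : ⋃₀ S = univ := by
    refine eq_univ_of_forall fun z => ?_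
    by_cases hz : z ∈ U
    · obtain ⟨w, hw, k, hk⟩ := hR z hz
      obtain ⟨b, hb, hzb⟩ := mem_iUnion₂.1 (htU k hk)
      refine ⟨C (k, b) + D, Or.inr ⟨(k, b), mem_iUnion.2 ⟨k, b, hb, rfl⟩, rfl⟩,
        z + w • e, ⟨ball_subset_closedBall hzb, ?_, hk.2.1⟩, w • (-e), ⟨w, hw, rfl⟩, by simp⟩
      exact (hAV.subset hk.1).2
    · exact ⟨Uᶜ, Or.inl rfl, hz⟩
  obtain ⟨z, hzU, hz⟩ := (dense_sUnion_interior_of_closed hSclosed hSc hSU).inter_open_nonempty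
    U hU hUne
  obtain ⟨s, hs, hzs⟩ := mem_iUnion₂.1 hz
  rcases hs with rfl | ⟨p, hp, rfl⟩
  · exact interior_subset hzs hzU
  obtain ⟨c, hc, _, ⟨w, hw, rfl⟩, hcw⟩ := interior_subset hzs
  obtain ⟨hball, hline⟩ := hloc p.1 p.2 (hTR p hp)
  have hCball : ∀ x ∈ C p, x ∈ closedBall p.2 (ρ p.1 p.2) := fun x hx => hhalf _ _ hx.1
  have hCA : C p ⊆ A := fun x hx =>
    (hAV.superset (show x ∈ {z ∈ V | φ z = 0} from ⟨hball (hCball x hx), hx.2.1⟩)).1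
  have hcz : c + w • (-e) = z := hcw
  refine hnp c (hCA hc) ⟨V, hV, hball (hCball c hc), g p.1, hgd p.1, hc.2.2, ?_,
    ball p.2 (ρ p.1 p.2) ∩ (fun x => x + w • (-e)) ⁻¹' interior (C p + D),
    isOpen_ball.inter (isOpen_interior.preimage (by fun_prop)),
    ⟨closedBall_subset_ball (half_lt_self (hρ p.1 p.2)) hc.1, ?_⟩,
    fun x hx => hball (ball_subset_closedBall hx.1), ?_⟩
  · by_contra! hzero
    refine (hline c (hCball c hc)).1 ?_
    have : g p.1 =ᶠ[nhds c] fun _ => 0 :=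
      Filter.eventually_of_mem (hV.mem_nhds (hball (hCball c hc))) hzero
    rw [this.fderiv_eq]
    simp
  · rw [mem_preimage, hcz]
    exact hzs
  · rintro x ⟨⟨hxb, hxi⟩, hgx⟩
    obtain ⟨c', hc', _, ⟨w', hw', rfl⟩, hcw'⟩ := interior_subset hxi
    have hcx : x + (w' - w) • e = c' := by
      have h1 : c' + w' • (-e) = x + w • (-e) := hcw'
      rw [eq_sub_of_add_eq h1]
      module
    have hww := (hline x (ball_subset_closedBall hxb)).2 (w' - w)
      (by rw [hcx]; exact hCball c' hc') hgx (by rw [hcx]; exact hc'.2.2)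
    rw [hww, zero_smul, add_zero] at hcx
    rw [hcx]
    exact hCA hc'

/-- A set containing no principal germ has dense complement. -/
lemma dense_compl_of_no_principal_germ {E : Type*} [NormedAddCommGroup E] [NormedSpace ℂ E]
    [Nontrivial E] {A : Set E} (hnp : ∀ a ∈ A, ¬ ContainsPrincipalGermAt A a) : Dense Aᶜ := by
  rw [← interior_eq_empty_iff_dense_compl, eq_empty_iff_forall_notMem]
  intro a ha
  obtain ⟨e, he⟩ := exists_ne (0 : E)
  obtain ⟨ℓ, -, hℓ⟩ := exists_dual_vector ℂ e (norm_ne_zero_iff.2 he)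
  refine hnp a (interior_subset ha) ⟨interior A, isOpen_interior, ha, fun z => ℓ (z - a),
    by fun_prop, by simp, ?_, interior A, isOpen_interior, ha, subset_rfl,
    fun z hz => interior_subset hz.1⟩
  by_contra! hzero
  have h0 : (fun z => ℓ (z - a)) =ᶠ[nhds a] fun _ => 0 :=
    Filter.eventually_of_mem (isOpen_interior.mem_nhds ha) hzero
  have h1 : HasFDerivAt (fun z => ℓ (z - a)) ℓ a :=
    ℓ.hasFDerivAt.comp a ((hasFDerivAt_id a).sub_const a)
  have h2 : ℓ = 0 := by
    rw [← h1.fderiv, h0.fderiv_eq]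
    simp
  rw [h2, zero_apply] at hℓ
  exact norm_ne_zero_iff.2 he (RCLike.ofReal_eq_zero.1 hℓ.symm)

/-- An analytic subset of an open set is relatively closed. -/
lemma IsHilbertAnalyticIn.isOpen_diff {E : Type*} [NormedAddCommGroup E] [NormedSpace ℂ E]
    {A B : Set E} (hA : IsHilbertAnalyticIn A B) : IsOpen (B \ A) := by
  rw [isOpen_iff_mem_nhds]
  rintro a ⟨haB, haA⟩
  obtain ⟨V, hV, haV, hVB, φ, hφ, hAV⟩ := hA.2 a haB
  have hopen : IsOpen (V ∩ φ ⁻¹' {0}ᶜ) :=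
    hφ.continuousOn.isOpen_inter_preimage hV isOpen_compl_singleton
  have hmem : a ∈ V ∩ φ ⁻¹' {0}ᶜ :=
    ⟨haV, fun h => haA (hAV.superset (show a ∈ {z ∈ V | φ z = 0} from ⟨haV, h⟩)).1⟩
  filter_upwards [hopen.mem_nhds hmem] with z hz
  exact ⟨hVB hz.1, fun hzA => hz.2 (hAV.subset ⟨hzA, hz.1⟩).2⟩

/-- Near a zero of a holomorphic function that does not vanish identically, there are a complex
direction and a circle such that the function has no zero on small translates of the circle. -/
lemma exists_circle_ne_zero {E : Type*} [NormedAddCommGroup E] [NormedSpace ℂ E]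
    {f : E → ℂ} {V : Set E} (hV : IsOpen V) (hf : DifferentiableOn ℂ f V) {a : E} {ρ : ℝ}
    (hball : ball a ρ ⊆ V) (hfa : f a = 0) {y : E} (hy : y ∈ ball a ρ) (hfy : f y ≠ 0) :
    ∃ e : E, ∃ r > 0, ∃ δ > 0, ∀ z ∈ ball a δ, ∀ w ∈ closedBall (0 : ℂ) r,
      z + w • e ∈ V ∧ (w ∈ sphere (0 : ℂ) r → f (z + w • e) ≠ 0) := by
  set e := y - a with he
  have hρ : 0 < ρ := pos_of_mem_ball hy
  have hye : a + (1 : ℂ) • e = y := by simp [he]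
  have he0 : 0 < ‖e‖ := norm_pos_iff.2 fun h => hfy (by
    rw [← hye, h, smul_zero, add_zero, hfa])
  have hlt : ‖e‖ < ρ := by rwa [he, ← dist_eq_norm]
  have hmem : ∀ w ∈ ball (0 : ℂ) (ρ / ‖e‖), a + w • e ∈ V := by
    intro w hw
    refine hball ?_
    rw [mem_ball_zero_iff, lt_div_iff₀ he0] at hw
    simpa [dist_eq_norm, norm_smul] using hw
  have h0 : (0 : ℂ) ∈ ball (0 : ℂ) (ρ / ‖e‖) := mem_ball_self (by positivity)
  have h1 : (1 : ℂ) ∈ ball (0 : ℂ) (ρ / ‖e‖) := by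
    rw [mem_ball_zero_iff, norm_one, lt_div_iff₀ he0]
    linarith
  have han : AnalyticOnNhd ℂ (fun u : ℂ => f (a + u • e)) (ball 0 (ρ / ‖e‖)) :=
    DifferentiableOn.analyticOnNhd (fun u hu => (hasDerivAt_comp_add_smul
      (hf.differentiableAt (hV.mem_nhds (hmem u hu)))).differentiableAt.differentiableWithinAt)
      isOpen_ball
  have hpunct : ∀ᶠ u in nhdsWithin (0 : ℂ) {0}ᶜ, f (a + u • e) ≠ 0 := by
    refine (han 0 h0).eventually_eq_zero_or_eventually_ne_zero.resolve_left fun hz => hfy ?_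
    have h2 : f (a + (1 : ℂ) • e) = 0 := han.eqOn_zero_of_preconnected_of_eventuallyEq_zero
      (convex_ball 0 _).isPreconnected h0 hz h1
    rwa [hye] at h2
  rw [eventually_nhdsWithin_iff] at hpunct
  obtain ⟨s, hs, hsball⟩ := Metric.eventually_nhds_iff.1 (hpunct.and (isOpen_ball.eventually_mem h0))
  have hsub : ∀ w ∈ closedBall (0 : ℂ) (s / 2), dist w 0 < s := fun w hw =>
    (mem_closedBall.1 hw).trans_lt (half_lt_self hs)
  have hA1 : ∀ᶠ z in nhds a, ∀ w ∈ closedBall (0 : ℂ) (s / 2), z + w • e ∈ V := by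
    refine (isCompact_closedBall (0 : ℂ) (s / 2)).eventually_forall_of_forall_eventually
      fun w hw => ?_
    have hc : Continuous fun p : E × ℂ => p.1 + p.2 • e := by fun_prop
    exact hc.continuousAt.eventually (hV.mem_nhds (hmem w (hsball (hsub w hw)).2))
  have hA2 : ∀ᶠ z in nhds a, ∀ w ∈ sphere (0 : ℂ) (s / 2), f (z + w • e) ≠ 0 := by
    refine (isCompact_sphere (0 : ℂ) (s / 2)).eventually_forall_of_forall_eventually
      fun w hw => ?_
    have hw' := hsub w (sphere_subset_closedBall hw)
    have hc : Continuous fun p : E × ℂ => p.1 + p.2 • e := by fun_prop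
    have hw0 : w ≠ 0 := ne_of_mem_sphere hw (half_pos hs).ne'
    have hfc : ContinuousAt f (a + w • e) :=
      hf.continuousOn.continuousAt (hV.mem_nhds (hmem w (hsball hw').2))
    exact (ContinuousAt.comp (f := fun p : E × ℂ => p.1 + p.2 • e) (x := (a, w)) hfc
      hc.continuousAt).eventually_ne ((hsball hw').1 hw0)
  obtain ⟨δ, hδ, hδball⟩ := Metric.eventually_nhds_iff.1 (hA1.and hA2)
  exact ⟨e, s / 2, half_pos hs, δ, hδ, fun z hz w hw => ⟨(hδball hz).1 w hw, (hδball hz).2 w⟩⟩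

/-- Local extension of holomorphic maps across an analytic set without principal germs. -/
lemma exists_local_extension {E F : Type*} [NormedAddCommGroup E] [NormedSpace ℂ E]
    [CompleteSpace E] [TopologicalSpace.SeparableSpace E] [Nontrivial E]
    [NormedAddCommGroup F] [NormedSpace ℂ F] [CompleteSpace F] {A B : Set E}
    (hA : IsHilbertAnalyticIn A B) (hnp : ∀ a ∈ A, ¬ ContainsPrincipalGermAt A a) {h : E → F}
    (hh : DifferentiableOn ℂ h (B \ A)) {a : E} (ha : a ∈ B) :
    ∃ N : Set E, IsOpen N ∧ a ∈ N ∧ N ⊆ B ∧ ∃ H : E → F,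
      DifferentiableOn ℂ H N ∧ EqOn H h (N \ A) := by
  have hopen := hA.isOpen_diff
  by_cases haA : a ∈ A
  swap
  · exact ⟨B \ A, hopen, ⟨ha, haA⟩, sdiff_subset, h, hh, fun _ _ => rfl⟩
  obtain ⟨V, hV, haV, hVB, φ, hφ, hAV⟩ := hA.2 a ha
  obtain ⟨ρ, hρ, hball⟩ := Metric.isOpen_iff.1 hV a haV
  obtain ⟨y, hy, hyA⟩ := (dense_compl_of_no_principal_germ hnp).inter_open_nonempty _
    isOpen_ball ⟨a, mem_ball_self hρ⟩
  have hφy : φ y ≠ 0 := fun h0 =>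
    hyA (hAV.superset (show y ∈ {z ∈ V | φ z = 0} from ⟨hball hy, h0⟩)).1
  obtain ⟨j, hj⟩ : ∃ j, φ y j ≠ 0 := by
    by_contra! hzero
    exact hφy (by ext j; simpa using hzero j)
  have hfd : DifferentiableOn ℂ (fun z => φ z j) V :=
    ((lp.evalCLM ℂ (fun _ : ℕ => ℂ) 2 j).differentiable.comp_differentiableOn hφ)
  have hfA : ∀ z ∈ A ∩ V, φ z j = 0 := fun z hz => by rw [(hAV.subset hz).2]; rfl
  obtain ⟨e, r, hr, δ, hδ, hcirc⟩ := exists_circle_ne_zero hV hfd hball (hfA a ⟨haA, haV⟩) hy hj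
  have hcircA : ∀ z ∈ ball a δ, ∀ w ∈ sphere (0 : ℂ) r, z + w • e ∈ B \ A := by
    intro z hz w hw
    obtain ⟨h1, h2⟩ := hcirc z hz w (sphere_subset_closedBall hw)
    exact ⟨hVB h1, fun h3 => h2 hw (hfA _ ⟨h3, h1⟩)⟩
  let H : E → F := fun z => ∫ θ in (0 : ℝ)..2 * Real.pi,
    ((2 * Real.pi : ℝ)⁻¹ : ℂ) • h (z + circleMap 0 r θ • e)
  have hH : ∀ z ∈ ball a δ, DifferentiableAt ℂ H z := fun z hz =>
    differentiableAt_intervalIntegral_comp_add hopen hh (γ := fun θ => circleMap 0 r θ • e)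
      (by fun_prop) continuous_const
      (fun θ _ => hcircA z hz _ (circleMap_mem_sphere 0 hr.le θ))
  have hHh : ∀ z ∈ ball a δ, (∀ w ∈ closedBall (0 : ℂ) r, z + w • e ∉ A) → H z = h z := by
    intro z hz hdisc
    have hd : DifferentiableOn ℂ (fun u : ℂ => h (z + u • e)) (closedBall 0 r) := fun w hw =>
      (hasDerivAt_comp_add_smul (hh.differentiableAt (hopen.mem_nhds
        ⟨hVB (hcirc z hz w hw).1, hdisc w hw⟩))).differentiableAt.differentiableWithinAt
    have hmean := DiffContOnCl.circleAverage
      (f := fun u : ℂ => h (z + u • e)) (c := 0) (R := r) (by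
        rw [abs_of_pos hr]
        exact (hd.mono closure_ball_subset_closedBall).diffContOnCl)
    simp only [zero_smul, add_zero] at hmean
    rw [← hmean, Real.circleAverage_def]
    simp only [H]
    rw [intervalIntegral.integral_smul, ← Complex.coe_smul]
    simp
  refine ⟨ball a δ ∩ B, ?_, ⟨mem_ball_self hδ, ha⟩, inter_subset_right, H,
    fun z hz => (hH z hz.1).differentiableWithinAt, ?_⟩
  · rw [isOpen_iff_mem_nhds]
    rintro z ⟨hz, hzB⟩
    filter_upwards [isOpen_ball.mem_nhds hz] with x hx
    have := (hcirc x hx 0 (mem_closedBall_self hr.le)).1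
    exact ⟨hx, hVB (by simpa using this)⟩
  · rintro z ⟨⟨hz, hzB⟩, hzA⟩
    by_contra hne
    have hcontH : ContinuousOn H (ball a δ ∩ (B \ A)) := fun x hx =>
      (hH x hx.1).continuousAt.continuousWithinAt
    have hconth : ContinuousOn h (ball a δ ∩ (B \ A)) := hh.continuousOn.mono inter_subset_right
    have hU : IsOpen ((ball a δ ∩ (B \ A)) ∩ (fun x => H x - h x) ⁻¹' {0}ᶜ) :=
      (hcontH.sub hconth).isOpen_inter_preimage (isOpen_ball.inter hopen) isOpen_compl_singleton
    have hrs : (r : ℂ) ∈ sphere (0 : ℂ) r := by simp [abs_of_pos hr]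
    obtain ⟨x, hx, hxdisc⟩ := exists_disc_disjoint_of_no_principal_germ hV hφ.continuousOn hAV hnp
      hfd hfA (e := e) (sphere_subset_closedBall hrs) hU
      ⟨z, ⟨hz, hzB, hzA⟩, fun h0 => hne (sub_eq_zero.1 h0)⟩
      (fun x hx w hw => (hcirc x hx.1.1 w hw).1)
      (fun x hx => (hcirc x hx.1.1 _ (sphere_subset_closedBall hrs)).2 hrs)
    exact hx.2 (sub_eq_zero.2 (hHh x hx.1.1 hxdisc))

/- STATEMENT 9: holomorphic maps with values in a Hilbert space F extend
across an analytic set A ⊆ B that contains no principal germ at any of its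
points (in particular codim A ≥ 2). -/

theorem extension_across_no_principal_germ
    {L F : Type*} [NormedAddCommGroup L] [InnerProductSpace ℂ L] [CompleteSpace L]
    [TopologicalSpace.SeparableSpace L]
    [NormedAddCommGroup F] [InnerProductSpace ℂ F] [CompleteSpace F]
    (A : Set L) (hA : IsHilbertAnalyticIn A (ball (0 : L) 1))
    (hnp : ∀ a ∈ A, ¬ ContainsPrincipalGermAt A a)
    (h : L → F) (hh : DifferentiableOn ℂ h (ball (0 : L) 1 \ A)) :
    ∃ H : L → F, DifferentiableOn ℂ H (ball (0 : L) 1) ∧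
      Set.EqOn H h (ball (0 : L) 1 \ A) := by
  rcases subsingleton_or_nontrivial L with hL | hL
  · exact ⟨h, fun z _ => (hasFDerivAt_of_subsingleton h z).differentiableAt.differentiableWithinAt,
      fun _ _ => rfl⟩
  have hopen := hA.isOpen_diff
  have hdense := dense_compl_of_no_principal_germ hnp
  have hcl : ball (0 : L) 1 ⊆ closure (ball (0 : L) 1 \ A) :=
    hdense.open_subset_closure_inter isOpen_ball
  have hlocal : ∀ a ∈ ball (0 : L) 1, ∃ N : Set L, IsOpen N ∧ a ∈ N ∧ ∃ H : L → F,
      DifferentiableOn ℂ H N ∧ EqOn H h (N \ A) ∧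
      EqOn (extendFrom (ball (0 : L) 1 \ A) h) H N := by
    intro a ha
    obtain ⟨N, hN, haN, hNB, H, hH, hHh⟩ := exists_local_extension hA hnp hh ha
    refine ⟨N, hN, haN, H, hH, hHh, fun z hz => extendFrom_eq (hcl (hNB hz)) ?_⟩
    have hc : ContinuousAt H z := hH.continuousOn.continuousAt (hN.mem_nhds hz)
    refine (hc.mono_left nhdsWithin_le_nhds).congr' ?_
    filter_upwards [self_mem_nhdsWithin, mem_nhdsWithin_of_mem_nhds (hN.mem_nhds hz)] with x hx hxN
    exact hHh ⟨hxN, hx.2⟩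
  refine ⟨extendFrom (ball (0 : L) 1 \ A) h, fun a ha => ?_, fun a ha => ?_⟩
  · obtain ⟨N, hN, haN, H, hH, -, hext⟩ := hlocal a ha
    exact ((hH.differentiableAt (hN.mem_nhds haN)).congr_of_eventuallyEq
      (Filter.eventually_of_mem (hN.mem_nhds haN) hext)).differentiableWithinAt
  · obtain ⟨N, hN, haN, H, hH, hHh, hext⟩ := hlocal a ha.1
    rw [hext haN, hHh ⟨haN, ha.2⟩]
end
end
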